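/- Let Λ be the completed preprojective algebra of a non-Dynkin graph and W its Coxeter group. For each w ∈ W, the ideal I_w is a tilting Λ-module of projective dimension at most one, and the map w ↦ I_w is an anti-isomorphism of posets from W with the right weak order onto ⟨I_1,...,I_n⟩ ordered by S ≥ T iff Ext^1_Λ(S,T) = 0. -/

import Mathlib

set_option linter.unusedSectionVars false

section PathAlgebra

variable {K : Type} [Field K] {ι : Type} [Fintype ι] [LinearOrder ι]

/-- Paths in the double quiver of the graph with `m i j` edges between `i` and `j`. -/
inductive Pth (m : ι → ι → ℕ) : ι → ι → Type
  | nil (i : ι) : Pth m i i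
  | cons {i j k : ι} (a : Fin (m i j)) (p : Pth m j k) : Pth m i k

/-- The length of a path. -/
def Pth.len {m : ι → ι → ℕ} : ∀ {i j : ι}, Pth m i j → ℕ
  | _, _, .nil _ => 0
  | _, _, .cons _ p => p.len + 1

variable {m : ι → ι → ℕ}

/-- Convolution helper: `go g i F k p` is the coefficient at `p` of the product `F * g` where
`F` is a family of coefficients for paths starting at `i`. -/
def go (g : ∀ i j : ι, Pth m i j → K) : ∀ (i : ι), (∀ j, Pth m i j → K) → ∀ (k : ι), Pth m i k → K
  | i, F, _, .nil _ => F i (.nil i) * g i i (.nil i)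
  | i, F, k, .cons (j := j) a p =>
      F i (.nil i) * g i k (.cons a p) + go g j (fun j' q => F j' (.cons a q)) k p

lemma go_congrF (g : ∀ i j : ι, Pth m i j → K) {i k : ι} {F F' : ∀ j, Pth m i j → K}
    (h : ∀ j q, F j q = F' j q) (p : Pth m i k) : go g i F k p = go g i F' k p := by
  have : F = F' := funext fun j => funext (h j)
  rw [this]

lemma go_addF (g : ∀ i j : ι, Pth m i j → K) :
    ∀ {i k : ι} (F F' : ∀ j, Pth m i j → K) (p : Pth m i k),
    go g i (fun j q => F j q + F' j q) k p = go g i F k p + go g i F' k p := by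
  intro i k F F' p
  induction p with
  | nil i => simp [go, add_mul]
  | cons a p ih =>
      simp only [go]
      rw [ih]
      ring

lemma go_mulF (g : ∀ i j : ι, Pth m i j → K) (c : K) :
    ∀ {i k : ι} (F : ∀ j, Pth m i j → K) (p : Pth m i k),
    go g i (fun j q => c * F j q) k p = c * go g i F k p := by
  intro i k F p
  induction p with
  | nil i => simp [go]; ring
  | cons a p ih =>
      simp only [go]
      rw [ih]
      ring

lemma go_zeroF (g : ∀ i j : ι, Pth m i j → K) : ∀ {i k : ι} (p : Pth m i k),
    go g i (fun _ _ => (0 : K)) k p = 0 := by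
  intro i k p
  induction p with
  | nil i => simp [go]
  | cons a p ih => simp [go, ih]

lemma go_addg (g g' : ∀ i j : ι, Pth m i j → K) :
    ∀ {i k : ι} (F : ∀ j, Pth m i j → K) (p : Pth m i k),
    go (fun i j q => g i j q + g' i j q) i F k p = go g i F k p + go g' i F k p := by
  intro i k F p
  induction p with
  | nil i => simp [go]; ring
  | cons a p ih =>
      simp only [go]
      rw [ih]
      ring

lemma go_zerog : ∀ {i k : ι} (F : ∀ j, Pth m i j → K) (p : Pth m i k),
    go (fun _ _ _ => (0 : K)) i F k p = 0 := by
  intro i k F p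
  induction p with
  | nil i => simp [go]
  | cons a p ih => simp [go, ih]

/-- Raw convolution product. -/
def mulRaw (f g : ∀ i j : ι, Pth m i j → K) : ∀ i j : ι, Pth m i j → K :=
  fun i k p => go g i (f i) k p

lemma go_assoc (g h : ∀ i j : ι, Pth m i j → K) :
    ∀ {i l : ι} (F : ∀ j, Pth m i j → K) (r : Pth m i l),
    go h i (fun k p => go g i F k p) l r = go (mulRaw g h) i F l r := by
  intro i l F r
  induction r with
  | nil i => simp [go, mulRaw, mul_assoc]
  | cons a r ih =>
      rename_i i0 j0 l0
      simp only [go, mulRaw]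
      rw [go_congrF h (F' := fun k p => F i0 (.nil i0) * g i0 k (.cons a p) +
            go g j0 (fun j' q => F j' (.cons a q)) k p) (fun k p => by simp only [go])]
      rw [go_addF h, go_mulF h, ih]
      ring

lemma go_oneF (f : ∀ i j : ι, Pth m i j → K) : ∀ {i k : ι} (p : Pth m i k),
    go f i (fun j q => (match q with | .nil _ => (1 : K) | .cons _ _ => 0 : K)) k p
      = f i k p := by
  intro i k p
  induction p with
  | nil i => simp [go]
  | cons a p ih =>
      simp only [go]
      rw [go_congrF f (F' := fun _ _ => (0 : K)) (fun j q => rfl), go_zeroF]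
      ring

lemma go_oneg : ∀ {i k : ι} (F : ∀ j, Pth m i j → K) (p : Pth m i k),
    go (fun _ _ q => (match q with | .nil _ => (1 : K) | .cons _ _ => 0 : K)) i F k p
      = F k p := by
  intro i k F p
  induction p with
  | nil i => simp [go]
  | cons a p ih => simp [go, ih]

/-- The complete path algebra of the double quiver of the graph `m`: formal possibly infinite
`K`-linear combinations of paths. -/
@[ext]
structure PreE (K : Type) [Field K] {ι : Type} (m : ι → ι → ℕ) where
  coeff : ∀ i j : ι, Pth m i j → K

namespace PreE

instance : Zero (PreE K m) := ⟨⟨fun _ _ _ => 0⟩⟩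
instance : Add (PreE K m) := ⟨fun f g => ⟨fun i j p => f.coeff i j p + g.coeff i j p⟩⟩
instance : Neg (PreE K m) := ⟨fun f => ⟨fun i j p => -f.coeff i j p⟩⟩
instance : One (PreE K m) :=
  ⟨⟨fun _ _ q => (match q with | .nil _ => (1 : K) | .cons _ _ => 0 : K)⟩⟩
instance : Mul (PreE K m) := ⟨fun f g => ⟨mulRaw f.coeff g.coeff⟩⟩

instance instRing : Ring (PreE K m) :=
  Ring.ofMinimalAxioms
    (fun a b c => by ext i j p; exact add_assoc _ _ _)
    (fun a => by ext i j p; exact zero_add _)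
    (fun a => by ext i j p; exact neg_add_cancel _)
    (fun a b c => by
      ext i l r
      exact go_assoc b.coeff c.coeff (a.coeff i) r)
    (fun a => by ext i k p; exact go_oneF a.coeff p)
    (fun a => by ext i k p; exact go_oneg (a.coeff i) p)
    (fun a b c => by
      ext i k p
      exact go_addg b.coeff c.coeff (a.coeff i) p)
    (fun a b c => by
      ext i k p
      exact go_addF c.coeff (a.coeff i) (b.coeff i) p)

end PreE

end PathAlgebra

section Preprojective

variable (K : Type) [Field K] {ι : Type} [Fintype ι] [LinearOrder ι]

/-- The preprojective relation `ρ = Σ_{α ∈ Q₁} (α α* - α* α)`, an element of the complete path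
algebra: it assigns to each two-cycle `i → j → i` through matching dual arrows the
coefficient `+1` if `i < j` and `-1` if `j < i`. -/
def rho (m : ι → ι → ℕ) : PreE K m :=
  ⟨fun i k p =>
    match p with
    | .nil _ => 0
    | .cons (j := j) a q =>
        match q with
        | .nil _ => 0
        | .cons b q' =>
            match q' with
            | .cons _ _ => 0
            | .nil _ =>
                if k = i then
                  (if (a : ℕ) = (b : ℕ) then (if i < j then (1 : K) else -1) else 0)
                else 0⟩

/-- The two-sided ideal generated by the preprojective relation. -/
def relIdeal (m : ι → ι → ℕ) : TwoSidedIdeal (PreE K m) :=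
  TwoSidedIdeal.span {rho K m}

/-- The closure of the preprojective ideal with respect to the arrow-adic topology. -/
def relClosure (m : ι → ι → ℕ) : Set (PreE K m) :=
  {f | ∀ n : ℕ, ∃ g ∈ relIdeal K m, ∀ (i j : ι) (p : Pth m i j),
    p.len < n → f.coeff i j p = g.coeff i j p}

/-- The congruence defining the complete preprojective algebra. -/
def ppCon (m : ι → ι → ℕ) : RingCon (PreE K m) :=
  ringConGen (fun x y => x - y ∈ relClosure K m)

/-- The complete preprojective algebra of the graph `m`. -/
def PPA (m : ι → ι → ℕ) : Type := (ppCon K m).Quotient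

instance (m : ι → ι → ℕ) : Ring (PPA K m) :=
  inferInstanceAs (Ring (ppCon K m).Quotient)

/-- The idempotent `e_i` of the complete preprojective algebra. -/
def eIdem (m : ι → ι → ℕ) (i : ι) : PPA K m :=
  (ppCon K m).mk'
    ⟨fun _ _ p => match p with
      | .nil v => if v = i then (1 : K) else 0
      | .cons _ _ => 0⟩

/-- The tilting ideal `I_i = Λ(1 - e_i)Λ`. -/
def Igen (m : ι → ι → ℕ) (i : ι) : TwoSidedIdeal (PPA K m) :=
  TwoSidedIdeal.span {1 - eIdem K m i}

/-- The product of two two-sided ideals. -/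
def tmul {R : Type} [Ring R] (I J : TwoSidedIdeal R) : TwoSidedIdeal R :=
  TwoSidedIdeal.span {x | ∃ a ∈ I, ∃ b ∈ J, x = a * b}

/-- The product ideal `I_{i_1} ⋯ I_{i_l}` associated to a word in the vertices;
the empty word gives `I_id = Λ`. -/
def prodI (m : ι → ι → ℕ) (l : List ι) : TwoSidedIdeal (PPA K m) :=
  l.foldr (fun i acc => tmul (Igen K m i) acc) ⊤

end Preprojective

section Tilting

variable (Λ : Type) [Ring Λ]

/-- `Ext¹_Λ(S, T) = 0`: every short exact sequence `0 → T → E → S → 0` splits. -/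
def Ext1Vanishes (S : Type) [AddCommGroup S] [Module Λ S]
    (T : Type) [AddCommGroup T] [Module Λ T] : Prop :=
  ∀ (E : Type) [AddCommGroup E] [Module Λ E] (i : T →ₗ[Λ] E) (p : E →ₗ[Λ] S),
    Function.Injective i → Function.Surjective p → Function.Exact i p →
    ∃ s : S →ₗ[Λ] E, p ∘ₗ s = LinearMap.id

/-- A tilting module of projective dimension at most one: (i) there is an exact sequence
`0 → P₁ → P₀ → T → 0` with `P₀, P₁` finitely generated projective, (ii) `Ext¹(T, T) = 0`, and
(iii) there is an exact sequence `0 → Λ → T₀ → T₁ → 0` with `T₀, T₁ ∈ add T` (direct summands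
of finite direct sums of copies of `T`). -/
def IsTiltingModule (T : Type) [AddCommGroup T] [Module Λ T] : Prop :=
  (∃ (n : ℕ) (p : (Fin n → Λ) →ₗ[Λ] T), Function.Surjective p ∧
      Module.Finite Λ (LinearMap.ker p) ∧ Module.Projective Λ (LinearMap.ker p)) ∧
  Ext1Vanishes Λ T T ∧
  (∃ (n n' : ℕ) (V : Submodule Λ (Fin n → T)) (V' : Submodule Λ (Fin n' → T))
      (_ : ∃ W, IsCompl V W) (_ : ∃ W', IsCompl V' W')
      (u : Λ →ₗ[Λ] V) (v : V →ₗ[Λ] V'),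
      Function.Injective u ∧ Function.Surjective v ∧ Function.Exact u v)

end Tilting

section CoxeterGeometry

open CoxeterSystem

variable {ι : Type} [DecidableEq ι]

/-- The simple reflection `σ_j` acting on the weight lattice of the graph `m`. -/
def weightRefl (m : ι → ι → ℕ) (j : ι) (f : ι → ℤ) : ι → ℤ :=
  fun i => if i = j then -f j else f i + m i j * f j

lemma weightRefl_same (m : ι → ι → ℕ) (j : ι) (f : ι → ℤ) : weightRefl m j f j = -f j := by
  simp [weightRefl]

lemma weightRefl_of_ne (m : ι → ι → ℕ) {i j : ι} (h : i ≠ j) (f : ι → ℤ) :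
    weightRefl m j f i = f i + m i j * f j := by
  simp [weightRefl, h]

lemma weightRefl_neg (m : ι → ι → ℕ) (j : ι) (f : ι → ℤ) :
    weightRefl m j (-f) = -weightRefl m j f := by
  ext i
  by_cases h : i = j <;> simp [weightRefl, h]
  ring

lemma weightRefl_weightRefl (m : ι → ι → ℕ) (j : ι) (f : ι → ℤ) :
    weightRefl m j (weightRefl m j f) = f := by
  ext i
  by_cases h : i = j <;> simp [weightRefl, h]

/-- The simple reflection as an element of the monoid of self-maps of the weight lattice. -/
def weightReflEnd (m : ι → ι → ℕ) (j : ι) : Function.End (ι → ℤ) := weightRefl m j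

/-- The Coxeter matrix attached to the multigraph `m`. -/
def IsCoxeterOf (m : ι → ι → ℕ) (M : CoxeterMatrix ι) : Prop :=
  ∀ i j, i ≠ j → M i j = if m i j = 0 then 2 else if m i j = 1 then 3 else 0

variable {m : ι → ι → ℕ} {M : CoxeterMatrix ι}

lemma weightRefl_isLiftable (hsymm : ∀ i j, m i j = m j i) (hM : IsCoxeterOf m M) :
    M.IsLiftable (weightReflEnd m) := by
  intro i j
  by_cases hij : i = j
  · subst hij
    rw [M.diagonal, pow_one]
    funext f
    exact weightRefl_weightRefl m i f
  · have hji : j ≠ i := fun h => hij h.symm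
    rw [hM i j hij]
    split_ifs with h0 h1
    · funext f
      have h0' : m j i = 0 := by rw [hsymm, h0]
      change weightRefl m i (weightRefl m j (weightRefl m i (weightRefl m j f))) = f
      funext k
      by_cases hki : k = i
      · subst hki; simp [weightRefl, hij, hji, h0, h0']
      by_cases hkj : k = j
      · subst hkj; simp [weightRefl, hji, h0']
      simp [weightRefl, hij, hji, hki, hkj, h0, h0']
      ring
    · funext f
      have h1' : m j i = 1 := by rw [hsymm, h1]
      change weightRefl m i (weightRefl m j (weightRefl m i (weightRefl m j
        (weightRefl m i (weightRefl m j f))))) = f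
      funext k
      by_cases hki : k = i
      · subst hki; simp [weightRefl, hij, hji, h1, h1']
      by_cases hkj : k = j
      · subst hkj; simp [weightRefl, hij, hji, h1, h1']
      simp [weightRefl, hij, hji, hki, hkj, h1, h1']
      ring
    · exact pow_zero _

variable {W : Type} [Group W] (cs : CoxeterSystem M W)

/-- The action of the Coxeter group on the weight lattice. -/
def weightAct (hsymm : ∀ i j, m i j = m j i) (hM : IsCoxeterOf m M) :
    W →* Function.End (ι → ℤ) :=
  cs.lift ⟨weightReflEnd m, weightRefl_isLiftable hsymm hM⟩

/-- `heights cs f w i` is the value of the weight `f` on the root `w α_i`. -/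
def heights (hsymm : ∀ i j, m i j = m j i) (hM : IsCoxeterOf m M) (f : ι → ℤ) (w : W) : ι → ℤ :=
  weightAct cs hsymm hM w⁻¹ f

variable (hsymm : ∀ i j, m i j = m j i) (hM : IsCoxeterOf m M)

lemma heights_one (f : ι → ℤ) : heights cs hsymm hM f 1 = f := by
  simp only [heights, inv_one, map_one]
  rfl

lemma heights_mul (f : ι → ℤ) (w x : W) :
    heights cs hsymm hM f (w * x) = heights cs hsymm hM (heights cs hsymm hM f w) x := by
  simp only [heights, mul_inv_rev, map_mul]
  rfl

lemma heights_simple (f : ι → ℤ) (j : ι) :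
    heights cs hsymm hM f (cs.simple j) = weightRefl m j f := by
  simp only [heights, inv_simple, weightAct]
  rw [cs.lift_apply_simple]
  rfl

lemma heights_mul_simple (f : ι → ℤ) (w : W) (j : ι) :
    heights cs hsymm hM f (w * cs.simple j) = weightRefl m j (heights cs hsymm hM f w) := by
  rw [heights_mul, heights_simple]

lemma heights_neg (f : ι → ℤ) (w : W) :
    heights cs hsymm hM (-f) w = -heights cs hsymm hM f w := by
  induction w using cs.simple_induction_right with
  | one => simp [heights_one]
  | mul_simple_right w i ih => rw [heights_mul_simple, heights_mul_simple, ih, weightRefl_neg]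

lemma simple_comm (hM : IsCoxeterOf m M)
    {i j : ι} (hij : i ≠ j) (h : m i j = 0) :
    cs.simple i * cs.simple j = cs.simple j * cs.simple i := by
  have := cs.simple_mul_simple_pow i j
  rw [hM i j hij, if_pos h, pow_two] at this
  have h2 := eq_inv_of_mul_eq_one_left this
  simpa [mul_inv_rev] using h2

lemma simple_braid (hM : IsCoxeterOf m M)
    {i j : ι} (hij : i ≠ j) (h : m i j = 1) :
    cs.simple i * cs.simple j * cs.simple i = cs.simple j * cs.simple i * cs.simple j := by
  have := cs.simple_mul_simple_pow i j
  rw [hM i j hij, if_neg (by omega), if_pos h, pow_succ, pow_two] at this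
  have h2 : (cs.simple i * cs.simple j * cs.simple i) *
      (cs.simple j * cs.simple i * cs.simple j) = 1 := by
    simpa [mul_assoc] using this
  have h3 := eq_inv_of_mul_eq_one_left h2
  simpa [mul_inv_rev, mul_assoc] using h3

lemma heights_pos_aux {f : ι → ℤ} (hf : ∀ i, 0 < f i) (n : ℕ) : ∀ w : W, cs.length w = n →
    (∀ i, ¬ cs.IsRightDescent w i → 0 < heights cs hsymm hM f w i) ∧
    (∀ s t, s ≠ t → 2 ≤ m s t → cs.IsRightDescent w t → ¬ cs.IsRightDescent w s →
      0 < heights cs hsymm hM f w s + heights cs hsymm hM f w t) := by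
  induction n using Nat.strong_induction_on with
  | _ n ih =>
  intro w hw
  have key : ∀ s t, s ≠ t → cs.IsRightDescent w t → ¬ cs.IsRightDescent w s →
      0 < heights cs hsymm hM f w s ∧
      (2 ≤ m s t → 0 < heights cs hsymm hM f w s + heights cs hsymm hM f w t) := by
    intro s t hst ht hs
    obtain ⟨w1, rfl⟩ : ∃ w1, w = w1 * cs.simple t := ⟨w * cs.simple t, by simp⟩
    have h1 : cs.length (w1 * cs.simple t) = cs.length w1 + 1 := by
      have := (cs.isRightDescent_iff).1 ht
      simpa using this.symm
    have ht1 : ¬ cs.IsRightDescent w1 t := by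
      rw [IsRightDescent]; omega
    have ihw1 := ih _ (by omega) w1 rfl
    have hy := ihw1.1 t ht1
    have hmst : m t s = m s t := hsymm t s
    rw [heights_mul_simple, weightRefl_same, weightRefl_of_ne m hst]
    set x := heights cs hsymm hM f w1 s with hx
    set y := heights cs hsymm hM f w1 t with hyy
    by_cases hs1 : cs.IsRightDescent w1 s
    · by_cases h2 : 2 ≤ m s t
      · have := ihw1.2 t s (Ne.symm hst) (by omega) hs1 ht1
        have h2' : (2 : ℤ) ≤ m s t := by exact_mod_cast h2
        constructor
        · nlinarith
        · intro _; nlinarith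
      · refine ⟨?_, fun h => absurd h h2⟩
        obtain ⟨w2, rfl⟩ : ∃ w2, w1 = w2 * cs.simple s := ⟨w1 * cs.simple s, by simp⟩
        have h3 : cs.length (w2 * cs.simple s) = cs.length w2 + 1 := by
          have := (cs.isRightDescent_iff).1 hs1
          simpa using this.symm
        have hs' := (cs.not_isRightDescent_iff).1 hs
        have h01 : m s t = 0 ∨ m s t = 1 := by omega
        rcases h01 with h0 | h0
        · exfalso
          rw [mul_assoc w2, simple_comm cs hM hst h0, ← mul_assoc w2,
            simple_mul_simple_cancel_right] at hs'
          rw [mul_assoc w2, simple_comm cs hM hst h0, ← mul_assoc w2] at h1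
          have := cs.length_mul_le w2 (cs.simple t)
          rw [length_simple] at this
          omega
        · by_cases ht2 : cs.IsRightDescent w2 t
          · exfalso
            obtain ⟨w3, rfl⟩ : ∃ w3, w2 = w3 * cs.simple t := ⟨w2 * cs.simple t, by simp⟩
            have h4 : cs.length (w3 * cs.simple t) = cs.length w3 + 1 := by
              have := (cs.isRightDescent_iff).1 ht2
              simpa using this.symm
            have e1 : w3 * cs.simple t * cs.simple s * cs.simple t * cs.simple s =
                w3 * cs.simple s * cs.simple t := by
              have := simple_braid cs hM hst h0
              calc _ = w3 * (cs.simple t * cs.simple s * cs.simple t) * cs.simple s := by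
                    simp [mul_assoc]
                _ = _ := by rw [← this]; simp [mul_assoc]
            rw [e1] at hs'
            have a1 := cs.length_mul_le (w3 * cs.simple s) (cs.simple t)
            have a2 := cs.length_mul_le w3 (cs.simple s)
            rw [length_simple] at a1 a2
            omega
          · have := (ih _ (by omega) w2 rfl).1 t ht2
            have e1 : x = -heights cs hsymm hM f w2 s := by
              rw [hx, heights_mul_simple, weightRefl_same]
            have e2 : y = heights cs hsymm hM f w2 t + heights cs hsymm hM f w2 s := by
              rw [hyy, heights_mul_simple, weightRefl_of_ne m (Ne.symm hst), hmst, h0]; simp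
            rw [e1, e2, h0]
            push_cast
            linarith
    · have hxp := ihw1.1 s hs1
      constructor
      · positivity
      · intro h2
        have h2' : (2 : ℤ) ≤ m s t := by exact_mod_cast h2
        nlinarith
  refine ⟨fun i hi => ?_, fun s t hst h2 ht hs => (key s t hst ht hs).2 h2⟩
  by_cases h1 : w = 1
  · subst h1; rw [heights_one]; exact hf i
  · obtain ⟨t, ht⟩ := cs.exists_rightDescent_of_ne_one h1
    exact (key i t (fun h => hi (h ▸ ht)) ht hi).1

lemma heights_pos {f : ι → ℤ} (hf : ∀ i, 0 < f i) {w : W} {i : ι}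
    (h : ¬ cs.IsRightDescent w i) : 0 < heights cs hsymm hM f w i :=
  (heights_pos_aux cs hsymm hM hf _ w rfl).1 i h

lemma heights_neg_of_descent {f : ι → ℤ} (hf : ∀ i, 0 < f i) {w : W} {i : ι}
    (h : cs.IsRightDescent w i) : heights cs hsymm hM f w i < 0 := by
  have := heights_pos cs hsymm hM hf (cs.isRightDescent_iff_not_isRightDescent_mul.1 h)
  rw [heights_mul_simple, weightRefl_same] at this
  linarith

lemma isRightDescent_of_heights_neg {f : ι → ℤ} (hf : ∀ i, 0 < f i) {w : W} {i : ι}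
    (h : heights cs hsymm hM f w i < 0) : cs.IsRightDescent w i := by
  by_contra hc
  have := heights_pos cs hsymm hM hf hc
  linarith

/-- Two distinct right descents span a finite dihedral group. -/
lemma lt_two_of_descents (hsymm : ∀ i j, m i j = m j i) (hM : IsCoxeterOf m M)
    {w : W} {s t : ι} (hst : s ≠ t) (hs : cs.IsRightDescent w s)
    (ht : cs.IsRightDescent w t) : m s t < 2 := by
  by_contra h2
  push Not at h2
  have hf : ∀ i : ι, (0 : ℤ) < (fun _ => (1 : ℤ)) i := fun _ => one_pos
  have key : ∀ n, ∀ w : W, cs.length w = n → ∀ s t, s ≠ t → 2 ≤ m s t →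
      0 < heights cs hsymm hM (fun _ => 1) w s →
      heights cs hsymm hM (fun _ => 1) w s + heights cs hsymm hM (fun _ => 1) w t < 0 →
      False := by
    intro n
    induction n using Nat.strong_induction_on with
    | _ n ih =>
    intro w hw s t hst h2 h3 h4
    have ht : cs.IsRightDescent w t :=
      isRightDescent_of_heights_neg cs hsymm hM hf (by linarith)
    refine ih _ (hw ▸ ht) (w * cs.simple t) rfl t s hst.symm (by rw [hsymm]; exact h2) ?_ ?_
    · rw [heights_mul_simple, weightRefl_same]; linarith
    · rw [heights_mul_simple, weightRefl_same, weightRefl_of_ne m hst]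
      have h2' : (2 : ℤ) ≤ m s t := by exact_mod_cast h2
      nlinarith
  have a := heights_neg_of_descent cs hsymm hM hf hs
  have b := heights_neg_of_descent cs hsymm hM hf ht
  refine key _ (w * cs.simple s) rfl s t hst h2 ?_ ?_
  · rw [heights_mul_simple, weightRefl_same]; linarith
  · rw [heights_mul_simple, weightRefl_same, weightRefl_of_ne m hst.symm, hsymm t s]
    have h2' : (2 : ℤ) ≤ m s t := by exact_mod_cast h2
    nlinarith

lemma length_of_descents_zero (hsymm : ∀ i j, m i j = m j i) (hM : IsCoxeterOf m M)
    {w : W} {s t : ι} (hst : s ≠ t) (hs : cs.IsRightDescent w s)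
    (ht : cs.IsRightDescent w t) (h0 : m s t = 0) :
    cs.length (w * cs.simple s * cs.simple t) + 2 = cs.length w := by
  have hf : ∀ i : ι, (0 : ℤ) < (fun _ => (1 : ℤ)) i := fun _ => one_pos
  have b := heights_neg_of_descent cs hsymm hM hf ht
  have h1 : cs.IsRightDescent (w * cs.simple s) t := by
    apply isRightDescent_of_heights_neg cs hsymm hM hf
    rw [heights_mul_simple, weightRefl_of_ne m hst.symm, hsymm t s, h0]
    simpa using b
  have := cs.isRightDescent_iff.1 hs
  have := cs.isRightDescent_iff.1 h1
  omega

lemma length_of_descents_one (hsymm : ∀ i j, m i j = m j i) (hM : IsCoxeterOf m M)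
    {w : W} {s t : ι} (hst : s ≠ t) (hs : cs.IsRightDescent w s)
    (ht : cs.IsRightDescent w t) (h0 : m s t = 1) :
    cs.length (w * cs.simple s * cs.simple t * cs.simple s) + 3 = cs.length w := by
  have hf : ∀ i : ι, (0 : ℤ) < (fun _ => (1 : ℤ)) i := fun _ => one_pos
  have a := heights_neg_of_descent cs hsymm hM hf hs
  have b := heights_neg_of_descent cs hsymm hM hf ht
  have h1 : cs.IsRightDescent (w * cs.simple s) t := by
    apply isRightDescent_of_heights_neg cs hsymm hM hf
    rw [heights_mul_simple, weightRefl_of_ne m hst.symm, hsymm t s, h0]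
    push_cast; linarith
  have h2 : cs.IsRightDescent (w * cs.simple s * cs.simple t) s := by
    apply isRightDescent_of_heights_neg cs hsymm hM hf
    rw [heights_mul_simple, weightRefl_of_ne m hst, heights_mul_simple, weightRefl_same,
      weightRefl_of_ne m hst.symm, hsymm t s, h0]
    push_cast; linarith
  have := cs.isRightDescent_iff.1 hs
  have := cs.isRightDescent_iff.1 h1
  have := cs.isRightDescent_iff.1 h2
  omega

/-- Matsumoto's theorem: a family in a monoid satisfying the braid relations takes the same
product on any two reduced words of the same element. -/
lemma prod_map_eq_of_reduced (hsymm : ∀ i j, m i j = m j i) (hM : IsCoxeterOf m M)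
    {N : Type*} [Monoid N] (g : ι → N)
    (hcomm : ∀ i j, i ≠ j → m i j = 0 → g i * g j = g j * g i)
    (hbraid : ∀ i j, i ≠ j → m i j = 1 → g i * g j * g i = g j * g i * g j) (n : ℕ) :
    ∀ l l' : List ι, l.length = n → cs.IsReduced l → cs.IsReduced l' →
      cs.wordProd l = cs.wordProd l' → (l.map g).prod = (l'.map g).prod := by
  induction n using Nat.strong_induction_on with
  | _ n ih =>
  intro l l' hl hr hr' hw
  have hlen : l'.length = l.length := by rw [← hr.eq, ← hr'.eq, hw]
  rcases List.eq_nil_or_concat l with rfl | ⟨l1, s, rfl⟩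
  · have : l' = [] := List.length_eq_zero_iff.1 (by simpa using hlen)
    rw [this]
  rcases List.eq_nil_or_concat l' with rfl | ⟨l1', t, rfl⟩
  · simp at hlen
  have red : ∀ (q : List ι) (a : ι), cs.IsReduced (q.concat a) →
      cs.IsReduced q ∧ cs.IsRightDescent (cs.wordProd (q.concat a)) a := by
    intro q a hq
    have h1 := hq.take q.length
    rw [List.concat_eq_append, List.take_left] at h1
    refine ⟨h1, ?_⟩
    rw [IsRightDescent, hq.eq, wordProd_concat, simple_mul_simple_cancel_right, h1.eq]
    simp
  obtain ⟨hr1, hd1⟩ := red _ _ hr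
  obtain ⟨hr1', hd1'⟩ := red _ _ hr'
  rw [List.length_concat] at hl hlen
  rw [List.length_concat] at hlen
  -- a reduced word with a prescribed ending
  have step : ∀ (q : List ι) (a : ι) (q' : List ι), q.length < n → cs.IsReduced q →
      cs.wordProd q = cs.wordProd q' → q'.length = q.length → (q.map g).prod = (q'.map g).prod := by
    intro q a q' hq hq1 hqq hl'
    refine ih _ hq q q' rfl hq1 ?_ hqq
    rw [CoxeterSystem.IsReduced, ← hqq, hq1.eq, hl']
  by_cases hst : s = t
  · subst hst
    have : cs.wordProd l1 = cs.wordProd l1' := by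
      rw [wordProd_concat, wordProd_concat] at hw
      exact mul_right_cancel hw
    have := ih l1.length (by omega) l1 l1' rfl hr1 hr1' this
    simp [this]
  rw [← hw] at hd1'
  set w := cs.wordProd (l1.concat s) with hwdef
  have hm := lt_two_of_descents cs hsymm hM hst hd1 hd1'
  have hlw : cs.length w = n := by rw [hwdef, hr.eq, List.length_concat, hl]
  have e1 : cs.wordProd l1 = w * cs.simple s := by rw [hwdef, wordProd_concat]; simp
  have e1' : cs.wordProd l1' = w * cs.simple t := by rw [hw, wordProd_concat]; simp
  have h01 : m s t = 0 ∨ m s t = 1 := by omega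
  rcases h01 with h0 | h0
  · have hl2 := length_of_descents_zero cs hsymm hM hst hd1 hd1' h0
    obtain ⟨v, hv, hvw⟩ := cs.exists_isReduced (w * cs.simple s * cs.simple t)
    have hvl : v.length + 2 = n := by rw [← hv.eq, ← hvw, hl2, hlw]
    have a1 := step l1 s (v.concat t) (by omega) hr1
      (by rw [e1, wordProd_concat, ← hvw]; simp) (by rw [List.length_concat]; omega)
    have a2 := step l1' s (v.concat s) (by omega) hr1'
      (by rw [e1', wordProd_concat, ← hvw, mul_assoc w, simple_comm cs hM hst h0, ← mul_assoc]
          simp) (by rw [List.length_concat]; omega)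
    simp only [List.concat_eq_append, List.map_append, List.prod_append, List.map_cons,
      List.map_nil, List.prod_cons, List.prod_nil, mul_one] at a1 a2 ⊢
    rw [a1, a2, mul_assoc, mul_assoc, hcomm s t hst h0]
  · have hl2 := length_of_descents_one cs hsymm hM hst hd1 hd1' h0
    obtain ⟨v, hv, hvw⟩ := cs.exists_isReduced (w * cs.simple s * cs.simple t * cs.simple s)
    have hvl : v.length + 3 = n := by rw [← hv.eq, ← hvw, hl2, hlw]
    have a1 := step l1 s ((v.concat s).concat t) (by omega) hr1
      (by rw [e1, wordProd_concat, wordProd_concat, ← hvw]; simp)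
      (by simp only [List.length_concat]; omega)
    have a2 := step l1' s ((v.concat t).concat s) (by omega) hr1'
      (by rw [e1', wordProd_concat, wordProd_concat, ← hvw, mul_assoc w, mul_assoc w,
            simple_braid cs hM hst h0]
          simp [← mul_assoc])
      (by simp only [List.length_concat]; omega)
    simp only [List.concat_eq_append, List.map_append, List.prod_append, List.map_cons,
      List.map_nil, List.prod_cons, List.prod_nil, mul_one] at a1 a2 ⊢
    have := hbraid s t hst h0
    rw [a1, a2]
    calc _ = (v.map g).prod * (g s * g t * g s) := by simp only [mul_assoc]
      _ = _ := by rw [this]; simp only [mul_assoc]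

/-- In an infinite Coxeter group no element has all simple reflections as right descents. -/
lemma exists_not_rightDescent (hsymm : ∀ i j, m i j = m j i) (hM : IsCoxeterOf m M)
    [Finite ι] [Infinite W] (w : W) :
    ∃ i, ¬ cs.IsRightDescent w i := by
  by_contra hall
  push Not at hall
  have hf : ∀ i : ι, (0 : ℤ) < (fun _ => (1 : ℤ)) i := fun _ => one_pos
  have hg : ∀ i : ι, 0 < (-heights cs hsymm hM (fun _ => 1) w) i := fun i => by
    have := heights_neg_of_descent cs hsymm hM hf (hall i)
    simpa using this
  have key : ∀ n, ∀ x : W, cs.length x = n → cs.length (w * x) + cs.length x = cs.length w := by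
    intro n
    induction n with
    | zero => intro x hx; rw [cs.length_eq_zero_iff] at hx; simp [hx]
    | succ n ih =>
      intro x hx
      obtain ⟨i, hi⟩ := cs.exists_rightDescent_of_ne_one
        (w := x) (fun h => by rw [h, length_one] at hx; omega)
      have h1 := cs.isRightDescent_iff.1 hi
      have h2 := ih (x * cs.simple i) (by omega)
      have h3 := heights_pos cs hsymm hM hg (cs.isRightDescent_iff_not_isRightDescent_mul.1 hi)
      rw [heights_neg, ← heights_mul] at h3
      have h4 : cs.IsRightDescent (w * (x * cs.simple i)) i :=
        isRightDescent_of_heights_neg cs hsymm hM hf (by simpa using h3)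
      have h5 := cs.isRightDescent_iff.1 h4
      rw [mul_assoc, simple_mul_simple_cancel_right] at h5
      omega
  have hfin : (Set.univ : Set W) ⊆ cs.wordProd '' {l : List ι | l.length ≤ cs.length w} := by
    intro x _
    obtain ⟨l, hl, rfl⟩ := cs.exists_isReduced x
    have := key _ (cs.wordProd l) rfl
    rw [hl.eq] at this
    exact ⟨l, by simp only [Set.mem_ofPred_eq]; omega, rfl⟩
  exact Set.infinite_univ (((List.finite_length_le ι _).image _).subset hfin)

/-- In an infinite irreducible Coxeter group, any element can be prolonged to one that does not
have a given simple reflection as right descent. -/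
lemma exists_prolong_not_descent (hsymm : ∀ i j, m i j = m j i) (hM : IsCoxeterOf m M)
    [Finite ι] [Infinite W]
    (hconn : (SimpleGraph.fromRel (fun i j => m i j ≠ 0)).Connected) (w : W) (i : ι) :
    ∃ x, cs.length (w * x) = cs.length w + cs.length x ∧ ¬ cs.IsRightDescent (w * x) i := by
  have hf : ∀ i : ι, (0 : ℤ) < (fun _ => (1 : ℤ)) i := fun _ => one_pos
  let le : W → W → Prop := fun u v => cs.length v = cs.length u + cs.length (u⁻¹ * v)
  have le_refl : ∀ u, le u u := fun u => by simp [le]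
  have le_trans : ∀ {u v z}, le u v → le v z → le u z := by
    intro u v z h1 h2
    simp only [le] at *
    have a := cs.length_mul_le (u⁻¹ * v) (v⁻¹ * z)
    have b := cs.length_mul_le u (u⁻¹ * z)
    have e : u⁻¹ * v * (v⁻¹ * z) = u⁻¹ * z := by group
    rw [e] at a
    rw [mul_inv_cancel_left] at b
    omega
  have le_simple : ∀ u j, ¬ cs.IsRightDescent u j → le u (u * cs.simple j) := by
    intro u j h
    simp only [le, inv_mul_cancel_left, length_simple]
    exact cs.not_isRightDescent_iff.1 h
  let perm : W → ι → Prop := fun u j => ∀ v, le u v → cs.IsRightDescent v j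
  have perm_mono : ∀ {u v j}, le u v → perm u j → perm v j :=
    fun h hp z hz => hp z (le_trans h hz)
  suffices ¬ perm w i by
    simp only [perm, not_forall] at this
    obtain ⟨v, hv, hvi⟩ := this
    refine ⟨w⁻¹ * v, ?_, ?_⟩
    · rw [mul_inv_cancel_left]; exact hv
    · rwa [mul_inv_cancel_left]
  intro hperm
  have adj_step : ∀ u j k, perm u j → j ≠ k → m j k ≠ 0 → ∃ v, le u v ∧ perm v k := by
    intro u j k hp hjk hm
    let S : Set ℕ := {n | ∃ v, le u v ∧ (n : ℤ) = -heights cs hsymm hM (fun _ => 1) v j}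
    have hS : S.Nonempty := by
      have := heights_neg_of_descent cs hsymm hM hf (hp u (le_refl u))
      exact ⟨(-heights cs hsymm hM (fun _ => 1) u j).toNat, u, le_refl u,
        by rw [Int.toNat_of_nonneg]; omega⟩
    obtain ⟨v, huv, hv⟩ := Nat.sInf_mem hS
    -- heights only increase along prolongations
    have mono : ∀ n, ∀ x : W, cs.length x = n → le v (v * x) →
        heights cs hsymm hM (fun _ => 1) v j ≤ heights cs hsymm hM (fun _ => 1) (v * x) j := by
      intro n
      induction n with
      | zero => intro x hx _; rw [cs.length_eq_zero_iff] at hx; simp [hx]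
      | succ n ih =>
        intro x hx hle
        obtain ⟨l, hl⟩ := cs.exists_rightDescent_of_ne_one
          (w := x) (fun h => by rw [h, length_one] at hx; omega)
        have h1 := cs.isRightDescent_iff.1 hl
        obtain ⟨y, rfl⟩ : ∃ y, x = y * cs.simple l := ⟨x * cs.simple l, by simp⟩
        rw [simple_mul_simple_cancel_right] at h1
        simp only [le, inv_mul_cancel_left] at hle
        have a := cs.length_mul_le v y
        have b := cs.length_mul_le (v * y) (cs.simple l)
        rw [length_simple, mul_assoc] at b
        have hvy : le v (v * y) := by
          simp only [le, inv_mul_cancel_left]; omega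
        have hnd : ¬ cs.IsRightDescent (v * y) l := by
          rw [IsRightDescent, mul_assoc]; omega
        have h2 := ih y (by omega) hvy
        have hlj : j ≠ l := by
          rintro rfl
          exact hnd (hp _ (le_trans huv hvy))
        rw [← mul_assoc, heights_mul_simple, weightRefl_of_ne m hlj]
        have := heights_pos cs hsymm hM hf hnd
        have : 0 ≤ (m j l : ℤ) * heights cs hsymm hM (fun _ => 1) (v * y) l := by positivity
        linarith
    refine ⟨v, huv, fun z hvz => ?_⟩
    by_contra hzk
    have hz : le u (z * cs.simple k) := le_trans huv (le_trans hvz (le_simple z k hzk))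
    have h1 := mono _ (v⁻¹ * z) rfl (by rw [mul_inv_cancel_left]; exact hvz)
    rw [mul_inv_cancel_left] at h1
    have h2 := heights_pos cs hsymm hM hf hzk
    have h3 : heights cs hsymm hM (fun _ => 1) (z * cs.simple k) j =
        heights cs hsymm hM (fun _ => 1) z j + m j k * heights cs hsymm hM (fun _ => 1) z k := by
      rw [heights_mul_simple, weightRefl_of_ne m hjk]
    have h4 := heights_neg_of_descent cs hsymm hM hf (hp _ hz)
    have hm' : (1 : ℤ) ≤ m j k := by exact_mod_cast Nat.one_le_iff_ne_zero.2 hm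
    have h5 : sInf S ≤ (-heights cs hsymm hM (fun _ => 1) (z * cs.simple k) j).toNat :=
      Nat.sInf_le ⟨_, hz, by rw [Int.toNat_of_nonneg]; omega⟩
    have h6 : heights cs hsymm hM (fun _ => 1) z k ≤
      m j k * heights cs hsymm hM (fun _ => 1) z k := by nlinarith
    omega
  have walk_step : ∀ u, le w u → ∀ j, ∃ v, le u v ∧ perm v j := by
    intro u₀ hu₀ j
    obtain ⟨p⟩ := hconn.preconnected i j
    suffices ∀ a b (q : (SimpleGraph.fromRel (fun i j => m i j ≠ 0)).Walk a b) u, le u₀ u →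
        perm u a → ∃ v, le u₀ v ∧ perm v b from
      this i j p u₀ (le_refl u₀) (perm_mono hu₀ hperm)
    intro a b q
    induction q with
    | nil => exact fun u h1 h2 => ⟨u, h1, h2⟩
    | cons hadj _ ih =>
      intro u h1 h2
      rw [SimpleGraph.fromRel_adj] at hadj
      obtain ⟨v, hv, hpv⟩ := adj_step u _ _ h2 hadj.1
        (by rcases hadj.2 with h | h
            · exact h
            · rw [hsymm]; exact h)
      exact ih v (le_trans h1 hv) hpv
  have hall : ∀ s : Finset ι, ∃ v, le w v ∧ ∀ j ∈ s, perm v j := by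
    intro s
    induction s using Finset.induction_on with
    | empty => exact ⟨w, le_refl w, by simp⟩
    | insert a s ha ih =>
      obtain ⟨v, hv, hvs⟩ := ih
      obtain ⟨v', hv', hva⟩ := walk_step v hv a
      refine ⟨v', le_trans hv hv', fun j hj => ?_⟩
      rcases Finset.mem_insert.1 hj with rfl | hj
      · exact hva
      · exact perm_mono hv' (hvs j hj)
  cases nonempty_fintype ι
  obtain ⟨v, -, hv⟩ := hall Finset.univ
  obtain ⟨j, hj⟩ := exists_not_rightDescent cs hsymm hM v
  exact hj (hv j (Finset.mem_univ j) v (le_refl v))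

end CoxeterGeometry

section DoubleQuiverRepresentations

variable (K : Type) [Field K] {ι : Type} [Fintype ι] [LinearOrder ι]

/-- The sign of the arrows `i → j` in the preprojective relation. -/
def ppSign (i j : ι) : K := if i < j then 1 else -1

lemma ppSign_swap {i j : ι} (h : i ≠ j) : ppSign K j i = -ppSign K i j := by
  rcases lt_or_gt_of_ne h with h | h <;> simp [ppSign, h, h.not_gt]

lemma ppSign_mul_self (i j : ι) : ppSign K i j * ppSign K i j = 1 := by
  unfold ppSign; split_ifs <;> simp

variable {K}

lemma exists_trace_comp_ne_zero {V W : Type} [AddCommGroup V] [Module K V]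
    [FiniteDimensional K V] [AddCommGroup W] [Module K W] {h : V →ₗ[K] W} (hh : h ≠ 0) :
    ∃ φ : W →ₗ[K] V, LinearMap.trace K V (φ ∘ₗ h) ≠ 0 := by
  obtain ⟨v, hv⟩ : ∃ v, h v ≠ 0 := by
    by_contra hc
    push Not at hc
    exact hh (LinearMap.ext hc)
  obtain ⟨f, hf⟩ := Module.Projective.exists_dual_ne_zero K hv
  refine ⟨f.smulRight v, ?_⟩
  have : f.smulRight v ∘ₗ h = (f ∘ₗ h).smulRight v := rfl
  rw [this, LinearMap.trace_smulRight]
  exact hf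

variable {m : ι → ι → ℕ} {V : ι → Type} [∀ i, AddCommGroup (V i)] [∀ i, Module K (V i)]

/-- The commutator map: `g ↦ (g_j α - α g_i)` over all arrows `α : i → j`. -/
def arrowComm (α : ∀ i j, ℕ → (V i →ₗ[K] V j)) :
    (∀ i, V i →ₗ[K] V i) →ₗ[K] (∀ i j, Fin (m i j) → (V i →ₗ[K] V j)) where
  toFun g := fun i j k => g j ∘ₗ α i j k - α i j k ∘ₗ g i
  map_add' g g' := by
    ext i j k x
    simp only [Pi.add_apply, LinearMap.sub_apply, LinearMap.comp_apply, LinearMap.add_apply,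
      map_add]
    abel
  map_smul' c g := by
    ext i j k x
    simp [smul_sub]

/-- The derivative of the preprojective relation, a map from families of maps along the arrows to
families of endomorphisms. -/
def relDeriv (hsymm : ∀ i j, m i j = m j i) (α : ∀ i j, ℕ → (V i →ₗ[K] V j)) :
    (∀ i j, Fin (m i j) → (V i →ₗ[K] V j)) →ₗ[K] (∀ i, V i →ₗ[K] V i) where
  toFun h := fun i => ∑ j, ∑ k : Fin (m i j), ppSign K i j •
    (α j i k ∘ₗ h i j k + h j i (Fin.cast (hsymm i j) k) ∘ₗ α i j k)
  map_add' h h' := by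
    ext i x
    simp only [Pi.add_apply, LinearMap.sum_apply, LinearMap.smul_apply, LinearMap.add_apply,
      LinearMap.comp_apply, map_add, ← Finset.sum_add_distrib, ← smul_add]
    refine Finset.sum_congr rfl fun j _ => Finset.sum_congr rfl fun k _ => ?_
    congr 1
    abel
  map_smul' c h := by
    ext i x
    simp only [Pi.smul_apply, LinearMap.sum_apply, LinearMap.smul_apply, LinearMap.add_apply,
      LinearMap.comp_apply, map_smul, ← Finset.smul_sum, ← smul_add, RingHom.id_apply]
    rw [Finset.smul_sum]
    refine Finset.sum_congr rfl fun j _ => ?_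
    rw [smul_comm]

lemma relDeriv_arrowComm (hsymm : ∀ i j, m i j = m j i) {α : ∀ i j, ℕ → (V i →ₗ[K] V j)}
    (hrel : ∀ i x, ∑ j, ∑ k : Fin (m i j), ppSign K i j • α j i k (α i j k x) = 0)
    (g : ∀ i, V i →ₗ[K] V i) : relDeriv hsymm α (arrowComm (m := m) α g) = 0 := by
  ext i x
  have h1 := hrel i (g i x)
  have h2 := congrArg (g i) (hrel i x)
  simp only [map_sum, map_smul, map_zero] at h2
  simp only [relDeriv, arrowComm, LinearMap.coe_mk, AddHom.coe_mk, LinearMap.sum_apply,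
    LinearMap.smul_apply, LinearMap.add_apply, LinearMap.comp_apply, LinearMap.sub_apply, map_sub,
    Fin.val_cast, Pi.zero_apply, LinearMap.zero_apply]
  refine Eq.trans ?_ ((congrArg₂ (· - ·) h2 h1).trans (sub_zero 0))
  simp only [← Finset.sum_sub_distrib, ← smul_sub]
  refine Finset.sum_congr rfl fun j _ => Finset.sum_congr rfl fun k _ => ?_
  congr 1
  abel

/-- The trace pairing between families of maps along opposite arrows. -/
noncomputable def arrowPairing (hsymm : ∀ i j, m i j = m j i) :
    (∀ i j, Fin (m i j) → (V i →ₗ[K] V j)) →ₗ[K]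
      Module.Dual K (∀ i j, Fin (m i j) → (V i →ₗ[K] V j)) :=
  LinearMap.mk₂ K (fun h h' => ∑ i, ∑ j, ∑ k : Fin (m i j), ppSign K i j *
      LinearMap.trace K (V i) (h' j i (Fin.cast (hsymm i j) k) ∘ₗ h i j k))
    (fun h₁ h₂ h' => by
      simp only [Pi.add_apply, LinearMap.comp_add, map_add, mul_add, Finset.sum_add_distrib])
    (fun c h h' => by
      simp only [Pi.smul_apply, LinearMap.comp_smul, map_smul, smul_eq_mul, Finset.mul_sum]
      simp only [mul_left_comm])
    (fun h₁ h₂ h' => by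
      simp only [Pi.add_apply, LinearMap.add_comp, map_add, mul_add, Finset.sum_add_distrib])
    (fun c h h' => by
      simp only [Pi.smul_apply, LinearMap.smul_comp, map_smul, smul_eq_mul, Finset.mul_sum]
      simp only [mul_left_comm])

lemma arrowPairing_apply (hsymm : ∀ i j, m i j = m j i)
    (h h' : ∀ i j, Fin (m i j) → (V i →ₗ[K] V j)) :
    arrowPairing hsymm h h' = ∑ i, ∑ j, ∑ k : Fin (m i j), ppSign K i j *
      LinearMap.trace K (V i) (h' j i (Fin.cast (hsymm i j) k) ∘ₗ h i j k) := rfl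

lemma comp_sum_right {U V W σ : Type} [AddCommGroup U] [Module K U] [AddCommGroup V] [Module K V]
    [AddCommGroup W] [Module K W] (f : V →ₗ[K] W) (s : Finset σ) (g : σ → U →ₗ[K] V) :
    f ∘ₗ ∑ a ∈ s, g a = ∑ a ∈ s, f ∘ₗ g a := by
  ext x
  simp

variable [∀ i, FiniteDimensional K (V i)]

lemma arrowPairing_injective (hsymm : ∀ i j, m i j = m j i) :
    Function.Injective (arrowPairing (K := K) (V := V) hsymm) := by
  rw [injective_iff_map_eq_zero]
  intro h h0
  by_contra hne
  obtain ⟨i, j, k, hk⟩ : ∃ i j k, h i j k ≠ 0 := by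
    by_contra hc
    push Not at hc
    exact hne (funext fun i => funext fun j => funext fun k => hc i j k)
  obtain ⟨φ, hφ⟩ := exists_trace_comp_ne_zero hk
  have h1 := congrArg (fun f => f (Pi.single j (Pi.single i
    (Pi.single (Fin.cast (hsymm i j) k) φ)))) h0
  simp only [LinearMap.zero_apply] at h1
  rw [arrowPairing_apply, Finset.sum_eq_single i, Finset.sum_eq_single j,
    Finset.sum_eq_single k] at h1
  · simp only [Pi.single_eq_same] at h1
    rcases mul_eq_zero.1 h1 with h2 | h2
    · unfold ppSign at h2; split_ifs at h2 <;> simp at h2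
    · exact hφ h2
  · intro k' _ hk'
    have : Fin.cast (hsymm i j) k' ≠ Fin.cast (hsymm i j) k := fun h => hk' (by simpa using h)
    simp [Pi.single_eq_of_ne this]
  · simp
  · intro j' _ hj'
    simp [Pi.single_eq_of_ne hj']
  · simp
  · intro i' _ hi'
    refine Finset.sum_eq_zero fun j' _ => Finset.sum_eq_zero fun k' _ => ?_
    by_cases hj : j' = j
    · subst hj; simp [Pi.single_eq_of_ne hi']
    · simp [Pi.single_eq_of_ne hj]
  · simp

lemma arrowPairing_arrowComm (hsymm : ∀ i j, m i j = m j i) (hloop : ∀ i, m i i = 0)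
    {α : ∀ i j, ℕ → (V i →ₗ[K] V j)} (g : ∀ i, V i →ₗ[K] V i)
    (h : ∀ i j, Fin (m i j) → (V i →ₗ[K] V j)) :
    arrowPairing hsymm h (arrowComm α g) =
      ∑ i, LinearMap.trace K (V i) (g i ∘ₗ relDeriv hsymm α h i) := by
  have swap : ∑ i, ∑ j, ∑ k : Fin (m i j), ppSign K i j *
        LinearMap.trace K (V i) ((α j i k ∘ₗ g j) ∘ₗ h i j k) =
      -∑ i, ∑ j, ∑ k : Fin (m i j), ppSign K i j *
        LinearMap.trace K (V i) (g i ∘ₗ h j i (Fin.cast (hsymm i j) k) ∘ₗ α i j k) := by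
    rw [Finset.sum_comm]
    simp only [← Finset.sum_neg_distrib]
    refine Finset.sum_congr rfl fun j _ => Finset.sum_congr rfl fun i _ => ?_
    refine Fintype.sum_equiv (finCongr (hsymm i j)) _ _ fun k => ?_
    have hij : i ≠ j := by
      rintro rfl
      exact absurd k.2 (by simp [hloop])
    rw [ppSign_swap K hij, neg_mul, neg_neg, LinearMap.comp_assoc, LinearMap.trace_comp_comm',
      LinearMap.comp_assoc]
    rfl
  simp only [arrowPairing_apply, relDeriv, arrowComm, LinearMap.coe_mk, AddHom.coe_mk,
    Fin.val_cast, LinearMap.sub_comp, map_sub, mul_sub, Finset.sum_sub_distrib, swap, sub_neg_eq_add]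
  rw [← Finset.sum_add_distrib]
  refine Finset.sum_congr rfl fun i _ => ?_
  rw [← Finset.sum_add_distrib, comp_sum_right, map_sum]
  refine Finset.sum_congr rfl fun j _ => ?_
  rw [← Finset.sum_add_distrib, comp_sum_right, map_sum]
  refine Finset.sum_congr rfl fun k _ => ?_
  rw [LinearMap.comp_smul, map_smul, smul_eq_mul, LinearMap.comp_add, map_add, mul_add,
    LinearMap.comp_assoc]

/-- A representation of the preprojective relation whose endomorphism algebra has the dimension
forced by the quadratic form has no infinitesimal deformations: every solution of the linearized
relation is a commutator. -/
lemma mem_range_arrowComm (hsymm : ∀ i j, m i j = m j i) (hloop : ∀ i, m i i = 0)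
    {α : ∀ i j, ℕ → (V i →ₗ[K] V j)}
    (hrel : ∀ i x, ∑ j, ∑ k : Fin (m i j), ppSign K i j • α j i k (α i j k x) = 0)
    (hend : Module.finrank K (LinearMap.ker (arrowComm (m := m) α)) ≤
      ∑ i, Module.finrank K (V i))
    (hdim : (∑ i, ∑ j, m i j * (Module.finrank K (V i) * Module.finrank K (V j))) +
        2 * ∑ i, Module.finrank K (V i) ≤ 2 * ∑ i, Module.finrank K (V i) ^ 2)
    {h : ∀ i j, Fin (m i j) → (V i →ₗ[K] V j)} (hh : relDeriv hsymm α h = 0) :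
    ∃ g, arrowComm α g = h := by
  have hX0 : Module.finrank K (∀ i, V i →ₗ[K] V i) = ∑ i, Module.finrank K (V i) ^ 2 := by
    rw [Module.finrank_pi_fintype]
    exact Finset.sum_congr rfl fun i _ => by rw [Module.finrank_linearMap, sq]
  have hX1 : Module.finrank K (∀ i j, Fin (m i j) → (V i →ₗ[K] V j)) =
      ∑ i, ∑ j, m i j * (Module.finrank K (V i) * Module.finrank K (V j)) := by
    rw [Module.finrank_pi_fintype]
    refine Finset.sum_congr rfl fun i _ => ?_
    rw [Module.finrank_pi_fintype]
    refine Finset.sum_congr rfl fun j _ => ?_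
    rw [Module.finrank_pi_fintype]
    simp [Module.finrank_linearMap]
  have hle : LinearMap.range (arrowComm (m := m) α) ≤ LinearMap.ker (relDeriv hsymm α) := by
    rintro _ ⟨g, rfl⟩
    exact relDeriv_arrowComm hsymm hrel g
  have hker : Module.finrank K (LinearMap.ker (relDeriv hsymm α)) ≤
      Module.finrank K (LinearMap.range (arrowComm (m := m) α)).dualAnnihilator := by
    refine LinearMap.finrank_le_finrank_of_injective
      (f := ((arrowPairing hsymm).domRestrict _).codRestrict _ ?_) ?_
    · rintro ⟨h, hh⟩
      rw [Submodule.mem_dualAnnihilator]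
      rintro _ ⟨g, rfl⟩
      rw [LinearMap.mem_ker] at hh
      rw [LinearMap.domRestrict_apply, arrowPairing_arrowComm hsymm hloop, hh]
      simp
    · rintro ⟨h, hh⟩ ⟨h', hh'⟩ heq
      have := congrArg Subtype.val heq
      exact Subtype.ext (arrowPairing_injective hsymm this)
  have hann := Subspace.finrank_add_finrank_dualAnnihilator_eq
    (LinearMap.range (arrowComm (m := m) α))
  have hrk := LinearMap.finrank_range_add_finrank_ker (arrowComm (m := m) α)
  have heq := Submodule.eq_of_le_of_finrank_le hle (by omega)
  have : h ∈ LinearMap.range (arrowComm (m := m) α) := by rw [heq]; exact hh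
  exact this

end DoubleQuiverRepresentations

section AbstractPreprojective

/-- The arrows of the double quiver of `m` with source `i`; reversing them gives the arrows with
target `i`. -/
abbrev Arr {ι : Type} (m : ι → ι → ℕ) (i : ι) : Type := Σ j, Fin (m i j)

/-- The properties of a complete preprojective algebra of non-Dynkin or Dynkin type that determine
the behaviour of its tilting ideals: idempotents, arrows, the preprojective relation, the
arrow filtration, and exactness of the middle part of the standard resolution of simple modules on
both sides. -/
structure PPData (K : Type) [Field K] {ι : Type} [Fintype ι] [LinearOrder ι] (m : ι → ι → ℕ)
    (A : Type) [Ring A] [Algebra K A] where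
  /-- the idempotents -/
  e : ι → A
  /-- the arrows `i → j` -/
  ar : ι → ι → ℕ → A
  /-- the arrow filtration -/
  L : ℕ → Submodule K A
  e_mul_self : ∀ i, e i * e i = e i
  e_mul_of_ne : ∀ i j, i ≠ j → e i * e j = 0
  sum_e : ∑ i, e i = 1
  e_ar : ∀ i j k, e i * ar i j k = ar i j k
  ar_e : ∀ i j k, ar i j k * e j = ar i j k
  rel : ∀ i, ∑ a : Arr m i, ppSign K i a.1 • (ar i a.1 a.2 * ar a.1 i a.2) = 0
  L_zero : L 0 = ⊤
  L_succ_right : ∀ n x, x ∈ L (n + 1) ↔ ∃ y : ∀ i, Arr m i → A,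
    (∀ i a, y i a ∈ L n) ∧ x = ∑ i, ∑ a, y i a * ar a.1 i a.2
  L_succ_left : ∀ n x, x ∈ L (n + 1) ↔ ∃ y : ∀ i, Arr m i → A,
    (∀ i a, y i a ∈ L n) ∧ x = ∑ i, ∑ a : Arr m i, ar i a.1 a.2 * y i a
  L_inf : ∀ x, (∀ n, x ∈ L n) → x = 0
  exists_scalar : ∀ x, ∃ c : ι → K, x - ∑ i, c i • e i ∈ L 1
  e_not_mem : ∀ c : ι → K, ∑ i, c i • e i ∈ L 1 → c = 0
  exact_right : ∀ i (t : Arr m i → A), ∑ a, ppSign K i a.1 • (t a * ar a.1 i a.2) = 0 →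
    ∃ z, ∀ a, t a * e a.1 = z * ar i a.1 a.2
  exact_left : ∀ i (t : Arr m i → A), ∑ a, ppSign K i a.1 • (ar i a.1 a.2 * t a) = 0 →
    ∃ z, ∀ a, e a.1 * t a = ar a.1 i a.2 * z

/-- A subspace stable under multiplication on both sides. -/
structure BiStable {K A : Type} [Field K] [Ring A] [Algebra K A] (T : Submodule K A) : Prop where
  left : ∀ (a : A) {x : A}, x ∈ T → a * x ∈ T
  right : ∀ (a : A) {x : A}, x ∈ T → x * a ∈ T

namespace BiStable

variable {K A : Type} [Field K] [Ring A] [Algebra K A] {S T : Submodule K A}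

lemma top : BiStable (⊤ : Submodule K A) := ⟨fun _ _ _ => trivial, fun _ _ _ => trivial⟩

lemma mul (hS : BiStable S) (hT : BiStable T) : BiStable (S * T) where
  left a x hx := by
    induction hx using Submodule.mul_induction_on' with
    | mem_mul_mem y hy z hz => rw [← mul_assoc]; exact Submodule.mul_mem_mul (hS.left a hy) hz
    | add y _ z _ h1 h2 => rw [mul_add]; exact add_mem h1 h2
  right a x hx := by
    induction hx using Submodule.mul_induction_on' with
    | mem_mul_mem y hy z hz => rw [mul_assoc]; exact Submodule.mul_mem_mul hy (hT.right a hz)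
    | add y _ z _ h1 h2 => rw [add_mul]; exact add_mem h1 h2

lemma mul_le_left (hS : BiStable S) : S * T ≤ S :=
  Submodule.mul_le.2 fun _ hx _ _ => hS.right _ hx

lemma mul_le_right (hT : BiStable T) : S * T ≤ T :=
  Submodule.mul_le.2 fun _ _ _ hy => hT.left _ hy

lemma mul_top (hS : BiStable S) : S * ⊤ = S :=
  le_antisymm hS.mul_le_left fun x hx => by
    simpa using Submodule.mul_mem_mul hx (Submodule.mem_top (x := (1 : A)))

lemma top_mul (hS : BiStable S) : ⊤ * S = S :=
  le_antisymm hS.mul_le_right fun x hx => by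
    simpa using Submodule.mul_mem_mul (Submodule.mem_top (x := (1 : A))) hx

end BiStable

namespace PPData

variable {K : Type} [Field K] {ι : Type} [Fintype ι] [LinearOrder ι] {m : ι → ι → ℕ}
  {A : Type} [Ring A] [Algebra K A] (D : PPData K m A)

/-- The arrows starting at `i`. -/
def out (i : ι) (a : Arr m i) : A := D.ar i a.1 a.2

/-- The arrows ending at `i`. -/
def inn (i : ι) (a : Arr m i) : A := D.ar a.1 i a.2

lemma rel' (i : ι) : ∑ a, ppSign K i a.1 • (D.out i a * D.inn i a) = 0 := D.rel i

lemma e_out (i : ι) (a : Arr m i) : D.e i * D.out i a = D.out i a := D.e_ar _ _ _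
lemma out_e (i : ι) (a : Arr m i) : D.out i a * D.e a.1 = D.out i a := D.ar_e _ _ _
lemma e_inn (i : ι) (a : Arr m i) : D.e a.1 * D.inn i a = D.inn i a := D.e_ar _ _ _
lemma inn_e (i : ι) (a : Arr m i) : D.inn i a * D.e i = D.inn i a := D.ar_e _ _ _

lemma ar_mul_e_of_ne {j l : ι} (h : j ≠ l) (i : ι) (k : ℕ) : D.ar i j k * D.e l = 0 := by
  rw [← D.ar_e, mul_assoc, D.e_mul_of_ne _ _ h, mul_zero]

lemma e_mul_ar_of_ne {i l : ι} (h : l ≠ i) (j : ι) (k : ℕ) : D.e l * D.ar i j k = 0 := by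
  rw [← D.e_ar, ← mul_assoc, D.e_mul_of_ne _ _ h, zero_mul]

lemma fst_ne (hloop : ∀ i, m i i = 0) {i : ι} (a : Arr m i) : a.1 ≠ i := by
  obtain ⟨j, k⟩ := a
  intro h
  change j = i at h
  subst h
  exact absurd k.2 (by simp [hloop])

/-- The opposite of a preprojective algebra is a preprojective algebra. -/
def op : PPData K m Aᵐᵒᵖ where
  e i := MulOpposite.op (D.e i)
  ar i j k := MulOpposite.op (D.ar j i k)
  L n := (D.L n).comap (MulOpposite.opLinearEquiv K).symm.toLinearMap
  e_mul_self i := by rw [← MulOpposite.op_mul, D.e_mul_self]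
  e_mul_of_ne i j h := by rw [← MulOpposite.op_mul, D.e_mul_of_ne _ _ h.symm, MulOpposite.op_zero]
  sum_e := by rw [← Finset.op_sum, D.sum_e, MulOpposite.op_one]
  e_ar i j k := by rw [← MulOpposite.op_mul, D.ar_e]
  ar_e i j k := by rw [← MulOpposite.op_mul, D.e_ar]
  rel i := by
    apply MulOpposite.unop_injective
    simpa using D.rel i
  L_zero := by rw [D.L_zero]; rfl
  L_succ_right n x := by
    refine (D.L_succ_left n x.unop).trans ⟨?_, ?_⟩
    · rintro ⟨y, hy, hx⟩
      refine ⟨fun i a => MulOpposite.op (y i a), hy, MulOpposite.unop_injective ?_⟩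
      simpa using hx
    · rintro ⟨y, hy, hx⟩
      refine ⟨fun i a => (y i a).unop, hy, ?_⟩
      simpa using congrArg MulOpposite.unop hx
  L_succ_left n x := by
    refine (D.L_succ_right n x.unop).trans ⟨?_, ?_⟩
    · rintro ⟨y, hy, hx⟩
      refine ⟨fun i a => MulOpposite.op (y i a), hy, MulOpposite.unop_injective ?_⟩
      simpa using hx
    · rintro ⟨y, hy, hx⟩
      refine ⟨fun i a => (y i a).unop, hy, ?_⟩
      simpa using congrArg MulOpposite.unop hx
  L_inf x h := MulOpposite.unop_injective (D.L_inf _ h)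
  exists_scalar x := by
    obtain ⟨c, hc⟩ := D.exists_scalar x.unop
    exact ⟨c, by simpa using hc⟩
  e_not_mem c h := D.e_not_mem c (by simpa using h)
  exact_right i t h := by
    obtain ⟨z, hz⟩ := D.exact_left i (fun a => (t a).unop)
      (by simpa using congrArg MulOpposite.unop h)
    exact ⟨MulOpposite.op z, fun a => MulOpposite.unop_injective (by simpa using hz a)⟩
  exact_left i t h := by
    obtain ⟨z, hz⟩ := D.exact_right i (fun a => (t a).unop)
      (by simpa using congrArg MulOpposite.unop h)
    exact ⟨MulOpposite.op z, fun a => MulOpposite.unop_injective (by simpa using hz a)⟩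

lemma L_mul_left (n : ℕ) (b : A) {x : A} (hx : x ∈ D.L n) : b * x ∈ D.L n := by
  induction n generalizing x with
  | zero => rw [D.L_zero]; trivial
  | succ n ih =>
    obtain ⟨y, hy, rfl⟩ := (D.L_succ_right n x).1 hx
    refine (D.L_succ_right n _).2 ⟨fun i a => b * y i a, fun i a => ih (hy i a), ?_⟩
    simp only [Finset.mul_sum, mul_assoc]

lemma L_mul_right (n : ℕ) (b : A) {x : A} (hx : x ∈ D.L n) : x * b ∈ D.L n :=
  D.op.L_mul_left n (MulOpposite.op b) (x := MulOpposite.op x) hx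

lemma mul_inn_mem_L {n : ℕ} {x : A} (hx : x ∈ D.L n) (i : ι) (a : Arr m i) :
    x * D.inn i a ∈ D.L (n + 1) := by
  classical
  refine (D.L_succ_right n _).2 ⟨Pi.single i (Pi.single a x), fun j b => ?_, ?_⟩
  · by_cases hj : j = i
    · subst hj
      by_cases hb : b = a
      · subst hb; simpa using hx
      · simp [Pi.single_eq_of_ne hb]
    · simp [Pi.single_eq_of_ne hj]
  · rw [Finset.sum_eq_single i, Finset.sum_eq_single a]
    · simp [inn]
    · intro b _ hb; simp [Pi.single_eq_of_ne hb]
    · simp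
    · intro j _ hj; simp [Pi.single_eq_of_ne hj]
    · simp

lemma out_mul_mem_L {n : ℕ} {x : A} (hx : x ∈ D.L n) (i : ι) (a : Arr m i) :
    D.out i a * x ∈ D.L (n + 1) :=
  D.op.mul_inn_mem_L (x := MulOpposite.op x) hx i a

lemma L_succ_le (n : ℕ) : D.L (n + 1) ≤ D.L n := by
  intro x hx
  obtain ⟨y, hy, rfl⟩ := (D.L_succ_right n x).1 hx
  exact sum_mem fun i _ => sum_mem fun a _ => D.L_mul_right n _ (hy i a)

lemma inn_mem_L_one (i : ι) (a : Arr m i) : D.inn i a ∈ D.L 1 := by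
  simpa using D.mul_inn_mem_L (n := 0) (x := 1) (by rw [D.L_zero]; trivial) i a

lemma L_mul_L (p q : ℕ) {x y : A} (hx : x ∈ D.L p) (hy : y ∈ D.L q) : x * y ∈ D.L (p + q) := by
  induction q generalizing y with
  | zero => exact D.L_mul_right p y hx
  | succ q ih =>
    obtain ⟨z, hz, rfl⟩ := (D.L_succ_right q y).1 hy
    simp only [Finset.mul_sum, ← mul_assoc]
    exact sum_mem fun i _ => sum_mem fun a _ => D.mul_inn_mem_L (ih (hz i a)) i a

lemma mul_e_mem_L_one_iff (i : ι) (x : A) :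
    x * D.e i ∈ D.L 1 ↔ ∃ t : Arr m i → A, x * D.e i = ∑ a, t a * D.inn i a := by
  constructor
  · intro hx
    obtain ⟨y, -, h⟩ := (D.L_succ_right 0 _).1 hx
    refine ⟨y i, ?_⟩
    have := congrArg (· * D.e i) h
    simp only [mul_assoc, D.e_mul_self] at this
    rw [this, Finset.sum_mul, Finset.sum_eq_single i]
    · rw [Finset.sum_mul]
      exact Finset.sum_congr rfl fun a _ => by rw [mul_assoc, D.ar_e]; rfl
    · intro j _ hj
      rw [Finset.sum_mul]
      exact Finset.sum_eq_zero fun a _ => by rw [mul_assoc, D.ar_mul_e_of_ne hj, mul_zero]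
    · simp
  · rintro ⟨t, h⟩
    rw [h]
    exact sum_mem fun a _ => D.L_mul_left 1 _ (D.inn_mem_L_one i a)

/-- The ideal `A (1 - e_i) A`. -/
def I (i : ι) : Submodule K A := Submodule.span K {x | ∃ a b, x = a * (1 - D.e i) * b}

lemma I_biStable (i : ι) : BiStable (D.I i) where
  left c x hx := by
    induction hx using Submodule.span_induction with
    | mem y hy =>
      obtain ⟨a, b, rfl⟩ := hy
      exact Submodule.subset_span ⟨c * a, b, by simp only [mul_assoc]⟩
    | zero => simp
    | add y z _ _ h1 h2 => rw [mul_add]; exact add_mem h1 h2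
    | smul k y _ h => rw [mul_smul_comm]; exact Submodule.smul_mem _ _ h
  right c x hx := by
    induction hx using Submodule.span_induction with
    | mem y hy =>
      obtain ⟨a, b, rfl⟩ := hy
      exact Submodule.subset_span ⟨a, b * c, by simp only [mul_assoc]⟩
    | zero => simp
    | add y z _ _ h1 h2 => rw [add_mul]; exact add_mem h1 h2
    | smul k y _ h => rw [smul_mul_assoc]; exact Submodule.smul_mem _ _ h

lemma one_sub_e_mem_I (i : ι) : 1 - D.e i ∈ D.I i :=
  Submodule.subset_span ⟨1, 1, by simp⟩

lemma I_le {i : ι} {T : Submodule K A} (hT : BiStable T) (h : 1 - D.e i ∈ T) : D.I i ≤ T := by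
  refine Submodule.span_le.2 ?_
  rintro _ ⟨a, b, rfl⟩
  exact hT.right _ (hT.left _ h)

lemma e_mem_I {i j : ι} (h : j ≠ i) : D.e j ∈ D.I i := by
  have := (D.I_biStable i).left (D.e j) (D.one_sub_e_mem_I i)
  rwa [mul_sub, mul_one, D.e_mul_of_ne _ _ h, sub_zero] at this

lemma inn_mem_I (hloop : ∀ i, m i i = 0) (i : ι) (a : Arr m i) : D.inn i a ∈ D.I i := by
  rw [← D.e_inn]
  exact (D.I_biStable i).right _ (D.e_mem_I (fst_ne hloop a))

lemma mem_I_iff (hloop : ∀ i, m i i = 0) {i : ι} {x : A} : x ∈ D.I i ↔ x * D.e i ∈ D.L 1 := by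
  constructor
  · intro hx
    let T : Submodule K A := (D.L 1).comap (LinearMap.mulRight K (D.e i))
    refine Submodule.span_le (p := T).2 ?_ hx
    rintro _ ⟨a, b, rfl⟩
    change a * (1 - D.e i) * b * D.e i ∈ D.L 1
    obtain ⟨c, hc⟩ := D.exists_scalar b
    have : a * (1 - D.e i) * b * D.e i =
        a * (1 - D.e i) * (b - ∑ j, c j • D.e j) * D.e i := by
      have h : (∑ j, c j • D.e j) * D.e i = c i • D.e i := by
        rw [Finset.sum_mul, Finset.sum_eq_single i]
        · rw [smul_mul_assoc, D.e_mul_self]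
        · intro j _ hj; rw [smul_mul_assoc, D.e_mul_of_ne _ _ hj, smul_zero]
        · simp
      rw [mul_sub _ b, sub_mul _ _ (D.e i), mul_assoc _ (∑ j, c j • D.e j), h, mul_smul_comm,
        mul_assoc a _ (D.e i), sub_mul 1, one_mul, D.e_mul_self, sub_self, mul_zero, smul_zero,
        sub_zero]
    rw [this]
    exact D.L_mul_right 1 _ (D.L_mul_left 1 _ hc)
  · intro hx
    obtain ⟨t, ht⟩ := (D.mul_e_mem_L_one_iff i x).1 hx
    have : x = x * (1 - D.e i) + x * D.e i := by rw [mul_sub, mul_one, sub_add_cancel]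
    rw [this, ht]
    exact add_mem ((D.I_biStable i).left _ (D.one_sub_e_mem_I i))
      (sum_mem fun a _ => (D.I_biStable i).left _ (D.inn_mem_I hloop i a))

lemma L_one_le_I (hloop : ∀ i, m i i = 0) (i : ι) : D.L 1 ≤ D.I i := fun _ hx =>
  (D.mem_I_iff hloop).2 (D.L_mul_right 1 _ hx)

lemma e_not_mem_L_one (i : ι) : D.e i ∉ D.L 1 := by
  intro h
  have := D.e_not_mem (Pi.single i 1) (by
    rw [Finset.sum_eq_single i]
    · simpa using h
    · intro j _ hj; simp [Pi.single_eq_of_ne hj]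
    · simp)
  simpa using congrFun this i

lemma e_not_mem_I (hloop : ∀ i, m i i = 0) (i : ι) : D.e i ∉ D.I i := by
  rw [D.mem_I_iff hloop, D.e_mul_self]
  exact D.e_not_mem_L_one i

lemma mem_mul_I_iff (hloop : ∀ i, m i i = 0) {i : ι} {T : Submodule K A}
    (hT : ∀ (a : A) {x : A}, x ∈ T → x * a ∈ T) {x : A} :
    x ∈ T * D.I i ↔ x ∈ T ∧ ∃ t : Arr m i → A, (∀ a, t a ∈ T) ∧
      x * D.e i = ∑ a, t a * D.inn i a := by
  constructor
  · intro hx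
    induction hx using Submodule.mul_induction_on' with
    | mem_mul_mem y hy z hz =>
      refine ⟨hT _ hy, ?_⟩
      obtain ⟨t, ht⟩ := (D.mul_e_mem_L_one_iff i z).1 ((D.mem_I_iff hloop).1 hz)
      refine ⟨fun a => y * t a, fun a => hT _ hy, ?_⟩
      rw [mul_assoc, ht, Finset.mul_sum]
      simp only [mul_assoc]
    | add y _ z _ h1 h2 =>
      obtain ⟨hy, t, ht, ht'⟩ := h1
      obtain ⟨hz, s, hs, hs'⟩ := h2
      refine ⟨add_mem hy hz, fun a => t a + s a, fun a => add_mem (ht a) (hs a), ?_⟩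
      simp only [add_mul, ht', hs', Finset.sum_add_distrib]
  · rintro ⟨hx, t, ht, h⟩
    have : x = x * (1 - D.e i) + x * D.e i := by rw [mul_sub, mul_one, sub_add_cancel]
    rw [this, h]
    exact add_mem (Submodule.mul_mem_mul hx (D.one_sub_e_mem_I i))
      (sum_mem fun a _ => Submodule.mul_mem_mul (ht a) (D.inn_mem_I hloop i a))

lemma mul_one_sub_e_mem {i : ι} {T : Submodule K A} {x : A} (hx : x ∈ T) :
    x * (1 - D.e i) ∈ T * D.I i := Submodule.mul_mem_mul hx (D.one_sub_e_mem_I i)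

lemma mem_mul_I_of_e_ne {i j : ι} (hij : j ≠ i) {T : Submodule K A} {x : A} (hx : x * D.e j ∈ T) :
    x * D.e j ∈ T * D.I i := by
  have := D.mul_one_sub_e_mem (i := i) hx
  rwa [mul_sub, mul_one, mul_assoc, D.e_mul_of_ne _ _ hij, mul_zero, sub_zero] at this

lemma I_mul_self (i : ι) : D.I i * D.I i = D.I i := by
  refine le_antisymm (D.I_biStable i).mul_le_left ?_
  refine D.I_le ((D.I_biStable i).mul (D.I_biStable i)) ?_
  have := Submodule.mul_mem_mul (D.one_sub_e_mem_I i) (D.one_sub_e_mem_I i)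
  rwa [sub_mul, one_mul, mul_sub, mul_one, D.e_mul_self, sub_self, sub_zero] at this

section op

lemma map_op_I (i : ι) :
    (D.I i).map (MulOpposite.opLinearEquiv K : A ≃ₗ[K] Aᵐᵒᵖ).toLinearMap = D.op.I i := by
  rw [I, I, Submodule.map_span]
  congr 1
  ext x
  constructor
  · rintro ⟨_, ⟨a, b, rfl⟩, rfl⟩
    exact ⟨MulOpposite.op b, MulOpposite.op a, MulOpposite.unop_injective (by
      simp [op, mul_assoc])⟩
  · rintro ⟨a, b, rfl⟩
    exact ⟨_, ⟨b.unop, a.unop, rfl⟩, MulOpposite.unop_injective (by simp [op, mul_assoc])⟩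

end op

end PPData

end AbstractPreprojective

section Dimensions

namespace PPData

variable {K : Type} [Field K] {ι : Type} [Fintype ι] [LinearOrder ι] {m : ι → ι → ℕ}
  {A : Type} [Ring A] [Algebra K A] (D : PPData K m A)

/-- The elements `x` with `x e_i ∈ T`. -/
def slice (T : Submodule K A) (i : ι) : Submodule K A := T.comap (LinearMap.mulRight K (D.e i))

lemma mem_slice {T : Submodule K A} {i : ι} {x : A} : x ∈ D.slice T i ↔ x * D.e i ∈ T := Iff.rfl

/-- The dimension of `(A / T) e_i`. -/
noncomputable def dimV (T : Submodule K A) (i : ι) : ℕ := Module.finrank K (A ⧸ D.slice T i)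

/-- Right multiplication by `b` as a map between the spaces `(A / T) e_i`. -/
def rmul (T T' : Submodule K A) (i j : ι) (b : A) (h : ∀ x, x * D.e i ∈ T → x * b * D.e j ∈ T') :
    (A ⧸ D.slice T i) →ₗ[K] (A ⧸ D.slice T' j) :=
  Submodule.mapQ _ _ (LinearMap.mulRight K b) h

lemma rmul_mk {T T' : Submodule K A} {i j : ι} {b : A} (h) (x : A) :
    D.rmul T T' i j b h (Submodule.Quotient.mk x) = Submodule.Quotient.mk (x * b) := rfl

lemma mk_slice_eq {T : Submodule K A} {i : ι} {x y : A} :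
    (Submodule.Quotient.mk x : A ⧸ D.slice T i) = Submodule.Quotient.mk y ↔
      x * D.e i - y * D.e i ∈ T := by
  rw [Submodule.Quotient.eq, mem_slice, sub_mul]

lemma mk_slice_eq_zero {T : Submodule K A} {i : ι} {x : A} :
    (Submodule.Quotient.mk x : A ⧸ D.slice T i) = 0 ↔ x * D.e i ∈ T := by
  rw [Submodule.Quotient.mk_eq_zero, mem_slice]

lemma ar_slice {T : Submodule K A} (hT : BiStable T) (i j : ι) (k : ℕ) (x : A)
    (hx : x * D.e i ∈ T) : x * D.ar i j k * D.e j ∈ T := by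
  rw [← D.e_ar, ← mul_assoc]
  exact hT.right _ (hT.right _ hx)

/-- The representation of the double quiver on the spaces `(A / T) e_i`. -/
def act {T : Submodule K A} (hT : BiStable T) (i j : ι) (k : ℕ) :
    (A ⧸ D.slice T i) →ₗ[K] (A ⧸ D.slice T j) :=
  D.rmul T T i j (D.ar i j k) (D.ar_slice hT i j k)

/-- The vertex `i` does not occur in the right socle of `A / T`. -/
def NoSocle (T : Submodule K A) (i : ι) : Prop :=
  ∀ x, (∀ a, x * D.out i a ∈ T) → x * D.e i ∈ T

lemma slice_mul_I_of_ne {T : Submodule K A} (hT : BiStable T) {i j : ι} (h : j ≠ i) :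
    D.slice (T * D.I i) j = D.slice T j :=
  Submodule.ext fun _ => ⟨fun hx => hT.mul_le_left hx, fun hx => D.mem_mul_I_of_e_ne h hx⟩

lemma dimV_mul_I_of_ne {T : Submodule K A} (hT : BiStable T) {i j : ι} (h : j ≠ i) :
    D.dimV (T * D.I i) j = D.dimV T j := by
  rw [dimV, dimV, D.slice_mul_I_of_ne hT h]

lemma dimV_mul_I (hloop : ∀ i, m i i = 0) {T : Submodule K A} (hT : BiStable T)
    (hfd : ∀ j, FiniteDimensional K (A ⧸ D.slice T j)) (i : ι) :
    FiniteDimensional K (A ⧸ D.slice (T * D.I i) i) ∧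
      ∃ k, D.dimV (T * D.I i) i + D.dimV T i = ∑ j, m i j * D.dimV T j + 1 + k ∧
        (k = 0 ↔ D.NoSocle T i) := by
  let f : (A ⧸ D.slice T i) →ₗ[K] (∀ a : Arr m i, A ⧸ D.slice T a.1) :=
    LinearMap.pi fun a => D.act hT i a.1 a.2
  have hin : ∀ (a : Arr m i) (x : A), x * D.e a.1 ∈ T → x * D.inn i a * D.e i ∈ T * D.I i := by
    intro a x hx
    rw [mul_assoc, D.inn_e, ← D.e_inn, ← mul_assoc]
    exact Submodule.mul_mem_mul hx (D.inn_mem_I hloop i a)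
  let g : (∀ a : Arr m i, A ⧸ D.slice T a.1) →ₗ[K] (A ⧸ D.slice (T * D.I i) i) :=
    ∑ a, ppSign K i a.1 • (D.rmul T (T * D.I i) a.1 i (D.inn i a) (hin a) ∘ₗ LinearMap.proj a)
  have hgmk (t : Arr m i → A) : g (fun a => Submodule.Quotient.mk (t a)) =
      Submodule.Quotient.mk (∑ a, ppSign K i a.1 • (t a * D.inn i a)) := by
    simp only [g, LinearMap.sum_apply, LinearMap.smul_apply, LinearMap.comp_apply,
      LinearMap.proj_apply, rmul_mk]
    rw [← Submodule.mkQ_apply, map_sum]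
    simp only [map_smul, Submodule.mkQ_apply]
  have hlift (t : ∀ a : Arr m i, A ⧸ D.slice T a.1) :
      ∃ s : Arr m i → A, t = fun a => Submodule.Quotient.mk (s a) :=
    ⟨fun a => (Submodule.Quotient.mk_surjective _ (t a)).choose,
      funext fun a => (Submodule.Quotient.mk_surjective _ (t a)).choose_spec.symm⟩
  have hker : LinearMap.ker g = LinearMap.range f := by
    ext t
    constructor
    · intro ht
      obtain ⟨t, rfl⟩ := hlift t
      rw [LinearMap.mem_ker, hgmk, mk_slice_eq_zero] at ht
      obtain ⟨-, s, hs, hs'⟩ := (D.mem_mul_I_iff hloop hT.right).1 ht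
      rw [mul_assoc, D.e_mul_self] at hs'
      obtain ⟨z, hz⟩ := D.exact_right i (fun a => t a - ppSign K i a.1 • s a) (by
        have h0 : ∀ a : Arr m i, D.inn i a * D.e i = D.inn i a := D.inn_e i
        rw [Finset.sum_mul] at hs'
        simp only [smul_mul_assoc, mul_assoc, h0] at hs'
        simp only [sub_mul, smul_sub, Finset.sum_sub_distrib, smul_mul_assoc, smul_smul,
          ppSign_mul_self, one_smul]
        exact sub_eq_zero.2 hs')
      refine ⟨Submodule.Quotient.mk z, funext fun a => ?_⟩
      change Submodule.Quotient.mk (z * D.ar i a.1 a.2) = Submodule.Quotient.mk (t a)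
      rw [mk_slice_eq, mul_assoc, D.ar_e, ← hz, sub_mul, sub_right_comm, sub_self, zero_sub,
        smul_mul_assoc]
      exact T.neg_mem (T.smul_mem _ (hT.right _ (hs a)))
    · rintro ⟨x, rfl⟩
      obtain ⟨x, rfl⟩ := Submodule.Quotient.mk_surjective _ x
      rw [LinearMap.mem_ker]
      refine (hgmk fun a => x * D.ar i a.1 a.2).trans ?_
      have : ∑ a : Arr m i, ppSign K i a.1 • (x * D.ar i a.1 a.2 * D.inn i a) = 0 := by
        rw [← mul_zero x, ← D.rel' i, Finset.mul_sum]
        exact Finset.sum_congr rfl fun a _ => by rw [mul_smul_comm, ← mul_assoc]; rfl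
      rw [this, Submodule.Quotient.mk_zero]
  have hcodim : Module.finrank K ((A ⧸ D.slice (T * D.I i) i) ⧸ LinearMap.range g) = 1 := by
    refine (finrank_eq_one_iff_of_nonzero' (Submodule.Quotient.mk (Submodule.Quotient.mk 1)) ?_).2 ?_
    · intro h
      obtain ⟨t, ht⟩ := (Submodule.Quotient.mk_eq_zero _).1 h
      obtain ⟨t, rfl⟩ := hlift t
      rw [hgmk, mk_slice_eq, one_mul] at ht
      refine D.e_not_mem_I hloop i ?_
      have h1 := (D.I_biStable i).mul_le_right ht
      have h2 : (∑ a : Arr m i, ppSign K i a.1 • (t a * D.inn i a)) * D.e i ∈ D.I i :=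
        (D.I_biStable i).right _ (sum_mem fun a _ => Submodule.smul_mem _ _
          ((D.I_biStable i).left _ (D.inn_mem_I hloop i a)))
      simpa using sub_mem h2 h1
    · intro w
      obtain ⟨w, rfl⟩ := Submodule.Quotient.mk_surjective _ w
      obtain ⟨x, rfl⟩ := Submodule.Quotient.mk_surjective _ w
      obtain ⟨c, hc⟩ := D.exists_scalar x
      obtain ⟨t, ht⟩ := (D.mul_e_mem_L_one_iff i _).1 (D.L_mul_right 1 (D.e i) hc)
      refine ⟨c i, ?_⟩
      rw [← Submodule.Quotient.mk_smul, Submodule.Quotient.eq]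
      rw [← neg_mem_iff]
      refine ⟨fun a => Submodule.Quotient.mk (ppSign K i a.1 • t a), ?_⟩
      rw [hgmk, ← Submodule.Quotient.mk_smul, ← Submodule.Quotient.mk_sub,
        ← Submodule.Quotient.mk_neg]
      simp only [smul_mul_assoc, smul_smul, ppSign_mul_self, one_smul]
      rw [← ht, mk_slice_eq, mul_assoc, D.e_mul_self, sub_mul,
        Finset.sum_mul, Finset.sum_eq_single i]
      · rw [smul_mul_assoc, D.e_mul_self, neg_sub, sub_mul, smul_mul_assoc, one_mul, sub_self]
        exact zero_mem _
      · intro j _ hj; rw [smul_mul_assoc, D.e_mul_of_ne _ _ hj, smul_zero]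
      · simp
  have hfin : FiniteDimensional K (A ⧸ D.slice (T * D.I i) i) := by
    have : Module.Finite K ((A ⧸ D.slice (T * D.I i) i) ⧸ LinearMap.range g) :=
      Module.finite_of_finrank_eq_succ hcodim
    exact Module.Finite.of_submodule_quotient (LinearMap.range g)
  refine ⟨hfin, Module.finrank K (LinearMap.ker f), ?_, ?_⟩
  · have h1 := LinearMap.finrank_range_add_finrank_ker f
    have h2 := LinearMap.finrank_range_add_finrank_ker g
    have h3 := (LinearMap.range g).finrank_quotient_add_finrank
    have h4 : ∑ a : Arr m i, Module.finrank K (A ⧸ D.slice T a.1) =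
        ∑ j, m i j * Module.finrank K (A ⧸ D.slice T j) := by
      rw [Fintype.sum_sigma]
      exact Finset.sum_congr rfl fun j _ => by
        change ∑ _k : Fin (m i j), Module.finrank K (A ⧸ D.slice T j) = _
        rw [Finset.sum_const, Finset.card_univ, Fintype.card_fin, smul_eq_mul]
    rw [hker, Module.finrank_pi_fintype, h4] at h2
    rw [hcodim] at h3
    simp only [dimV]
    omega
  · rw [Submodule.finrank_eq_zero, LinearMap.ker_eq_bot']
    constructor
    · intro h x hx
      rw [← mk_slice_eq_zero]
      refine h _ (funext fun a => ?_)
      change Submodule.Quotient.mk (x * D.out i a) = 0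
      rw [mk_slice_eq_zero]
      exact hT.right _ (hx a)
    · intro h x hx
      obtain ⟨x, rfl⟩ := Submodule.Quotient.mk_surjective _ x
      rw [mk_slice_eq_zero]
      refine h x fun a => ?_
      have : x * D.ar i a.1 a.2 * D.e a.1 ∈ T :=
        (D.mk_slice_eq_zero (T := T) (i := a.1)).1 (congrFun hx a)
      rwa [mul_assoc, D.ar_e] at this

lemma eq_top_of_stable {Q : Submodule K A} {n : ℕ} (hn : D.L n ≤ Q) (he : ∀ i, D.e i ∈ Q)
    (har : ∀ i a x, x ∈ Q → x * D.inn i a ∈ Q) : Q = ⊤ := by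
  have key : ∀ k, ⊤ ≤ Q ⊔ D.L k := by
    intro k
    induction k with
    | zero => rw [D.L_zero]; exact le_sup_right
    | succ k ih =>
      intro x _
      obtain ⟨c, hc⟩ := D.exists_scalar x
      obtain ⟨y, -, hy⟩ := (D.L_succ_right 0 _).1 hc
      have : x = ∑ i, c i • D.e i + ∑ i, ∑ a, y i a * D.inn i a := by
        rw [eq_add_of_sub_eq' hy]; rfl
      rw [this]
      refine add_mem (Submodule.mem_sup_left (sum_mem fun i _ => Q.smul_mem _ (he i)))
        (sum_mem fun i _ => sum_mem fun a _ => ?_)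
      obtain ⟨q, hq, l, hl, h⟩ := Submodule.mem_sup.1 (ih (Submodule.mem_top (x := y i a)))
      rw [← h, add_mul]
      exact add_mem (Submodule.mem_sup_left (har i a q hq))
        (Submodule.mem_sup_right (D.mul_inn_mem_L hl i a))
  exact top_le_iff.1 ((key n).trans (sup_le le_rfl hn))

end PPData

end Dimensions

section Dichotomy

namespace PPData

variable {K : Type} [Field K] {ι : Type} [Fintype ι] [LinearOrder ι] {m : ι → ι → ℕ}
  {A : Type} [Ring A] [Algebra K A] (D : PPData K m A)

lemma act_mk {T : Submodule K A} (hT : BiStable T) (i j : ι) (k : ℕ) (x : A) :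
    D.act hT i j k (Submodule.Quotient.mk x) = Submodule.Quotient.mk (x * D.ar i j k) := rfl

lemma act_rel {T : Submodule K A} (hT : BiStable T) (i : ι) (x : A ⧸ D.slice T i) :
    ∑ j, ∑ k : Fin (m i j), ppSign K i j • D.act hT j i k (D.act hT i j k x) = 0 := by
  obtain ⟨x, rfl⟩ := Submodule.Quotient.mk_surjective _ x
  simp only [act_mk]
  simp only [← Submodule.mkQ_apply, ← map_smul, ← map_sum]
  rw [show ∑ j, ∑ k : Fin (m i j), ppSign K i j • (x * D.ar i j k * D.ar j i k) = 0 from ?_,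
    map_zero]
  rw [← mul_zero x, ← D.rel i, Fintype.sum_sigma, Finset.mul_sum]
  refine Finset.sum_congr rfl fun j _ => ?_
  rw [Finset.mul_sum]
  exact Finset.sum_congr rfl fun k _ => by rw [mul_smul_comm, mul_assoc]

lemma mk_e_of_ne {T : Submodule K A} {i j : ι} (h : i ≠ j) :
    (Submodule.Quotient.mk (D.e i) : A ⧸ D.slice T j) = 0 := by
  rw [mk_slice_eq_zero, D.e_mul_of_ne _ _ h]; exact zero_mem _

lemma mk_mul_e (T : Submodule K A) (i : ι) (x : A) :
    (Submodule.Quotient.mk (x * D.e i) : A ⧸ D.slice T i) = Submodule.Quotient.mk x := by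
  rw [mk_slice_eq, mul_assoc, D.e_mul_self, sub_self]; exact zero_mem _

lemma mk_mul_e_of_ne (T : Submodule K A) {i j : ι} (h : i ≠ j) (x : A) :
    (Submodule.Quotient.mk (x * D.e i) : A ⧸ D.slice T j) = 0 := by
  rw [mk_slice_eq_zero, mul_assoc, D.e_mul_of_ne _ _ h, mul_zero]; exact zero_mem _

lemma mk_mul_inn_of_ne (T : Submodule K A) {i j : ι} (h : i ≠ j) (a : Arr m i) (x : A) :
    (Submodule.Quotient.mk (x * D.inn i a) : A ⧸ D.slice T j) = 0 := by
  rw [← D.inn_e, ← mul_assoc]; exact D.mk_mul_e_of_ne T h _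

/-- Endomorphisms of `A / T` are determined by their value at the generator. -/
lemma finrank_ker_arrowComm_le (hsymm : ∀ i j, m i j = m j i) {T : Submodule K A}
    (hT : BiStable T) {n : ℕ} (hn : D.L n ≤ T)
    (hfd : ∀ j, FiniteDimensional K (A ⧸ D.slice T j)) :
    Module.finrank K (LinearMap.ker (arrowComm (m := m) (D.act hT))) ≤ ∑ i, D.dimV T i := by
  let ψ : (∀ i, (A ⧸ D.slice T i) →ₗ[K] (A ⧸ D.slice T i)) →ₗ[K] (∀ i, A ⧸ D.slice T i) :=
    LinearMap.pi fun i => LinearMap.applyₗ (Submodule.Quotient.mk 1) ∘ₗ LinearMap.proj i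
  have hinj : Function.Injective (ψ ∘ₗ (LinearMap.ker (arrowComm (m := m) (D.act hT))).subtype) := by
    rw [← LinearMap.ker_eq_bot, LinearMap.ker_eq_bot']
    rintro ⟨g, hg⟩ h
    have hg' (p q : ι) (k : Fin (m p q)) (x : A ⧸ D.slice T p) :
        g q (D.act hT p q k x) = D.act hT p q k (g p x) :=
      sub_eq_zero.1 (LinearMap.congr_fun (congrFun (congrFun (congrFun hg p) q) k) x)
    let Q : Submodule K A := ⨅ j, LinearMap.ker (g j ∘ₗ (D.slice T j).mkQ)
    have hQ : Q = ⊤ := by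
      have hmem (x : A) : x ∈ Q ↔ ∀ j, g j (Submodule.Quotient.mk x) = 0 := by
        simp only [Q, Submodule.mem_iInf]; rfl
      refine D.eq_top_of_stable (n := n) (fun x hx => ?_) (fun i => ?_) fun i a x hx => ?_
      · refine (hmem x).2 fun j => ?_
        rw [D.mk_slice_eq_zero.2 (hT.right _ (hn hx)), map_zero]
      · refine (hmem _).2 fun j => ?_
        by_cases hj : i = j
        · subst hj
          rw [← one_mul (D.e i), mk_mul_e]
          exact congrFun h i
        · rw [D.mk_e_of_ne hj, map_zero]
      · refine (hmem _).2 fun j => ?_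
        by_cases hj : i = j
        · subst hj
          have := hg' a.1 i (Fin.cast (hsymm _ _) a.2) (Submodule.Quotient.mk x)
          rw [(hmem x).1 hx, map_zero] at this
          exact this
        · rw [D.mk_mul_inn_of_ne T hj, map_zero]
    refine Subtype.ext (funext fun j => LinearMap.ext fun x => ?_)
    obtain ⟨x, rfl⟩ := Submodule.Quotient.mk_surjective _ x
    have : x ∈ Q := hQ ▸ Submodule.mem_top
    exact (Submodule.mem_iInf _).1 this j
  refine (LinearMap.finrank_le_finrank_of_injective hinj).trans ?_
  rw [Module.finrank_pi_fintype]
  rfl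

/-- If `A / T` satisfies the numerical condition for rigidity, then the multiplicity of the simple
module at `i` vanishes either in the top of `T` or in the socle of `A / T`. -/
lemma mul_I_eq_or_noSocle (hsymm : ∀ i j, m i j = m j i) (hloop : ∀ i, m i i = 0)
    {T : Submodule K A} (hT : BiStable T) {n : ℕ} (hn : D.L n ≤ T)
    (hfd : ∀ j, FiniteDimensional K (A ⧸ D.slice T j))
    (hdim : (∑ i, ∑ j, m i j * (D.dimV T i * D.dimV T j)) + 2 * ∑ i, D.dimV T i ≤
      2 * ∑ i, D.dimV T i ^ 2) (i : ι) :
    T * D.I i = T ∨ D.NoSocle T i := by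
  by_contra hcon
  obtain ⟨hne, hsoc⟩ := not_or.1 hcon
  obtain ⟨t₀, ht₀, ht₀e, ht₀'⟩ : ∃ t ∈ T, t * D.e i = t ∧ t ∉ T * D.I i := by
    by_contra hc
    push Not at hc
    refine hne (le_antisymm hT.mul_le_left fun t ht => ?_)
    have := hc (t * D.e i) (hT.right _ ht) (by rw [mul_assoc, D.e_mul_self])
    have h2 := add_mem (D.mul_one_sub_e_mem (i := i) ht) this
    rwa [mul_sub, mul_one, sub_add_cancel] at h2
  obtain ⟨x, hxout, hxe, hx⟩ : ∃ x, (∀ a, x * D.out i a ∈ T) ∧ x * D.e i = x ∧ x ∉ T := by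
    rw [NoSocle] at hsoc
    push Not at hsoc
    obtain ⟨x, h1, h2⟩ := hsoc
    refine ⟨x * D.e i, fun a => ?_, by rw [mul_assoc, D.e_mul_self], h2⟩
    rw [mul_assoc, D.e_out]
    exact h1 a
  obtain ⟨φ, hφ, hφT⟩ := Submodule.exists_le_ker_of_notMem ht₀'
  have hxar (j k) (hk : k < m i j) : x * D.ar i j k ∈ T := hxout ⟨j, ⟨k, hk⟩⟩
  have hxar' {p : ι} (hp : p ≠ i) (q k) : x * D.ar p q k = 0 := by
    rw [← hxe, mul_assoc, D.e_mul_ar_of_ne hp.symm, mul_zero]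
  have hwd (p q : ι) (k : Fin (m p q)) : D.slice T p ≤
      LinearMap.ker (φ ∘ₗ LinearMap.mulRight K (D.ar p q k)) := by
    intro y hy
    refine hφT ?_
    change y * D.ar p q k ∈ T * D.I i
    by_cases hq : q = i
    · subst hq
      rw [← D.e_ar, ← mul_assoc]
      have hp : p ≠ q := by
        rintro rfl
        exact absurd k.2 (by simp [hloop])
      refine Submodule.mul_mem_mul hy ?_
      rw [← D.e_ar]
      exact (D.I_biStable q).right _ (D.e_mem_I hp)
    · rw [← D.ar_e, ← mul_assoc]
      exact D.mem_mul_I_of_e_ne hq (D.ar_slice hT p q k y hy)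
  let h : ∀ p q, Fin (m p q) → ((A ⧸ D.slice T p) →ₗ[K] (A ⧸ D.slice T q)) := fun p q k =>
    (Submodule.liftQ (D.slice T p) (φ ∘ₗ LinearMap.mulRight K (D.ar p q k)) (hwd p q k)).smulRight
      (Submodule.Quotient.mk x)
  have hmk (p q : ι) (k : Fin (m p q)) (y : A) : h p q k (Submodule.Quotient.mk y) =
      φ (y * D.ar p q k) • (Submodule.Quotient.mk x : A ⧸ D.slice T q) := rfl
  have hh : relDeriv hsymm (D.act hT) h = 0 := by
    refine funext fun p => LinearMap.ext fun y => ?_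
    obtain ⟨y, rfl⟩ := Submodule.Quotient.mk_surjective _ y
    change (∑ j, ∑ k : Fin (m p j), ppSign K p j •
      (D.act hT j p k ∘ₗ h p j k + h j p (Fin.cast (hsymm p j) k) ∘ₗ D.act hT p j k))
        (Submodule.Quotient.mk y) = 0
    simp only [LinearMap.sum_apply, LinearMap.smul_apply, LinearMap.add_apply,
      LinearMap.comp_apply, act_mk, hmk, map_smul, Fin.val_cast]
    have h1 : ∀ j, ∀ k : Fin (m p j),
        (Submodule.Quotient.mk (x * D.ar j p k) : A ⧸ D.slice T p) = 0 := by
      intro j k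
      rw [mk_slice_eq_zero]
      by_cases hj : j = i
      · subst hj
        exact hT.right _ (hxar p k (hsymm p j ▸ k.2))
      · rw [hxar' hj, zero_mul]; exact zero_mem _
    simp only [h1, smul_zero, zero_add, smul_smul, ← Finset.sum_smul]
    rw [show ∑ j, ∑ k : Fin (m p j), ppSign K p j * φ (y * D.ar p j k * D.ar j p k) = 0 from ?_,
      zero_smul]
    rw [← map_zero φ, ← mul_zero y, ← D.rel p, Fintype.sum_sigma, Finset.mul_sum, map_sum]
    refine Finset.sum_congr rfl fun j _ => ?_
    rw [Finset.mul_sum, map_sum]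
    exact Finset.sum_congr rfl fun k _ => by rw [mul_smul_comm, map_smul, mul_assoc, smul_eq_mul]
  obtain ⟨g, hg⟩ := mem_range_arrowComm hsymm hloop (D.act_rel hT)
    (D.finrank_ker_arrowComm_le hsymm hT hn hfd) hdim hh
  have hg' (p q : ι) (k : Fin (m p q)) (y : A) :
      g q (Submodule.Quotient.mk (y * D.ar p q k)) =
        D.act hT p q k (g p (Submodule.Quotient.mk y)) +
          φ (y * D.ar p q k) • (Submodule.Quotient.mk x : A ⧸ D.slice T q) := by
    rw [← hmk, ← hg]
    change _ = _ + (g q (D.act hT p q k (Submodule.Quotient.mk y)) -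
      D.act hT p q k (g p (Submodule.Quotient.mk y)))
    rw [act_mk]
    abel
  let emb : ∀ j, (A ⧸ D.slice T j) →ₗ[K] (A ⧸ T) := fun j =>
    Submodule.mapQ _ _ (LinearMap.mulRight K (D.e j)) fun _ h => h
  have hemb (j y) : emb j (Submodule.Quotient.mk y) = Submodule.Quotient.mk (y * D.e j) := rfl
  let G : A →ₗ[K] (A ⧸ T) := (φ ∘ₗ LinearMap.mulRight K (D.e i)).smulRight (T.mkQ x) -
    ∑ j, emb j ∘ₗ g j ∘ₗ (D.slice T j).mkQ
  have hG (y : A) : G y = φ (y * D.e i) • T.mkQ x -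
      ∑ j, emb j (g j (Submodule.Quotient.mk y)) := by
    simp only [G, LinearMap.sub_apply, LinearMap.sum_apply]; rfl
  let Q : Submodule K A :=
    { carrier := {b | ∀ y z, G y = T.mkQ z → G (y * b) = T.mkQ (z * b)}
      add_mem' := fun {b c} hb hc y z h => by rw [mul_add, mul_add, map_add, map_add, hb y z h,
        hc y z h]
      zero_mem' := fun y z _ => by rw [mul_zero, mul_zero, map_zero, map_zero]
      smul_mem' := fun c b hb y z h => by
        rw [mul_smul_comm, mul_smul_comm, map_smul, map_smul, hb y z h] }
  have hQ' (b : A) (hb : ∀ (y : A) (γ : ι → A),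
      (∀ j, g j (Submodule.Quotient.mk y) = Submodule.Quotient.mk (γ j)) →
      G (y * b) = T.mkQ (φ (y * D.e i) • (x * b) - ∑ j, γ j * D.e j * b)) : b ∈ Q := by
    intro y z hz
    choose γ hγ using fun j => Submodule.Quotient.mk_surjective _ (g j (Submodule.Quotient.mk y))
    rw [hb y γ fun j => (hγ j).symm]
    rw [hG] at hz
    simp only [← hγ, hemb] at hz
    simp only [← Submodule.mkQ_apply, ← map_sum, ← map_smul, ← map_sub] at hz
    rw [Submodule.mkQ_apply, Submodule.mkQ_apply, Submodule.Quotient.eq] at hz ⊢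
    have := hT.right b hz
    rwa [sub_mul, sub_mul, smul_mul_assoc, Finset.sum_mul] at this
  have hQ : Q = ⊤ := by
    refine D.eq_top_of_stable (n := n + 1) (fun b hb => ?_) (fun j => ?_) fun p a b hb => ?_
    · refine hQ' b fun y γ hγ => ?_
      have hbT : b ∈ T := hn (D.L_succ_le n hb)
      have hφ0 : φ (y * b * D.e i) = 0 := by
        refine hφT ?_
        obtain ⟨u, hu, h⟩ := (D.L_succ_right n _).1 (D.L_mul_right _ (D.e i) (D.L_mul_left _ y hb))
        rw [h]
        exact sum_mem fun q _ => sum_mem fun a _ => Submodule.mul_mem_mul (hn (hu q a))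
          (D.L_one_le_I hloop i (D.inn_mem_L_one q a))
      rw [hG, hφ0, zero_smul, zero_sub, Finset.sum_eq_zero, neg_zero, eq_comm, Submodule.mkQ_apply,
        Submodule.Quotient.mk_eq_zero]
      · exact sub_mem (T.smul_mem _ (hT.left _ hbT)) (sum_mem fun j _ => hT.left _ hbT)
      · intro j _
        rw [D.mk_slice_eq_zero.2 (hT.right _ (hT.left _ hbT)), map_zero, map_zero]
    · refine hQ' _ fun y γ hγ => ?_
      rw [hG, Finset.sum_eq_single j, mk_mul_e, hγ, hemb, map_sub, map_smul,
        Finset.sum_eq_single j, mul_assoc (γ j), D.e_mul_self]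
      · congr 1
        by_cases hj : j = i
        · subst hj
          rw [mul_assoc, D.e_mul_self, hxe]
        · rw [mul_assoc, D.e_mul_of_ne _ _ hj, ← hxe, mul_assoc, D.e_mul_of_ne _ _ (Ne.symm hj)]
          simp
      · intro l _ hl
        rw [mul_assoc, D.e_mul_of_ne _ _ hl, mul_zero]
      · simp
      · intro l _ hl
        rw [D.mk_mul_e_of_ne T (Ne.symm hl), map_zero, map_zero]
      · simp
    · suffices hinn : D.inn p a ∈ Q by
        intro y z hz
        rw [← mul_assoc, ← mul_assoc]
        exact hinn _ _ (hb y z hz)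
      refine hQ' _ fun y γ hγ => ?_
      have hxp : x * D.inn p a ∈ T := by
        by_cases ha : a.1 = i
        · subst ha
          exact hxar p a.2 (lt_of_lt_of_eq a.2.2 (hsymm _ _))
        · change x * D.ar _ _ _ ∈ T
          rw [hxar' ha]; exact zero_mem _
      have hxp' : T.mkQ (x * D.inn p a) = 0 := (Submodule.Quotient.mk_eq_zero T).2 hxp
      have h3 := hg' a.1 p (Fin.cast (hsymm _ _) a.2) y
      simp only [Fin.val_cast] at h3
      change g p (Submodule.Quotient.mk (y * D.inn p a)) = _ + φ (y * D.inn p a) • _ at h3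
      rw [hG, Finset.sum_eq_single p, h3, hγ, act_mk, map_add, map_smul, hemb, hemb, map_sub,
        map_smul, hxp', Finset.sum_eq_single a.1,
        mul_assoc (γ a.1) (D.e a.1), D.e_inn, mul_assoc (γ a.1), D.ar_e]
      · rw [show D.ar a.1 p a.2 = D.inn p a from rfl, mul_assoc]
        by_cases hp : p = i
        · subst hp
          rw [D.inn_e, hxe]
          simp
        · have h4 : D.inn p a * D.e i = 0 := D.ar_mul_e_of_ne hp _ _
          have h5 : x * D.e p = 0 := by
            rw [← hxe, mul_assoc, D.e_mul_of_ne _ _ (Ne.symm hp), mul_zero]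
          rw [h4, h5]
          simp
      · intro l _ hl
        rw [mul_assoc, show D.inn p a = D.ar a.1 p a.2 from rfl, D.e_mul_ar_of_ne hl, mul_zero]
      · simp
      · intro l _ hl
        rw [D.mk_mul_inn_of_ne T (Ne.symm hl), map_zero, map_zero]
      · simp
  obtain ⟨z, hz⟩ := Submodule.mkQ_surjective T (G 1)
  have h1 : G (1 * t₀) = T.mkQ (z * t₀) :=
    (show t₀ ∈ Q from hQ ▸ Submodule.mem_top) 1 z hz.symm
  rw [one_mul, Submodule.mkQ_apply, (Submodule.Quotient.mk_eq_zero T).2 (hT.left _ ht₀), hG, ht₀e,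
    Finset.sum_eq_zero, sub_zero, smul_eq_zero] at h1
  · rcases h1 with h1 | h1
    · exact hφ h1
    · exact hx ((Submodule.Quotient.mk_eq_zero T).1 h1)
  · intro j _
    rw [D.mk_slice_eq_zero.2 (hT.right _ ht₀), map_zero, map_zero]

end PPData

end Dichotomy

section BraidRelations

namespace PPData

variable {K : Type} [Field K] {ι : Type} [Fintype ι] [LinearOrder ι] {m : ι → ι → ℕ}
  {A : Type} [Ring A] [Algebra K A] (D : PPData K m A)

lemma I_mul_I_eq_inf (hsymm : ∀ i j, m i j = m j i) (hloop : ∀ i, m i i = 0) {i j : ι}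
    (h : m i j = 0) : D.I i * D.I j = D.I i ⊓ D.I j := by
  refine le_antisymm (le_inf (D.I_biStable i).mul_le_left (D.I_biStable j).mul_le_right) ?_
  rintro x ⟨hi, hj⟩
  refine (D.mem_mul_I_iff hloop (D.I_biStable i).right).2 ⟨hi, ?_⟩
  obtain ⟨t, ht⟩ := (D.mul_e_mem_L_one_iff j x).1 ((D.mem_I_iff hloop).1 hj)
  refine ⟨fun a => t a * D.e a.1, fun a => ?_, ?_⟩
  · refine (D.I_biStable i).left _ (D.e_mem_I ?_)
    rintro rfl
    exact absurd a.2.2 (by simp [hsymm j, h])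
  · rw [ht]
    exact Finset.sum_congr rfl fun a _ => by rw [mul_assoc, D.e_inn]

lemma I_mul_comm (hsymm : ∀ i j, m i j = m j i) (hloop : ∀ i, m i i = 0) {i j : ι}
    (h : m i j = 0) : D.I i * D.I j = D.I j * D.I i := by
  rw [D.I_mul_I_eq_inf hsymm hloop h, D.I_mul_I_eq_inf hsymm hloop (hsymm i j ▸ h), inf_comm]

lemma inn_mul_inn_mem (hsymm : ∀ i j, m i j = m j i) (hloop : ∀ i, m i i = 0) {i j : ι}
    (h : m i j = 1) {Q : Submodule K A} (hQ : BiStable Q)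
    (he : ∀ l, l ≠ i → l ≠ j → D.e l ∈ Q) (b : Arr m i) (hb : b.1 = j) (a : Arr m j)
    (ha : a.1 = i) : D.inn j a * D.inn i b ∈ Q := by
  obtain ⟨j', b⟩ := b
  obtain ⟨i', a⟩ := a
  change j' = j at hb
  change i' = i at ha
  subst j' i'
  have hab : (a : ℕ) = b := by
    have h1 : (a : ℕ) < m i j := lt_of_lt_of_eq a.2 (hsymm _ _)
    have h2 := b.2
    omega
  have h1 : D.inn j ⟨i, a⟩ = D.out i ⟨j, b⟩ := by
    simp only [inn, out, hab]
  have h2 := D.rel' i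
  rw [← Finset.add_sum_erase _ _ (Finset.mem_univ (⟨j, b⟩ : Arr m i))] at h2
  have h3 : ppSign K i j • (D.out i ⟨j, b⟩ * D.inn i ⟨j, b⟩) ∈ Q := by
    rw [eq_neg_of_add_eq_zero_left h2]
    refine neg_mem (sum_mem fun c hc => Q.smul_mem _ (hQ.left _ ?_))
    rw [← D.e_inn]
    refine hQ.right _ (he _ (fst_ne hloop c) fun hcj => (Finset.mem_erase.1 hc).1 ?_)
    obtain ⟨l, c⟩ := c
    change l = j at hcj
    subst l
    congr 1
    have h4 := c.2
    have h5 := b.2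
    ext
    omega
  rw [h1]
  have := Q.smul_mem (ppSign K i j) h3
  rwa [smul_smul, ppSign_mul_self, one_smul] at this

lemma mul_inn_mem (hloop : ∀ i, m i i = 0) {i j : ι} {Q : Submodule K A} (hQ : BiStable Q)
    (he : ∀ l, l ≠ i → l ≠ j → D.e l ∈ Q) (b : Arr m i) {t : A}
    (ht : t * D.e j * D.inn i b ∈ Q) : t * D.inn i b ∈ Q := by
  rw [← D.e_inn] at ht ⊢
  by_cases hb : b.1 = j
  · subst hb
    rwa [mul_assoc, ← mul_assoc (D.e _), D.e_mul_self] at ht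
  · exact hQ.left _ (hQ.right _ (he _ (fst_ne hloop b) hb))

lemma I_mul_I_mul_I_le (hsymm : ∀ i j, m i j = m j i) (hloop : ∀ i, m i i = 0) {i j : ι}
    (hij : i ≠ j) (h : m i j = 1) {Q : Submodule K A} (hQ : BiStable Q)
    (he : ∀ l, l ≠ i → l ≠ j → D.e l ∈ Q) : D.I i * D.I j * D.I i ≤ Q := by
  have he' : ∀ l, l ≠ j → l ≠ i → D.e l ∈ Q := fun l h1 h2 => he l h2 h1
  intro x hx
  obtain ⟨hx, t, ht, hxi⟩ := (D.mem_mul_I_iff hloop ((D.I_biStable i).mul (D.I_biStable j)).right).1 hx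
  obtain ⟨-, s, hs, hxj⟩ := (D.mem_mul_I_iff hloop (D.I_biStable i).right).1 hx
  have hei : x * D.e i ∈ Q := by
    rw [hxi]
    refine sum_mem fun b _ => D.mul_inn_mem hloop hQ he b ?_
    obtain ⟨-, r, -, hr⟩ := (D.mem_mul_I_iff hloop (D.I_biStable i).right).1 (ht b)
    by_cases hb : b.1 = j
    · rw [hr, Finset.sum_mul]
      refine sum_mem fun a _ => ?_
      by_cases ha : a.1 = i
      · rw [mul_assoc]
        exact hQ.left _ (D.inn_mul_inn_mem hsymm hloop h hQ he b hb a ha)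
      · rw [← D.e_inn]
        exact hQ.right _ (hQ.left _ (hQ.right _ (he _ ha (fst_ne hloop a))))
    · rw [← D.e_inn, mul_assoc, ← mul_assoc (D.e j), D.e_mul_of_ne _ _ (Ne.symm hb), zero_mul,
        mul_zero]
      exact zero_mem _
  have hej : x * D.e j ∈ Q := by
    rw [hxj]
    refine sum_mem fun a _ => D.mul_inn_mem hloop hQ he' a ?_
    obtain ⟨r, hr⟩ := (D.mul_e_mem_L_one_iff i _).1 ((D.mem_I_iff hloop).1 (hs a))
    by_cases ha : a.1 = i
    · rw [hr, Finset.sum_mul]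
      refine sum_mem fun b _ => ?_
      by_cases hb : b.1 = j
      · rw [mul_assoc]
        exact hQ.left _ (D.inn_mul_inn_mem hsymm hloop (hsymm i j ▸ h) hQ he' a ha b hb)
      · rw [← D.e_inn]
        exact hQ.right _ (hQ.left _ (hQ.right _ (he _ (fst_ne hloop b) hb)))
    · rw [← D.e_inn, mul_assoc, ← mul_assoc (D.e i), D.e_mul_of_ne _ _ (Ne.symm ha), zero_mul,
        mul_zero]
      exact zero_mem _
  rw [← mul_one x, ← D.sum_e, Finset.mul_sum]
  refine sum_mem fun l _ => ?_
  by_cases hli : l = i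
  · subst hli; exact hei
  by_cases hlj : l = j
  · subst hlj; exact hej
  exact hQ.left _ (he l hli hlj)

lemma I_braid (hsymm : ∀ i j, m i j = m j i) (hloop : ∀ i, m i i = 0) {i j : ι}
    (hij : i ≠ j) (h : m i j = 1) : D.I i * D.I j * D.I i = D.I j * D.I i * D.I j := by
  have key : ∀ i j, ∀ l, l ≠ i → l ≠ j → D.e l ∈ D.I i * D.I j * D.I i := fun i j l h1 h2 => by
    have := Submodule.mul_mem_mul (Submodule.mul_mem_mul (D.e_mem_I h1) (D.e_mem_I h2))
      (D.e_mem_I h1)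
    rwa [D.e_mul_self, D.e_mul_self] at this
  refine le_antisymm (D.I_mul_I_mul_I_le hsymm hloop hij h
    (((D.I_biStable _).mul (D.I_biStable _)).mul (D.I_biStable _)) fun l h1 h2 => key j i l h2 h1)
    (D.I_mul_I_mul_I_le hsymm hloop hij.symm (hsymm i j ▸ h)
    (((D.I_biStable _).mul (D.I_biStable _)).mul (D.I_biStable _)) fun l h1 h2 => key i j l h2 h1)

/-- The product of the ideals `I_i` along a word. -/
def J (l : List ι) : Submodule K A := (l.map D.I).prod * ⊤

lemma J_nil : D.J [] = ⊤ := by simp [J]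

lemma J_cons (i : ι) (l : List ι) : D.J (i :: l) = D.I i * D.J l := by
  simp [J, mul_assoc]

lemma J_biStable (l : List ι) : BiStable (D.J l) := by
  induction l with
  | nil => rw [J_nil]; exact BiStable.top
  | cons i l ih => rw [J_cons]; exact (D.I_biStable i).mul ih

lemma J_append (l l' : List ι) : D.J (l ++ l') = D.J l * D.J l' := by
  induction l with
  | nil => rw [J_nil, (D.J_biStable l').top_mul]; rfl
  | cons i l ih => rw [List.cons_append, J_cons, J_cons, ih, mul_assoc]

lemma J_singleton (i : ι) : D.J [i] = D.I i := by
  rw [J_cons, J_nil, (D.I_biStable i).mul_top]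

lemma L_le_J (hloop : ∀ i, m i i = 0) (l : List ι) : D.L l.length ≤ D.J l := by
  induction l with
  | nil => rw [J_nil]; exact le_top
  | cons i l ih =>
    intro x hx
    obtain ⟨y, hy, rfl⟩ := (D.L_succ_left l.length x).1 hx
    rw [J_cons]
    refine sum_mem fun j _ => sum_mem fun a _ => Submodule.mul_mem_mul ?_ (ih (hy j a))
    refine D.L_one_le_I hloop i ?_
    simpa [out] using D.out_mul_mem_L (n := 0) (x := 1) (by rw [D.L_zero]; trivial) j a

section Coxeter

variable {M : CoxeterMatrix ι} {W : Type} [Group W] (cs : CoxeterSystem M W)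

/-- The ideal `I_w`. -/
noncomputable def Iw (w : W) : Submodule K A := D.J (cs.exists_isReduced w).choose

lemma Iw_biStable (w : W) : BiStable (D.Iw cs w) := D.J_biStable _

lemma exists_L_le_Iw (hloop : ∀ i, m i i = 0) (w : W) : ∃ n, D.L n ≤ D.Iw cs w :=
  ⟨_, D.L_le_J hloop _⟩

lemma J_eq_Iw (hsymm : ∀ i j, m i j = m j i) (hloop : ∀ i, m i i = 0) (hM : IsCoxeterOf m M)
    {l : List ι} (hl : cs.IsReduced l) : D.J l = D.Iw cs (cs.wordProd l) := by
  obtain ⟨h1, h2⟩ := (cs.exists_isReduced (cs.wordProd l)).choose_spec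
  rw [Iw, J, J, prod_map_eq_of_reduced cs hsymm hM D.I
    (fun i j _ h => D.I_mul_comm hsymm hloop h)
    (fun i j hij h => D.I_braid hsymm hloop hij h) _ l _ rfl hl h1 h2]

lemma Iw_mul (hsymm : ∀ i j, m i j = m j i) (hloop : ∀ i, m i i = 0) (hM : IsCoxeterOf m M)
    {v u : W} (h : cs.length (v * u) = cs.length v + cs.length u) :
    D.Iw cs (v * u) = D.Iw cs v * D.Iw cs u := by
  obtain ⟨l, hl, rfl⟩ := cs.exists_isReduced v
  obtain ⟨l', hl', rfl⟩ := cs.exists_isReduced u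
  rw [← D.J_eq_Iw cs hsymm hloop hM hl, ← D.J_eq_Iw cs hsymm hloop hM hl', ← J_append,
    ← cs.wordProd_append]
  refine (D.J_eq_Iw cs hsymm hloop hM ?_).symm
  rw [CoxeterSystem.IsReduced] at *
  rw [cs.wordProd_append, h, hl, hl', List.length_append]

lemma Iw_one (hsymm : ∀ i j, m i j = m j i) (hloop : ∀ i, m i i = 0) (hM : IsCoxeterOf m M) :
    D.Iw cs 1 = ⊤ := by
  rw [← cs.wordProd_nil, ← D.J_eq_Iw cs hsymm hloop hM (by simp [CoxeterSystem.IsReduced]), J_nil]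

lemma Iw_simple (hsymm : ∀ i j, m i j = m j i) (hloop : ∀ i, m i i = 0) (hM : IsCoxeterOf m M)
    (i : ι) : D.Iw cs (cs.simple i) = D.I i := by
  rw [← cs.wordProd_singleton,
    ← D.J_eq_Iw cs hsymm hloop hM (by simp [CoxeterSystem.IsReduced]), J_singleton]

lemma Iw_mul_simple (hsymm : ∀ i j, m i j = m j i) (hloop : ∀ i, m i i = 0) (hM : IsCoxeterOf m M)
    {w : W} {i : ι} (h : ¬cs.IsRightDescent w i) :
    D.Iw cs (w * cs.simple i) = D.Iw cs w * D.I i := by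
  rw [D.Iw_mul cs hsymm hloop hM, D.Iw_simple cs hsymm hloop hM]
  rw [cs.not_isRightDescent_iff.1 h, cs.length_simple]

lemma Iw_simple_mul (hsymm : ∀ i j, m i j = m j i) (hloop : ∀ i, m i i = 0) (hM : IsCoxeterOf m M)
    {w : W} {i : ι} (h : ¬cs.IsLeftDescent w i) :
    D.Iw cs (cs.simple i * w) = D.I i * D.Iw cs w := by
  rw [D.Iw_mul cs hsymm hloop hM, D.Iw_simple cs hsymm hloop hM]
  rw [cs.not_isLeftDescent_iff.1 h, cs.length_simple, add_comm]

lemma Iw_mul_I_of_descent (hsymm : ∀ i j, m i j = m j i) (hloop : ∀ i, m i i = 0)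
    (hM : IsCoxeterOf m M) {w : W} {i : ι} (h : cs.IsRightDescent w i) :
    D.Iw cs w * D.I i = D.Iw cs w := by
  have h1 : ¬cs.IsRightDescent (w * cs.simple i) i := by
    rwa [← cs.isRightDescent_iff_not_isRightDescent_mul]
  have h2 := D.Iw_mul_simple cs hsymm hloop hM h1
  rw [cs.simple_mul_simple_cancel_right] at h2
  rw [h2, mul_assoc, D.I_mul_self]

/-- Every product of the ideals `I_i` is some `I_w`. -/
lemma exists_J_eq_Iw (hsymm : ∀ i j, m i j = m j i) (hloop : ∀ i, m i i = 0)
    (hM : IsCoxeterOf m M) (l : List ι) : ∃ w, D.J l = D.Iw cs w := by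
  induction l using List.reverseRecOn with
  | nil => exact ⟨1, by rw [J_nil, D.Iw_one cs hsymm hloop hM]⟩
  | append_singleton l i ih =>
    obtain ⟨w, hw⟩ := ih
    rw [J_append, hw, J_singleton]
    by_cases h : cs.IsRightDescent w i
    · exact ⟨w, D.Iw_mul_I_of_descent cs hsymm hloop hM h⟩
    · exact ⟨_, (D.Iw_mul_simple cs hsymm hloop hM h).symm⟩

end Coxeter

end PPData

end BraidRelations

section DimensionVectors

lemma quadratic_update {ι : Type} [Fintype ι] [DecidableEq ι] {m : ι → ι → ℕ}
    (hsymm : ∀ i j, m i j = m j i) (hloop : ∀ i, m i i = 0) (d d' : ι → ℤ) (i : ι)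
    (hne : ∀ j, j ≠ i → d' j = d j) (hi : d' i + d i = ∑ j, m i j * d j + 1) :
    (∑ p, ∑ q, (m p q : ℤ) * (d' p * d' q)) + 2 * ∑ p, d' p - 2 * ∑ p, d' p ^ 2 =
      (∑ p, ∑ q, (m p q : ℤ) * (d p * d q)) + 2 * ∑ p, d p - 2 * ∑ p, d p ^ 2 := by
  obtain ⟨δ, hδ⟩ : ∃ δ, δ = d' i - d i := ⟨_, rfl⟩
  have hd : ∀ p, d' p = d p + if p = i then δ else 0 := by
    intro p
    split_ifs with h
    · subst h; omega
    · rw [hne p h, add_zero]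
  have h1 : ∑ p, d' p = ∑ p, d p + δ := by
    simp [hd, Finset.sum_add_distrib]
  have h2 : ∑ p, d' p ^ 2 = ∑ p, d p ^ 2 + 2 * d i * δ + δ ^ 2 := by
    simp [hd, add_sq, Finset.sum_add_distrib]
  have h3 : ∑ p, ∑ q, (m p q : ℤ) * (d' p * d' q) =
      ∑ p, ∑ q, (m p q : ℤ) * (d p * d q) + 2 * δ * ∑ q, (m i q : ℤ) * d q := by
    have e : ∀ p q, (m p q : ℤ) * (d' p * d' q) = (m p q : ℤ) * (d p * d q) +
        ((if q = i then (m p i : ℤ) * d p * δ else 0) +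
          ((if p = i then (m i q : ℤ) * d q * δ else 0) +
            (if p = i then (if q = i then (m i i : ℤ) * δ ^ 2 else 0) else 0))) := by
      intro p q
      rw [hd, hd]
      split_ifs with h h' h' <;> subst_vars <;> ring
    simp only [e, Finset.sum_add_distrib, Finset.sum_ite_eq', Finset.mem_univ, if_true]
    have h4 : ∑ x, ∑ x_1, (if x = i then (m i x_1 : ℤ) * d x_1 * δ else 0) =
        δ * ∑ q, (m i q : ℤ) * d q := by
      rw [Finset.sum_comm]
      simp only [Finset.sum_ite_eq', Finset.mem_univ, if_true]
      rw [Finset.mul_sum]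
      exact Finset.sum_congr rfl fun q _ => by ring
    have h5 : ∑ x, (m x i : ℤ) * d x * δ = δ * ∑ q, (m i q : ℤ) * d q := by
      rw [Finset.mul_sum]
      exact Finset.sum_congr rfl fun q _ => by rw [hsymm]; ring
    rw [h4, h5]
    simp [hloop]
    ring
  rw [h1, h2, h3]
  have h6 : δ = ∑ j, m i j * d j + 1 - 2 * d i := by omega
  generalize ∑ j, (m i j : ℤ) * d j = S at *
  have : S = δ - 1 + 2 * d i := by omega
  rw [this]
  ring

namespace PPData

variable {K : Type} [Field K] {ι : Type} [Fintype ι] [LinearOrder ι] {m : ι → ι → ℕ}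
  {A : Type} [Ring A] [Algebra K A] (D : PPData K m A)
  {M : CoxeterMatrix ι} {W : Type} [Group W] (cs : CoxeterSystem M W)

lemma Iw_dims (hsymm : ∀ i j, m i j = m j i) (hloop : ∀ i, m i i = 0) (hM : IsCoxeterOf m M)
    (n : ℕ) : ∀ w : W, cs.length w = n →
      (∀ j, FiniteDimensional K (A ⧸ D.slice (D.Iw cs w) j)) ∧
      (∀ i, heights cs hsymm hM 1 w i =
        1 + ∑ j, (m i j : ℤ) * D.dimV (D.Iw cs w) j - 2 * D.dimV (D.Iw cs w) i) ∧
      (∑ p, ∑ q, (m p q : ℤ) * ((D.dimV (D.Iw cs w) p : ℤ) * D.dimV (D.Iw cs w) q)) +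
        2 * ∑ p, (D.dimV (D.Iw cs w) p : ℤ) - 2 * ∑ p, (D.dimV (D.Iw cs w) p : ℤ) ^ 2 = 0 ∧
      ∀ i, ¬cs.IsRightDescent w i → D.NoSocle (D.Iw cs w) i := by
  have soc : ∀ w : W, (∀ j, FiniteDimensional K (A ⧸ D.slice (D.Iw cs w) j)) →
      (∀ i, heights cs hsymm hM 1 w i =
        1 + ∑ j, (m i j : ℤ) * D.dimV (D.Iw cs w) j - 2 * D.dimV (D.Iw cs w) i) →
      (∑ p, ∑ q, (m p q : ℤ) * ((D.dimV (D.Iw cs w) p : ℤ) * D.dimV (D.Iw cs w) q)) +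
        2 * ∑ p, (D.dimV (D.Iw cs w) p : ℤ) - 2 * ∑ p, (D.dimV (D.Iw cs w) p : ℤ) ^ 2 = 0 →
      ∀ i, ¬cs.IsRightDescent w i → D.NoSocle (D.Iw cs w) i := by
    intro w h1 h2 h3 i hi
    obtain ⟨N, hN⟩ := D.exists_L_le_Iw cs hloop w
    have hpos := heights_pos cs hsymm hM (f := 1) (fun _ => one_pos) hi
    rcases D.mul_I_eq_or_noSocle hsymm hloop (D.Iw_biStable cs w) hN h1
      (by zify; linarith) i with h | h
    · obtain ⟨-, k, hk, -⟩ := D.dimV_mul_I hloop (D.Iw_biStable cs w) h1 i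
      rw [h] at hk
      zify at hk
      rw [h2] at hpos
      omega
    · exact h
  induction n with
  | zero =>
    intro w hw
    obtain rfl := cs.length_eq_zero_iff.1 hw
    have h0 (j : ι) : Subsingleton (A ⧸ D.slice (D.Iw cs 1) j) := by
      rw [D.Iw_one cs hsymm hloop hM, show D.slice ⊤ j = ⊤ from rfl]
      infer_instance
    have hd (j : ι) : D.dimV (D.Iw cs 1) j = 0 := Module.finrank_zero_of_subsingleton
    have h1 : ∀ j, FiniteDimensional K (A ⧸ D.slice (D.Iw cs (1 : W)) j) := fun j => inferInstance
    have h2 : ∀ i, heights cs hsymm hM 1 1 i =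
        1 + ∑ j, (m i j : ℤ) * D.dimV (D.Iw cs 1) j - 2 * D.dimV (D.Iw cs 1) i := fun i => by
      rw [heights_one]
      simp [hd]
    have h3 : (∑ p, ∑ q, (m p q : ℤ) * ((D.dimV (D.Iw cs 1) p : ℤ) * D.dimV (D.Iw cs 1) q)) +
        2 * ∑ p, (D.dimV (D.Iw cs 1) p : ℤ) - 2 * ∑ p, (D.dimV (D.Iw cs 1) p : ℤ) ^ 2 = 0 := by
      simp [hd]
    exact ⟨h1, h2, h3, soc 1 h1 h2 h3⟩
  | succ n ih =>
    intro w hw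
    obtain ⟨i, hi⟩ := cs.exists_rightDescent_of_ne_one (w := w) (by rintro rfl; simp at hw)
    have hi' : ¬cs.IsRightDescent (w * cs.simple i) i := by
      rwa [← cs.isRightDescent_iff_not_isRightDescent_mul]
    obtain ⟨v, rfl⟩ : ∃ v, w = v * cs.simple i :=
      ⟨w * cs.simple i, (cs.simple_mul_simple_cancel_right i).symm⟩
    rw [cs.simple_mul_simple_cancel_right] at hi'
    have hv : cs.length v = n := by
      have := cs.not_isRightDescent_iff.1 hi'
      omega
    obtain ⟨h1, h2, h3, h4⟩ := ih v hv
    have hT := D.Iw_biStable cs v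
    obtain ⟨hf, k, hk, hk'⟩ := D.dimV_mul_I hloop hT h1 i
    rw [hk'.2 (h4 i hi')] at hk
    have hw' := D.Iw_mul_simple cs hsymm hloop hM hi'
    rw [← hw'] at hf hk
    have hne : ∀ j, j ≠ i → D.dimV (D.Iw cs (v * cs.simple i)) j = D.dimV (D.Iw cs v) j :=
      fun j hj => by rw [hw', D.dimV_mul_I_of_ne hT hj]
    have g1 : ∀ j, FiniteDimensional K (A ⧸ D.slice (D.Iw cs (v * cs.simple i)) j) := by
      intro j
      by_cases hj : j = i
      · subst hj; exact hf
      · rw [hw', D.slice_mul_I_of_ne hT hj]; exact h1 j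
    zify at hk
    rw [add_zero] at hk
    have hsum (p : ι) : ∑ j, (m p j : ℤ) * D.dimV (D.Iw cs (v * cs.simple i)) j =
        ∑ j, (m p j : ℤ) * D.dimV (D.Iw cs v) j +
          m p i * (D.dimV (D.Iw cs (v * cs.simple i)) i - D.dimV (D.Iw cs v) i) := by
      rw [← sub_eq_iff_eq_add', ← Finset.sum_sub_distrib, Finset.sum_eq_single i]
      · ring
      · intro j _ hj; rw [hne j hj, sub_self]
      · simp
    have g2 : ∀ p, heights cs hsymm hM 1 (v * cs.simple i) p =
        1 + ∑ j, (m p j : ℤ) * D.dimV (D.Iw cs (v * cs.simple i)) j -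
          2 * D.dimV (D.Iw cs (v * cs.simple i)) p := by
      intro p
      rw [heights_mul_simple, hsum]
      by_cases hp : p = i
      · subst hp
        rw [weightRefl_same, h2, hloop]
        push_cast
        linarith
      · rw [weightRefl_of_ne m hp, h2, h2, hne p hp]
        have : (D.dimV (D.Iw cs (v * cs.simple i)) i : ℤ) - D.dimV (D.Iw cs v) i =
          1 + ∑ j, (m i j : ℤ) * D.dimV (D.Iw cs v) j - 2 * D.dimV (D.Iw cs v) i := by linarith
        rw [this]
        ring
    have g3 := quadratic_update hsymm hloop (fun j => (D.dimV (D.Iw cs v) j : ℤ))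
      (fun j => (D.dimV (D.Iw cs (v * cs.simple i)) j : ℤ)) i
      (fun j hj => by simp only [hne j hj]) hk
    rw [h3] at g3
    exact ⟨g1, g2, g3, soc _ g1 g2 g3⟩

lemma noSocle_Iw (hsymm : ∀ i j, m i j = m j i) (hloop : ∀ i, m i i = 0) (hM : IsCoxeterOf m M)
    {w : W} {i : ι} (h : ¬cs.IsRightDescent w i) : D.NoSocle (D.Iw cs w) i :=
  (D.Iw_dims cs hsymm hloop hM _ w rfl).2.2.2 i h

lemma finiteDimensional_slice_Iw (hsymm : ∀ i j, m i j = m j i) (hloop : ∀ i, m i i = 0)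
    (hM : IsCoxeterOf m M) (w : W) (j : ι) :
    FiniteDimensional K (A ⧸ D.slice (D.Iw cs w) j) :=
  (D.Iw_dims cs hsymm hloop hM _ w rfl).1 j

lemma Iw_mul_I_ne (hsymm : ∀ i j, m i j = m j i) (hloop : ∀ i, m i i = 0) (hM : IsCoxeterOf m M)
    {w : W} {i : ι} (h : ¬cs.IsRightDescent w i) : D.Iw cs w * D.I i ≠ D.Iw cs w := by
  intro h'
  obtain ⟨h1, h2, -⟩ := D.Iw_dims cs hsymm hloop hM _ w rfl
  have hpos := heights_pos cs hsymm hM (f := 1) (fun _ => one_pos) h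
  obtain ⟨-, k, hk, -⟩ := D.dimV_mul_I hloop (D.Iw_biStable cs w) h1 i
  rw [h'] at hk
  zify at hk
  rw [h2] at hpos
  omega

end PPData

end DimensionVectors

section LeftRight

open MulOpposite

namespace PPData

variable {K : Type} [Field K] {ι : Type} [Fintype ι] [LinearOrder ι] {m : ι → ι → ℕ}
  {A : Type} [Ring A] [Algebra K A] (D : PPData K m A)
  {M : CoxeterMatrix ι} {W : Type} [Group W] (cs : CoxeterSystem M W)

lemma J_le_I {l : List ι} {i : ι} (h : i ∈ l) : D.J l ≤ D.I i := by
  induction l with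
  | nil => simp at h
  | cons j l ih =>
    rw [J_cons]
    rcases List.mem_cons.1 h with rfl | h
    · exact (D.I_biStable i).mul_le_left
    · exact (D.J_biStable l).mul_le_right.trans (ih h)

lemma exists_J_le_L (hloop : ∀ i, m i i = 0) (k : ℕ) : ∃ l, D.J l ≤ D.L k := by
  induction k with
  | zero => exact ⟨[], by rw [D.L_zero]; exact le_top⟩
  | succ k ih =>
    obtain ⟨l, hl⟩ := ih
    refine ⟨l ++ Finset.univ.toList, ?_⟩
    rw [J_append]
    refine Submodule.mul_le.2 fun x hx y hy => D.L_mul_L k 1 (hl hx) ?_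
    rw [← mul_one y, ← D.sum_e, Finset.mul_sum]
    exact sum_mem fun i _ => (D.mem_I_iff hloop).1 (D.J_le_I (by simp) hy)

/-- The right socle of the algebra vanishes in the non-Dynkin case. -/
lemma noSocle_bot (cs : CoxeterSystem M W) (hsymm : ∀ i j, m i j = m j i)
    (hloop : ∀ i, m i i = 0) (hM : IsCoxeterOf m M)
    [Infinite W] (hconn : (SimpleGraph.fromRel fun i j => m i j ≠ 0).Connected) (i : ι) :
    D.NoSocle ⊥ i := by
  intro x hx
  refine (Submodule.mem_bot K).2 (D.L_inf _ fun k => ?_)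
  obtain ⟨l, hl⟩ := D.exists_J_le_L hloop k
  obtain ⟨w, hw⟩ := D.exists_J_eq_Iw cs hsymm hloop hM l
  obtain ⟨y, hy, hi⟩ := exists_prolong_not_descent cs hsymm hM hconn w i
  rw [hw] at hl
  have := D.noSocle_Iw cs hsymm hloop hM hi x fun a => by
    rw [(Submodule.mem_bot K).1 (hx a)]; exact zero_mem _
  rw [D.Iw_mul cs hsymm hloop hM hy] at this
  exact hl ((D.Iw_biStable cs w).mul_le_left this)

lemma map_op_J (l : List ι) :
    (D.J l).map (opLinearEquiv K : A ≃ₗ[K] Aᵐᵒᵖ).toLinearMap = D.op.J l.reverse := by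
  induction l with
  | nil => rw [List.reverse_nil, J_nil, J_nil, Submodule.map_top, LinearEquiv.range]
  | cons i l ih =>
    rw [J_cons, List.reverse_cons, J_append, J_singleton, ← ih, ← map_op_I, ← Submodule.map_op_mul]

lemma op_mem_Iw (hsymm : ∀ i j, m i j = m j i) (hloop : ∀ i, m i i = 0) (hM : IsCoxeterOf m M)
    {w : W} {x : A} : MulOpposite.op x ∈ D.op.Iw cs w⁻¹ ↔ x ∈ D.Iw cs w := by
  obtain ⟨l, hl, rfl⟩ := cs.exists_isReduced w
  rw [← D.J_eq_Iw cs hsymm hloop hM hl, ← cs.wordProd_reverse,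
    ← D.op.J_eq_Iw cs hsymm hloop hM ((cs.isReduced_reverse_iff l).2 hl), ← map_op_J]
  constructor
  · rintro ⟨y, hy, h⟩
    rwa [← op_injective h]
  · exact fun h => ⟨x, h, rfl⟩

lemma map_op_Iw (hsymm : ∀ i j, m i j = m j i) (hloop : ∀ i, m i i = 0) (hM : IsCoxeterOf m M)
    (w : W) : (D.Iw cs w).map (opLinearEquiv K : A ≃ₗ[K] Aᵐᵒᵖ).toLinearMap = D.op.Iw cs w⁻¹ := by
  ext x
  constructor
  · rintro ⟨y, hy, rfl⟩
    exact (D.op_mem_Iw cs hsymm hloop hM).2 hy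
  · intro h
    exact ⟨x.unop, (D.op_mem_Iw cs hsymm hloop hM).1 (by simpa using h), rfl⟩

lemma biStable_map_op {T : Submodule K A} (hT : BiStable T) :
    BiStable (T.map (opLinearEquiv K : A ≃ₗ[K] Aᵐᵒᵖ).toLinearMap) where
  left a x hx := by
    obtain ⟨y, hy, rfl⟩ := hx
    exact ⟨y * a.unop, hT.right _ hy, rfl⟩
  right a x hx := by
    obtain ⟨y, hy, rfl⟩ := hx
    exact ⟨a.unop * y, hT.left _ hy, rfl⟩

lemma mem_I_mul_iff (hloop : ∀ i, m i i = 0) {i : ι} {T : Submodule K A}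
    (hT : BiStable T) {x : A} :
    x ∈ D.I i * T ↔ x ∈ T ∧ ∃ t : Arr m i → A, (∀ a, t a ∈ T) ∧
      D.e i * x = ∑ a, D.out i a * t a := by
  have h1 : x ∈ D.I i * T ↔
      MulOpposite.op x ∈ T.map (opLinearEquiv K : A ≃ₗ[K] Aᵐᵒᵖ).toLinearMap * D.op.I i := by
    rw [← map_op_I, ← Submodule.map_op_mul]
    exact ⟨fun h => ⟨x, h, rfl⟩, fun ⟨y, hy, h⟩ => by rwa [← op_injective h]⟩
  rw [h1, D.op.mem_mul_I_iff hloop (biStable_map_op hT).right]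
  refine and_congr ⟨fun ⟨y, hy, h⟩ => by rwa [← op_injective h], fun h => ⟨x, h, rfl⟩⟩ ?_
  constructor
  · rintro ⟨t, ht, h⟩
    refine ⟨fun a => (t a).unop, fun a => ?_, ?_⟩
    · obtain ⟨y, hy, h⟩ := ht a
      change unop (t a) ∈ T
      rw [← h]; exact hy
    · have h := congrArg unop h
      simp only [unop_mul, unop_op, Finset.unop_sum] at h
      exact h
  · rintro ⟨t, ht, h⟩
    refine ⟨fun a => MulOpposite.op (t a), fun a => ⟨t a, ht a, rfl⟩, unop_injective ?_⟩
    simp only [unop_mul, unop_op, Finset.unop_sum]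
    exact h

lemma I_mul_Iw_ne (hsymm : ∀ i j, m i j = m j i) (hloop : ∀ i, m i i = 0) (hM : IsCoxeterOf m M)
    {w : W} {i : ι} (h : ¬cs.IsLeftDescent w i) : D.I i * D.Iw cs w ≠ D.Iw cs w := by
  intro h'
  refine D.op.Iw_mul_I_ne cs hsymm hloop hM (w := w⁻¹) (i := i)
    (by rwa [cs.isRightDescent_inv_iff]) ?_
  rw [← D.map_op_Iw cs hsymm hloop hM, ← map_op_I, ← Submodule.map_op_mul, h']

lemma I_mul_Iw_of_descent (hsymm : ∀ i j, m i j = m j i) (hloop : ∀ i, m i i = 0)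
    (hM : IsCoxeterOf m M) {w : W} {i : ι} (h : cs.IsLeftDescent w i) :
    D.I i * D.Iw cs w = D.Iw cs w := by
  have h1 : ¬cs.IsLeftDescent (cs.simple i * w) i := by
    rwa [← cs.isLeftDescent_iff_not_isLeftDescent_mul]
  have h2 := D.Iw_simple_mul cs hsymm hloop hM h1
  rw [cs.simple_mul_simple_cancel_left] at h2
  rw [h2, ← mul_assoc, D.I_mul_self]

lemma e_mul_mem_Iw (hsymm : ∀ i j, m i j = m j i) (hloop : ∀ i, m i i = 0) (hM : IsCoxeterOf m M)
    {w : W} {i : ι} (h : ¬cs.IsLeftDescent w i) {x : A} (hx : ∀ a, D.inn i a * x ∈ D.Iw cs w) :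
    D.e i * x ∈ D.Iw cs w :=
  (D.op_mem_Iw cs hsymm hloop hM).1 <|
    D.op.noSocle_Iw cs hsymm hloop hM (w := w⁻¹) (i := i) (by rwa [cs.isRightDescent_inv_iff])
      (MulOpposite.op x) fun a => (D.op_mem_Iw cs hsymm hloop hM).2 (hx a)

lemma mem_Iw_of_I_mul (hsymm : ∀ i j, m i j = m j i) (hloop : ∀ i, m i i = 0)
    (hM : IsCoxeterOf m M) {w : W} {i : ι} (h : ¬cs.IsLeftDescent w i) {x : A}
    (hx : ∀ y ∈ D.I i, y * x ∈ D.Iw cs w) : x ∈ D.Iw cs w := by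
  have := add_mem (hx _ (D.one_sub_e_mem_I i)) (D.e_mul_mem_Iw cs hsymm hloop hM h
    fun a => hx _ (D.inn_mem_I hloop i a))
  rwa [sub_mul, one_mul, sub_add_cancel] at this

lemma mem_Iw_of_Iw_mul (hsymm : ∀ i j, m i j = m j i) (hloop : ∀ i, m i i = 0)
    (hM : IsCoxeterOf m M) (n : ℕ) : ∀ v u : W, cs.length v = n →
      cs.length (v * u) = cs.length v + cs.length u →
      ∀ x : A, (∀ y ∈ D.Iw cs v, y * x ∈ D.Iw cs (v * u)) → x ∈ D.Iw cs u := by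
  induction n with
  | zero =>
    intro v u hv _ x hx
    obtain rfl := cs.length_eq_zero_iff.1 hv
    rw [D.Iw_one cs hsymm hloop hM, one_mul] at hx
    simpa using hx 1 trivial
  | succ n ih =>
    intro v u hv hvu x hx
    obtain ⟨i, hi⟩ := cs.exists_leftDescent_of_ne_one (w := v) (by rintro rfl; simp at hv)
    have hi' := hi
    rw [cs.isLeftDescent_iff_not_isLeftDescent_mul] at hi'
    obtain ⟨v, rfl⟩ : ∃ v', v = cs.simple i * v' :=
      ⟨cs.simple i * v, (cs.simple_mul_simple_cancel_left i).symm⟩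
    rw [cs.simple_mul_simple_cancel_left] at hi'
    have hl := cs.not_isLeftDescent_iff.1 hi'
    have hle := cs.length_mul_le v u
    have hsle := cs.length_mul_le (cs.simple i) (v * u)
    rw [cs.length_simple, ← mul_assoc] at hsle
    have hnd : ¬cs.IsLeftDescent (v * u) i := by
      rw [cs.not_isLeftDescent_iff, ← mul_assoc]
      omega
    refine ih v u (by omega) (by omega) x fun y hy =>
      D.mem_Iw_of_I_mul cs hsymm hloop hM hnd fun z hz => ?_
    rw [← mul_assoc]
    have := hx (z * y) (by
      rw [D.Iw_simple_mul cs hsymm hloop hM hi']; exact Submodule.mul_mem_mul hz hy)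
    rw [mul_assoc (cs.simple i), D.Iw_simple_mul cs hsymm hloop hM hnd] at this
    exact (D.Iw_biStable cs _).mul_le_right this

lemma Iw_ne_top (hsymm : ∀ i j, m i j = m j i) (hloop : ∀ i, m i i = 0) (hM : IsCoxeterOf m M)
    {w : W} (hw : w ≠ 1) : D.Iw cs w ≠ ⊤ := by
  intro h
  obtain ⟨i, hi⟩ := cs.exists_leftDescent_of_ne_one hw
  refine D.e_not_mem_I hloop i ((D.I_biStable i).mul_le_left
    (show D.e i ∈ D.I i * D.Iw cs w from ?_))
  rw [D.I_mul_Iw_of_descent cs hsymm hloop hM hi, h]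
  trivial

lemma Iw_injective (hsymm : ∀ i j, m i j = m j i) (hloop : ∀ i, m i i = 0)
    (hM : IsCoxeterOf m M) : Function.Injective (D.Iw cs) := by
  have key : ∀ n, ∀ v w : W, cs.length v = n → D.Iw cs v = D.Iw cs w → v = w := by
    intro n
    induction n with
    | zero =>
      intro v w hv h
      obtain rfl := cs.length_eq_zero_iff.1 hv
      by_contra hw
      rw [D.Iw_one cs hsymm hloop hM] at h
      exact D.Iw_ne_top cs hsymm hloop hM (Ne.symm hw) h.symm
    | succ n ih =>
      intro v w hv h
      obtain ⟨i, hi⟩ := cs.exists_leftDescent_of_ne_one (w := v) (by rintro rfl; simp at hv)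
      have hw : cs.IsLeftDescent w i := by
        by_contra hw
        refine D.I_mul_Iw_ne cs hsymm hloop hM hw ?_
        rw [← h, D.I_mul_Iw_of_descent cs hsymm hloop hM hi]
      have hi' := hi
      rw [cs.isLeftDescent_iff_not_isLeftDescent_mul] at hi'
      rw [cs.isLeftDescent_iff_not_isLeftDescent_mul] at hw
      obtain ⟨v, rfl⟩ : ∃ v', v = cs.simple i * v' :=
        ⟨cs.simple i * v, (cs.simple_mul_simple_cancel_left i).symm⟩
      obtain ⟨w, rfl⟩ : ∃ w', w = cs.simple i * w' :=
        ⟨cs.simple i * w, (cs.simple_mul_simple_cancel_left i).symm⟩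
      rw [cs.simple_mul_simple_cancel_left] at hi' hw
      have hl := cs.not_isLeftDescent_iff.1 hi'
      rw [D.Iw_simple_mul cs hsymm hloop hM hi', D.Iw_simple_mul cs hsymm hloop hM hw] at h
      rw [ih v w (by omega) (le_antisymm (fun x hx => ?_) fun x hx => ?_)]
      · refine D.mem_Iw_of_I_mul cs hsymm hloop hM hw fun y hy => ?_
        exact (D.Iw_biStable cs w).mul_le_right (h ▸ Submodule.mul_mem_mul hy hx)
      · refine D.mem_Iw_of_I_mul cs hsymm hloop hM hi' fun y hy => ?_
        exact (D.Iw_biStable cs v).mul_le_right (h ▸ Submodule.mul_mem_mul hy hx)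
  exact fun v w h => key _ v w rfl h

/-- The algebra has no left socle. -/
def LeftFree : Prop := ∀ i x, (∀ a, D.inn i a * x = 0) → D.e i * x = 0

lemma leftFree (cs : CoxeterSystem M W) (hsymm : ∀ i j, m i j = m j i)
    (hloop : ∀ i, m i i = 0) (hM : IsCoxeterOf m M)
    [Infinite W] (hconn : (SimpleGraph.fromRel fun i j => m i j ≠ 0).Connected) : D.LeftFree := by
  intro i x hx
  have := (Submodule.mem_bot K).1 (D.op.noSocle_bot cs hsymm hloop hM hconn i (MulOpposite.op x) fun a =>
    (Submodule.mem_bot K).2 (unop_injective (hx a)))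
  exact congrArg unop this

lemma eq_zero_of_I_mul (hloop : ∀ i, m i i = 0) (hD : D.LeftFree) {i : ι} {x : A}
    (hx : ∀ y ∈ D.I i, y * x = 0) : x = 0 := by
  have h1 := hx _ (D.one_sub_e_mem_I i)
  rw [sub_mul, one_mul, hD i x fun a => hx _ (D.inn_mem_I hloop i a), sub_zero] at h1
  exact h1

lemma eq_zero_of_J_mul (hloop : ∀ i, m i i = 0) (hD : D.LeftFree) (l : List ι) {x : A}
    (hx : ∀ y ∈ D.J l, y * x = 0) : x = 0 := by
  induction l with
  | nil => simpa using hx 1 (by rw [J_nil]; trivial)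
  | cons i l ih =>
    refine ih fun y hy => D.eq_zero_of_I_mul hloop hD (i := i) fun z hz => ?_
    rw [← mul_assoc]
    exact hx _ (by rw [J_cons]; exact Submodule.mul_mem_mul hz hy)

end PPData

/-- A two-sided stable subspace as a left ideal. -/
def BiStable.toIdeal {K A : Type} [Field K] [Ring A] [Algebra K A] {T : Submodule K A}
    (hT : BiStable T) : Ideal A :=
  { T.toAddSubmonoid with smul_mem' := fun a _ hx => hT.left a hx }

lemma BiStable.mem_toIdeal {K A : Type} [Field K] [Ring A] [Algebra K A] {T : Submodule K A}
    (hT : BiStable T) {x : A} : x ∈ hT.toIdeal ↔ x ∈ T := Iff.rfl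

namespace PPData

variable {K : Type} [Field K] {ι : Type} [Fintype ι] [LinearOrder ι] {m : ι → ι → ℕ}
  {A : Type} [Ring A] [Algebra K A] (D : PPData K m A)

lemma exists_eq_mul_of_I (hloop : ∀ i, m i i = 0) (i : ι)
    (f : (D.I_biStable i).toIdeal →ₗ[A] A) :
    ∃ z, ∀ y : (D.I_biStable i).toIdeal, f y = y.1 * z := by
  let p : A := f ⟨1 - D.e i, D.one_sub_e_mem_I i⟩
  let q : Arr m i → A := fun a => f ⟨D.inn i a, D.inn_mem_I hloop i a⟩
  have hsm (c : A) (y : (D.I_biStable i).toIdeal) : c * f y = f (c • y) := (map_smul f c y).symm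
  have hq (a : Arr m i) : D.e a.1 * q a = q a := by
    rw [hsm]; exact congrArg f (Subtype.ext (D.e_inn i a))
  obtain ⟨z, hz⟩ := D.exact_left i q (by
    have : ∀ a : Arr m i, ppSign K i a.1 • (D.ar i a.1 a.2 * q a) =
        f ((algebraMap K A (ppSign K i a.1) * D.out i a) • ⟨D.inn i a, D.inn_mem_I hloop i a⟩) := by
      intro a
      rw [map_smul, smul_eq_mul, mul_assoc, Algebra.smul_def]
      rfl
    simp only [this, ← map_sum]
    rw [← map_zero f]
    refine congrArg f (Subtype.ext ?_)
    rw [← Submodule.subtype_apply, map_sum]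
    simp only [Submodule.subtype_apply, Submodule.coe_smul, smul_eq_mul,
      ← Algebra.smul_def]
    simpa [smul_mul_assoc] using D.rel' i)
  refine ⟨(1 - D.e i) * p + D.e i * z, fun y => ?_⟩
  obtain ⟨t, ht⟩ := (D.mul_e_mem_L_one_iff i y.1).1 ((D.mem_I_iff hloop).1 y.2)
  have hy : y = y.1 • ⟨1 - D.e i, D.one_sub_e_mem_I i⟩ +
      ∑ a, t a • (⟨D.inn i a, D.inn_mem_I hloop i a⟩ : (D.I_biStable i).toIdeal) := by
    refine Subtype.ext ?_
    rw [Submodule.coe_add, AddSubmonoidClass.coe_finsetSum]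
    simp only [Submodule.coe_smul, smul_eq_mul]
    rw [← ht, mul_sub, mul_one, sub_add_cancel]
  have hp : (1 - D.e i) * p = p := by
    rw [hsm]
    refine congrArg f (Subtype.ext ?_)
    change (1 - D.e i) * (1 - D.e i) = 1 - D.e i
    rw [mul_sub, mul_one, sub_mul, one_mul, D.e_mul_self, sub_self, sub_zero]
  have h1 : y.1 * (D.e i * z) = ∑ a, t a * q a := by
    rw [← mul_assoc, ht, Finset.sum_mul]
    refine Finset.sum_congr rfl fun a _ => ?_
    rw [← hq, hz, mul_assoc]
    rfl
  conv_lhs => rw [hy]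
  rw [map_add, map_smul, map_sum, hp, mul_add, h1]
  simp only [map_smul, smul_eq_mul]
  rfl

/-- Every left linear map from a product of the ideals `I_i` to the algebra is a right
multiplication. -/
lemma exists_eq_mul_of_J (hloop : ∀ i, m i i = 0) (hD : D.LeftFree) (l : List ι)
    (f : (D.J_biStable l).toIdeal →ₗ[A] A) :
    ∃ z, ∀ y : (D.J_biStable l).toIdeal, f y = y.1 * z := by
  induction l with
  | nil =>
    have h1 : (1 : A) ∈ D.J [] := by rw [J_nil]; trivial
    refine ⟨f ⟨1, h1⟩, fun y => ?_⟩
    rw [← smul_eq_mul, ← map_smul]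
    exact congrArg f (Subtype.ext (mul_one y.1).symm)
  | cons i l ih =>
    have hmem {y u : A} (hy : y ∈ D.I i) (hu : u ∈ D.J l) : y * u ∈ D.J (i :: l) := by
      rw [J_cons]; exact Submodule.mul_mem_mul hy hu
    have hex (u : (D.J_biStable l).toIdeal) : ∃ z, ∀ y (hy : y ∈ D.I i),
        f ⟨y * u.1, hmem hy u.2⟩ = y * z := by
      let h : (D.I_biStable i).toIdeal →ₗ[A] A :=
        { toFun := fun y => f ⟨y.1 * u.1, hmem y.2 u.2⟩
          map_add' := fun y y' => by
            rw [← map_add]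
            exact congrArg f (Subtype.ext (add_mul _ _ _))
          map_smul' := fun c y => by
            rw [RingHom.id_apply, ← map_smul]
            exact congrArg f (Subtype.ext (mul_assoc _ _ _)) }
      obtain ⟨z, hz⟩ := D.exists_eq_mul_of_I hloop i h
      exact ⟨z, fun y hy => hz ⟨y, hy⟩⟩
    choose z hz using hex
    have huniq {a b : A} (h : ∀ y ∈ D.I i, y * a = y * b) : a = b :=
      sub_eq_zero.1 (D.eq_zero_of_I_mul hloop hD (i := i) fun y hy => by
        rw [mul_sub, h y hy, sub_self])
    let g : (D.J_biStable l).toIdeal →ₗ[A] A :=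
      { toFun := z
        map_add' := fun u u' => huniq fun y hy => by
          rw [mul_add, ← hz _ y hy, ← hz _ y hy, ← hz _ y hy, ← map_add]
          exact congrArg f (Subtype.ext (mul_add _ _ _))
        map_smul' := fun c u => huniq fun y hy => by
          rw [RingHom.id_apply, smul_eq_mul, ← mul_assoc, ← hz _ y hy,
            ← hz _ (y * c) ((D.I_biStable i).right _ hy)]
          exact congrArg f (Subtype.ext (mul_assoc _ _ _).symm) }
    obtain ⟨z', hz'⟩ := ih g
    refine ⟨z', ?_⟩
    rintro ⟨y, hy⟩
    have hy' : y ∈ D.I i * D.J l := by rw [← J_cons]; exact hy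
    suffices h : ∃ hy : y ∈ D.J (i :: l), f ⟨y, hy⟩ = y * z' from h.2
    clear hy
    induction hy' using Submodule.mul_induction_on' with
    | mem_mul_mem a ha b hb =>
      exact ⟨hmem ha hb, by rw [hz ⟨b, hb⟩ a ha, mul_assoc, ← hz' ⟨b, hb⟩]; rfl⟩
    | add a _ b _ h1 h2 =>
      obtain ⟨h1, h1'⟩ := h1
      obtain ⟨h2, h2'⟩ := h2
      refine ⟨add_mem h1 h2, ?_⟩
      rw [add_mul, ← h1', ← h2', ← map_add]
      rfl

end PPData

end LeftRight

section Ext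

variable {Λ : Type} [Ring Λ] {X Y B C E : Type} [AddCommGroup X] [Module Λ X]
  [AddCommGroup Y] [Module Λ Y] [AddCommGroup B] [Module Λ B] [AddCommGroup C] [Module Λ C]
  [AddCommGroup E] [Module Λ E]

/-- If `Ext¹(B, Y) = 0`, then maps out of `B` lift along extensions with kernel `Y`. -/
lemma Ext1Vanishes.exists_lift (h : Ext1Vanishes Λ B Y) {i : Y →ₗ[Λ] E} {p : E →ₗ[Λ] C}
    (hi : Function.Injective i) (hp : Function.Surjective p) (hip : Function.Exact i p)
    (g : B →ₗ[Λ] C) : ∃ k : B →ₗ[Λ] E, p ∘ₗ k = g := by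
  let N : Submodule Λ (E × B) := LinearMap.ker (p.coprod (-g))
  have hN {x : E × B} : x ∈ N ↔ p x.1 = g x.2 := by
    simp [N, LinearMap.mem_ker, ← sub_eq_add_neg, sub_eq_zero]
  have hpi (y : Y) : p (i y) = 0 := (hip _).2 ⟨y, rfl⟩
  obtain ⟨s, hs⟩ := h N ((i.prod 0).codRestrict N fun y => hN.2 (by simp [hpi]))
    ((LinearMap.snd Λ E B).comp N.subtype)
    (fun y y' hy => hi (congrArg (fun x : N => x.1.1) hy))
    (fun b => by
      obtain ⟨e, he⟩ := hp (g b)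
      exact ⟨⟨(e, b), hN.2 he⟩, rfl⟩)
    (fun x => by
      constructor
      · intro hx
        have h2 : x.1.2 = 0 := hx
        have h1 := hN.1 x.2
        rw [h2, map_zero] at h1
        obtain ⟨y, hy⟩ := (hip _).1 h1
        exact ⟨y, Subtype.ext (Prod.ext hy h2.symm)⟩
      · rintro ⟨y, rfl⟩
        rfl)
  refine ⟨(LinearMap.fst Λ E B) ∘ₗ N.subtype ∘ₗ s, LinearMap.ext fun b => ?_⟩
  exact (hN.1 (s b).2).trans (congrArg g (LinearMap.congr_fun hs b))

lemma ext1Vanishes_of_projective [Module.Projective Λ B] : Ext1Vanishes Λ B Y :=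
  fun _ _ _ _ p _ hp _ => Module.projective_lifting_property p LinearMap.id hp

lemma Ext1Vanishes.of_retract (h : Ext1Vanishes Λ B Y) (j : X →ₗ[Λ] B) (r : B →ₗ[Λ] X)
    (hrj : r ∘ₗ j = LinearMap.id) : Ext1Vanishes Λ X Y := by
  intro E _ _ i p hi hp hip
  obtain ⟨k, hk⟩ := h.exists_lift hi hp hip r
  exact ⟨k ∘ₗ j, by rw [← LinearMap.comp_assoc, hk, hrj]⟩

lemma Ext1Vanishes.pi {κ : Type} [Fintype κ] {X : κ → Type} [∀ a, AddCommGroup (X a)]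
    [∀ a, Module Λ (X a)] (h : ∀ a, Ext1Vanishes Λ (X a) Y) : Ext1Vanishes Λ (∀ a, X a) Y := by
  classical
  intro E _ _ i p hi hp hip
  choose k hk using fun a => (h a).exists_lift hi hp hip (LinearMap.single Λ X a)
  refine ⟨∑ a, k a ∘ₗ LinearMap.proj a, LinearMap.ext fun x => ?_⟩
  have hk' (a : κ) (y : X a) : p (k a y) = Pi.single a y := LinearMap.congr_fun (hk a) y
  simp [hk', Finset.univ_sum_single]

lemma Ext1Vanishes.prod (hX : Ext1Vanishes Λ X Y) (hB : Ext1Vanishes Λ B Y) :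
    Ext1Vanishes Λ (X × B) Y := by
  intro E _ _ i p hi hp hip
  obtain ⟨k, hk⟩ := hX.exists_lift hi hp hip (LinearMap.inl Λ X B)
  obtain ⟨k', hk'⟩ := hB.exists_lift hi hp hip (LinearMap.inr Λ X B)
  refine ⟨k.coprod k', ?_⟩
  rw [LinearMap.comp_coprod, hk, hk', LinearMap.coprod_inl_inr]

/-- Vanishing of `Ext¹(C, Y)` from a short exact sequence `0 → X → B → C → 0`. -/
lemma Ext1Vanishes.of_exact (hB : Ext1Vanishes Λ B Y) {f : X →ₗ[Λ] B} {g : B →ₗ[Λ] C}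
    (hg : Function.Surjective g) (hfg : Function.Exact f g)
    (hext : ∀ φ : X →ₗ[Λ] Y, ∃ ψ : B →ₗ[Λ] Y, ψ ∘ₗ f = φ) : Ext1Vanishes Λ C Y := by
  intro E _ _ i p hi hp hip
  obtain ⟨k, hk⟩ := hB.exists_lift hi hp hip g
  have hk' (b : B) : p (k b) = g b := LinearMap.congr_fun hk b
  have hgf (x : X) : g (f x) = 0 := (hfg _).2 ⟨x, rfl⟩
  have hmem (x : X) : k (f x) ∈ LinearMap.range i := (hip _).1 (by rw [hk', hgf])
  obtain ⟨ψ, hψ⟩ := hext ((LinearEquiv.ofInjective i hi).symm.toLinearMap ∘ₗ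
    (k ∘ₗ f).codRestrict _ hmem)
  have hψ' (x : X) : i (ψ (f x)) = k (f x) := by
    have h1 := LinearMap.congr_fun hψ x
    have h2 := congrArg (fun y => (LinearEquiv.ofInjective i hi y).1) h1
    simpa using h2
  have hker : LinearMap.ker g ≤ LinearMap.ker (k - i ∘ₗ ψ) := by
    intro b hb
    obtain ⟨x, rfl⟩ := (hfg _).1 hb
    simp [hψ']
  refine ⟨(LinearMap.ker g).liftQ _ hker ∘ₗ (g.quotKerEquivOfSurjective hg).symm.toLinearMap,
    LinearMap.ext fun c => ?_⟩
  obtain ⟨b, rfl⟩ := hg c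
  have hb : (g.quotKerEquivOfSurjective hg).symm (g b) = (LinearMap.ker g).mkQ b := by
    rw [LinearEquiv.symm_apply_eq]
    rfl
  have hpi : p (i (ψ b)) = 0 := (hip _).2 ⟨_, rfl⟩
  simp [hb, hk', hpi]

/-- If `Ext¹(C, Y) = 0`, then maps to `Y` extend along the monomorphism in a short exact sequence
with cokernel `C`. -/
lemma Ext1Vanishes.exists_extend (hC : Ext1Vanishes Λ C Y) {f : X →ₗ[Λ] B} {g : B →ₗ[Λ] C}
    (hf : Function.Injective f) (hg : Function.Surjective g) (hfg : Function.Exact f g)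
    (φ : X →ₗ[Λ] Y) : ∃ ψ : B →ₗ[Λ] Y, ψ ∘ₗ f = φ := by
  let N : Submodule Λ (Y × B) := LinearMap.range (φ.prod (-f))
  have hgf (x : X) : g (f x) = 0 := (hfg _).2 ⟨x, rfl⟩
  let i : Y →ₗ[Λ] (Y × B) ⧸ N := N.mkQ ∘ₗ LinearMap.inl Λ Y B
  let p : (Y × B) ⧸ N →ₗ[Λ] C := N.liftQ (g ∘ₗ LinearMap.snd Λ Y B) (by
    rintro _ ⟨x, rfl⟩
    simp [hgf])
  have hi : Function.Injective i := by
    rw [← LinearMap.ker_eq_bot, LinearMap.ker_eq_bot']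
    intro y hy
    obtain ⟨x, hx⟩ := (Submodule.Quotient.mk_eq_zero N).1 hy
    have h2 : -f x = 0 := congrArg Prod.snd hx
    have hx0 : x = 0 := hf (by rw [map_zero]; exact neg_eq_zero.1 h2)
    have h1 : φ x = y := congrArg Prod.fst hx
    rw [← h1, hx0, map_zero]
  have hp : Function.Surjective p := fun c => by
    obtain ⟨b, rfl⟩ := hg c
    exact ⟨N.mkQ (0, b), rfl⟩
  have hip : Function.Exact i p := by
    intro e
    constructor
    · obtain ⟨⟨y, b⟩, rfl⟩ := N.mkQ_surjective e
      intro h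
      obtain ⟨x, hx⟩ := (hfg b).1 h
      refine ⟨y + φ x, (Submodule.Quotient.eq N).2 ⟨x, ?_⟩⟩
      simp [hx]
    · rintro ⟨y, rfl⟩
      change g 0 = 0
      exact map_zero g
  obtain ⟨r, hr⟩ : ∃ r : _ →ₗ[Λ] Y, r ∘ₗ i = LinearMap.id :=
    ((hip.split_tfae hi hp).out 0 1).1 (hC _ i p hi hp hip)
  refine ⟨r ∘ₗ N.mkQ ∘ₗ LinearMap.inr Λ Y B, LinearMap.ext fun x => ?_⟩
  have h1 : N.mkQ (0, f x) = i (φ x) := by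
    refine ((Submodule.Quotient.eq N).2 ⟨-x, ?_⟩)
    simp
  have h2 : r (i (φ x)) = φ x := LinearMap.congr_fun hr (φ x)
  rw [← h2, ← h1]
  rfl

/-- A module with a resolution of length one by finitely generated projective modules. -/
def HasShortResolution (Λ : Type) [Ring Λ] (X : Type) [AddCommGroup X] [Module Λ X] : Prop :=
  ∃ (P Q : Type) (_ : AddCommGroup P) (_ : Module Λ P) (_ : AddCommGroup Q) (_ : Module Λ Q)
    (i : Q →ₗ[Λ] P) (p : P →ₗ[Λ] X), Module.Finite Λ P ∧ Module.Projective Λ P ∧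
    Module.Finite Λ Q ∧ Module.Projective Λ Q ∧ Function.Injective i ∧ Function.Surjective p ∧
    Function.Exact i p

/-- A map that lands in the range of an injective map factors through it. -/
lemma exists_comp_eq_of_range {f : X →ₗ[Λ] B} (hf : Function.Injective f) (g : C →ₗ[Λ] B)
    (h : ∀ c, g c ∈ LinearMap.range f) : ∃ k : C →ₗ[Λ] X, f ∘ₗ k = g :=
  ⟨(LinearEquiv.ofInjective f hf).symm.toLinearMap ∘ₗ g.codRestrict _ h, LinearMap.ext fun c => by
    exact congrArg Subtype.val
      ((LinearEquiv.ofInjective f hf).apply_symm_apply (g.codRestrict _ h c))⟩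

lemma HasShortResolution.of_projective [Module.Finite Λ X] [Module.Projective Λ X] :
    HasShortResolution Λ X :=
  ⟨X, PUnit, inferInstance, inferInstance, inferInstance, inferInstance, 0, LinearMap.id,
    inferInstance, inferInstance, inferInstance, inferInstance,
    fun _ _ _ => Subsingleton.elim _ _, Function.surjective_id, fun x =>
      ⟨fun h => ⟨0, by simpa using h.symm⟩, by rintro ⟨y, rfl⟩; simp⟩⟩

/-- The horseshoe lemma. -/
lemma HasShortResolution.of_exact (hX : HasShortResolution Λ X) (hC : HasShortResolution Λ C)
    {f : X →ₗ[Λ] B} {g : B →ₗ[Λ] C} (hf : Function.Injective f) (hg : Function.Surjective g)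
    (hfg : Function.Exact f g) : HasShortResolution Λ B := by
  obtain ⟨P, Q, _, _, _, _, i, p, h1, h2, h3, h4, h5, h6, h7⟩ := hX
  obtain ⟨P', Q', _, _, _, _, i', p', h1', h2', h3', h4', h5', h6', h7'⟩ := hC
  have hgf (x : X) : g (f x) = 0 := (hfg _).2 ⟨x, rfl⟩
  have hpi (x) : p (i x) = 0 := (h7 _).2 ⟨x, rfl⟩
  have hpi' (x) : p' (i' x) = 0 := (h7' _).2 ⟨x, rfl⟩
  obtain ⟨h, hh⟩ := Module.projective_lifting_property g p' hg
  have hh' (x) : g (h x) = p' x := LinearMap.congr_fun hh x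
  obtain ⟨k, hk⟩ := exists_comp_eq_of_range hf (h ∘ₗ i') fun c => (hfg _).1 (by
    rw [LinearMap.comp_apply, hh', hpi'])
  obtain ⟨σ, hσ⟩ := Module.projective_lifting_property p (-k) h6
  have hσ' (c) : f (p (σ c)) = -h (i' c) := by
    have e1 : p (σ c) = -k c := LinearMap.congr_fun hσ c
    have e2 : f (k c) = h (i' c) := LinearMap.congr_fun hk c
    rw [e1, map_neg, e2]
  refine ⟨P × P', Q × Q', _, _, _, _, (i.coprod σ).prod (i' ∘ₗ LinearMap.snd Λ Q Q'),
    (f ∘ₗ p).coprod h, inferInstance, inferInstance, inferInstance, inferInstance, ?_, ?_, ?_⟩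
  · rw [← LinearMap.ker_eq_bot, LinearMap.ker_eq_bot']
    rintro ⟨q, r⟩ hqr
    have hr : i' r = 0 := congrArg Prod.snd hqr
    have hr0 : r = 0 := h5' (by rw [hr, map_zero])
    have hq : i q + σ r = 0 := congrArg Prod.fst hqr
    rw [hr0, map_zero, add_zero] at hq
    rw [hr0, h5 (hq.trans (map_zero i).symm)]
    rfl
  · intro b
    obtain ⟨y, hy⟩ := h6' (g b)
    obtain ⟨x, hx⟩ := (hfg (b - h y)).1 (by rw [map_sub, hh', hy, sub_self])
    obtain ⟨z, rfl⟩ := h6 x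
    exact ⟨(z, y), by simp [hx]⟩
  · rintro ⟨x, y⟩
    constructor
    · intro hxy
      have hxy : f (p x) + h y = 0 := hxy
      have hy : p' y = 0 := by
        simpa [hgf, hh'] using congrArg g hxy
      obtain ⟨r, rfl⟩ := (h7' _).1 hy
      obtain ⟨q, hq⟩ := (h7 (x - σ r)).1 (hf (by
        rw [map_sub, map_sub, hσ', sub_neg_eq_add, hxy, map_zero]))
      exact ⟨(q, r), by simp [hq]⟩
    · rintro ⟨⟨q, r⟩, hqr⟩
      have e1 : i q + σ r = x := congrArg Prod.fst hqr
      have e2 : i' r = y := congrArg Prod.snd hqr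
      change f (p x) + h y = 0
      rw [← e1, ← e2, map_add, map_add, hpi, map_zero, hσ', zero_add, neg_add_cancel]

/-- The cokernel of a finitely generated projective submodule inherits a short resolution, if the
quotient lifts. -/
lemma HasShortResolution.of_projective_kernel [Module.Finite Λ X] [Module.Projective Λ X]
    (hB : HasShortResolution Λ B) {f : X →ₗ[Λ] B} {g : B →ₗ[Λ] C} (hf : Function.Injective f)
    (hg : Function.Surjective g) (hfg : Function.Exact f g) : HasShortResolution Λ C := by
  obtain ⟨P, Q, _, _, _, _, i, p, h1, h2, h3, h4, h5, h6, h7⟩ := hB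
  have hgf (x : X) : g (f x) = 0 := (hfg _).2 ⟨x, rfl⟩
  have hpi (x) : p (i x) = 0 := (h7 _).2 ⟨x, rfl⟩
  obtain ⟨τ, hτ⟩ := Module.projective_lifting_property p f h6
  have hτ' (x) : p (τ x) = f x := LinearMap.congr_fun hτ x
  refine ⟨P, Q × X, _, _, _, _, i.coprod τ, g ∘ₗ p, inferInstance, inferInstance, inferInstance,
    inferInstance, ?_, hg.comp h6, fun x => ⟨fun hx => ?_, ?_⟩⟩
  · rw [← LinearMap.ker_eq_bot, LinearMap.ker_eq_bot']
    rintro ⟨q, r⟩ hqr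
    have hqr : i q + τ r = 0 := hqr
    have hr : f r = 0 := by simpa [hpi, hτ'] using congrArg p hqr
    have hr0 : r = 0 := hf (by rw [hr, map_zero])
    rw [hr0, map_zero, add_zero] at hqr
    rw [hr0, h5 (hqr.trans (map_zero i).symm)]
    rfl
  · obtain ⟨r, hr⟩ := (hfg _).1 hx
    obtain ⟨q, hq⟩ := (h7 (x - τ r)).1 (by rw [map_sub, hτ', hr, sub_self])
    exact ⟨(q, r), by simp [hq]⟩
  · rintro ⟨⟨q, r⟩, rfl⟩
    simp [hpi, hτ', hgf]

lemma Module.Projective.finitePi {κ : Type} [Finite κ] [Module.Projective Λ X] :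
    Module.Projective Λ (κ → X) := by
  have := Fintype.ofFinite κ
  classical
  exact Module.Projective.of_equiv (DFinsupp.linearEquivFunOnFintype (R := Λ) (M := fun _ : κ => X))

lemma HasShortResolution.pi {κ : Type} [Finite κ] (h : HasShortResolution Λ X) :
    HasShortResolution Λ (κ → X) := by
  obtain ⟨P, Q, _, _, _, _, i, p, h1, h2, h3, h4, h5, h6, h7⟩ := h
  refine ⟨κ → P, κ → Q, _, _, _, _, i.compLeft κ, p.compLeft κ, inferInstance, .finitePi,
    inferInstance, .finitePi, h5.comp_left, h6.comp_left, fun x => ⟨fun hx => ?_, ?_⟩⟩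
  · choose q hq using fun a => (h7 (x a)).1 (congrFun hx a)
    exact ⟨q, funext hq⟩
  · rintro ⟨q, rfl⟩
    exact funext fun a => (h7 _).2 ⟨q a, rfl⟩

lemma HasShortResolution.exists_fin (h : HasShortResolution Λ X) :
    ∃ (n : ℕ) (p : (Fin n → Λ) →ₗ[Λ] X), Function.Surjective p ∧
      Module.Finite Λ (LinearMap.ker p) ∧ Module.Projective Λ (LinearMap.ker p) := by
  obtain ⟨P, Q, _, _, _, _, i, p, h1, h2, h3, h4, h5, h6, h7⟩ := h
  obtain ⟨n, s, hs⟩ := Module.Finite.exists_fin' Λ P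
  obtain ⟨σ, hσ⟩ := Module.projective_lifting_property s LinearMap.id hs
  have hσ' (x) : s (σ x) = x := LinearMap.congr_fun hσ x
  have hpi (x) : p (i x) = 0 := (h7 _).2 ⟨x, rfl⟩
  let π : (Fin n → Λ) →ₗ[Λ] LinearMap.ker s :=
    (LinearMap.id - σ ∘ₗ s).codRestrict _ fun x => by simp [hσ']
  have hπ : π ∘ₗ (LinearMap.ker s).subtype = LinearMap.id := by
    ext x : 2
    have hx : s x.1 = 0 := x.2
    simp [π, hx]
  have hπs : Function.Surjective π := fun x => ⟨x.1, LinearMap.congr_fun hπ x⟩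
  have : Module.Finite Λ (LinearMap.ker s) := Module.Finite.of_surjective π hπs
  have : Module.Projective Λ (LinearMap.ker s) := Module.Projective.of_split _ π hπ
  let Φ : Q × LinearMap.ker s →ₗ[Λ] LinearMap.ker (p ∘ₗ s) :=
    ((σ ∘ₗ i).coprod (LinearMap.ker s).subtype).codRestrict _ fun x => by
      have hx : s x.2.1 = 0 := x.2.2
      simp [hσ', hpi, hx]
  have hΦ : Function.Bijective Φ := by
    constructor
    · rw [← LinearMap.ker_eq_bot, LinearMap.ker_eq_bot']
      rintro ⟨q, r, hr⟩ hqr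
      have hr : s r = 0 := hr
      have hqr : σ (i q) + r = 0 := congrArg Subtype.val hqr
      have h0 : i q = 0 := by simpa [hσ', hr] using congrArg s hqr
      rw [h0, map_zero, zero_add] at hqr
      exact Prod.ext (h5 (h0.trans (map_zero i).symm)) (Subtype.ext hqr)
    · rintro ⟨x, hx⟩
      obtain ⟨q, hq⟩ := (h7 (s x)).1 hx
      refine ⟨(q, ⟨x - σ (s x), by simp [hσ']⟩), Subtype.ext ?_⟩
      change σ (i q) + (x - σ (s x)) = x
      rw [hq, add_sub_cancel]
  exact ⟨n, p ∘ₗ s, h6.comp hs, Module.Finite.of_surjective Φ hΦ.2,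
    Module.Projective.of_equiv (LinearEquiv.ofBijective Φ hΦ)⟩

/-- If `C` has projective dimension at most one, vanishing of `Ext¹(-, Y)` passes to kernels of
epimorphisms onto `C`. -/
lemma Ext1Vanishes.of_exact_of_hasShortResolution (hB : Ext1Vanishes Λ B Y)
    (hC : HasShortResolution Λ C) {f : X →ₗ[Λ] B} {g : B →ₗ[Λ] C} (hf : Function.Injective f)
    (hg : Function.Surjective g) (hfg : Function.Exact f g) : Ext1Vanishes Λ X Y := by
  obtain ⟨P, Q, _, _, _, _, i, p, h1, h2, h3, h4, h5, h6, h7⟩ := hC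
  have hgf (x : X) : g (f x) = 0 := (hfg _).2 ⟨x, rfl⟩
  have hpi (x) : p (i x) = 0 := (h7 _).2 ⟨x, rfl⟩
  obtain ⟨h, hh⟩ := Module.projective_lifting_property g p hg
  have hh' (x) : g (h x) = p x := LinearMap.congr_fun hh x
  obtain ⟨k, hk⟩ := exists_comp_eq_of_range hf (h ∘ₗ i) fun c => (hfg _).1 (by
    rw [LinearMap.comp_apply, hh', hpi])
  let t : (X →₀ Λ) →ₗ[Λ] X := Finsupp.linearCombination Λ id
  have ht : Function.Surjective t := Finsupp.linearCombination_id_surjective Λ X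
  obtain ⟨σ, hσ⟩ := Module.projective_lifting_property t (-k) ht
  have hσ' (c) : f (t (σ c)) = -h (i c) := by
    have e1 : t (σ c) = -k c := LinearMap.congr_fun hσ c
    have e2 : f (k c) = h (i c) := LinearMap.congr_fun hk c
    rw [e1, map_neg, e2]
  let T : (X →₀ Λ) × P →ₗ[Λ] B := (f ∘ₗ t).coprod h
  have hT : Function.Surjective T := by
    intro b
    obtain ⟨y, hy⟩ := h6 (g b)
    obtain ⟨x, hx⟩ := (hfg (b - h y)).1 (by rw [map_sub, hh', hy, sub_self])
    obtain ⟨z, rfl⟩ := ht x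
    exact ⟨(z, y), by simp [T, hx]⟩
  refine Ext1Vanishes.of_exact (X := LinearMap.ker t) (f := (LinearMap.ker t).subtype)
    (ext1Vanishes_of_projective (B := X →₀ Λ)) ht
    (fun x => by simp) fun φ => ?_
  have hmem (x : LinearMap.ker T) : p x.1.2 = 0 := by
    have hx : f (t x.1.1) + h x.1.2 = 0 := x.2
    simpa [hgf, hh'] using congrArg g hx
  let y : LinearMap.ker T →ₗ[Λ] P := LinearMap.snd Λ (X →₀ Λ) P ∘ₗ (LinearMap.ker T).subtype
  obtain ⟨q, hq⟩ := exists_comp_eq_of_range (C := LinearMap.ker T) h5 y fun x => (h7 _).1 (hmem x)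
  have hq' (x) : i (q x) = x.1.2 := LinearMap.congr_fun hq x
  let r : LinearMap.ker T →ₗ[Λ] LinearMap.ker t :=
    (LinearMap.fst Λ (X →₀ Λ) P ∘ₗ (LinearMap.ker T).subtype - σ ∘ₗ q).codRestrict _ fun x => by
      have hx : f (t x.1.1) + h x.1.2 = 0 := x.2
      refine hf ?_
      simp only [LinearMap.sub_apply, LinearMap.comp_apply, LinearMap.fst_apply,
        Submodule.subtype_apply, map_sub, hσ', hq', map_zero]
      rw [sub_neg_eq_add, hx]
  obtain ⟨ψ, hψ⟩ := hB.exists_extend (X := LinearMap.ker T) (f := (LinearMap.ker T).subtype) (g := T)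
    Subtype.val_injective hT (fun x => by simp) (φ ∘ₗ r)
  refine ⟨ψ ∘ₗ LinearMap.inl Λ _ _, LinearMap.ext fun x => ?_⟩
  have hx : t x.1 = 0 := x.2
  let x' : LinearMap.ker T := ⟨(x.1, 0), by simp [T, hx]⟩
  have hqx : q x' = 0 := h5 (by rw [hq', map_zero])
  have e1 : ψ (x.1, 0) = φ (r x') := LinearMap.congr_fun hψ x'
  have e2 : r x' = x := Subtype.ext (by
    change x.1 - σ (q x') = x.1
    rw [hqx, map_zero, sub_zero])
  rw [e2] at e1
  exact e1

end Ext

section Exchange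

/-- For `T` two-sided stable and `c` idempotent, the left submodule `Tc`. -/
def BiStable.corner {K A : Type} [Field K] [Ring A] [Algebra K A] {T : Submodule K A}
    (hT : BiStable T) (c : A) : Submodule A A where
  carrier := {x | x ∈ T ∧ x * c = x}
  add_mem' := fun hx hy => ⟨add_mem hx.1 hy.1, by rw [add_mul, hx.2, hy.2]⟩
  zero_mem' := ⟨zero_mem _, zero_mul _⟩
  smul_mem' := fun a x hx => ⟨hT.left a hx.1, by rw [smul_eq_mul, mul_assoc, hx.2]⟩

/-- Right multiplication by an element, as a map between left ideals. -/
def mulRightMap {A : Type} [Ring A] (P Q : Submodule A A) (z : A) (h : ∀ x ∈ P, x * z ∈ Q) :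
    P →ₗ[A] Q :=
  (LinearMap.toSpanSingleton A A z).restrict h

lemma coe_mulRightMap {A : Type} [Ring A] {P Q : Submodule A A} {z : A} (h : ∀ x ∈ P, x * z ∈ Q)
    (x : P) : (mulRightMap P Q z h x : A) = x * z := rfl

section Corner

variable {K A : Type} [Field K] [Ring A] [Algebra K A] {T T' : Submodule K A}

lemma Ext1Vanishes.corner (hT : BiStable T) (hT' : BiStable T') {c : A} (hc : c * c = c)
    (hle : T' ≤ T) (hTc : ∀ x ∈ T, x * c ∈ T') {Y : Type} [AddCommGroup Y] [Module A Y]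
    (h : Ext1Vanishes A hT'.toIdeal Y) : Ext1Vanishes A (hT.corner c) Y :=
  h.of_retract (mulRightMap _ _ c fun x hx => hTc x hx.1)
    (mulRightMap _ _ c fun x hx => ⟨hT.right _ (hle hx), by rw [mul_assoc, hc]⟩)
    (LinearMap.ext fun x => Subtype.ext (by
      change x.1 * c * c = x.1
      rw [x.2.2, x.2.2]))

lemma projective_corner_top {c : A} (hc : c * c = c) :
    Module.Projective A ((BiStable.top (K := K)).corner c) ∧
      Module.Finite A ((BiStable.top (K := K)).corner c) := by
  let f : A →ₗ[A] (BiStable.top (K := K)).corner c :=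
    (LinearMap.toSpanSingleton A A c).codRestrict _ fun x => ⟨trivial, by
      rw [LinearMap.toSpanSingleton_apply, smul_eq_mul, mul_assoc, hc]⟩
  have hf : f ∘ₗ Submodule.subtype _ = LinearMap.id :=
    LinearMap.ext fun x => Subtype.ext x.2.2
  exact ⟨Module.Projective.of_split _ f hf,
    Module.Finite.of_surjective f fun x => ⟨x.1, LinearMap.congr_fun hf x⟩⟩

lemma projective_toIdeal (hT : BiStable T) (h : T = ⊤) :
    Module.Projective A hT.toIdeal ∧ Module.Finite A hT.toIdeal := by
  have h : hT.toIdeal = ⊤ := by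
    ext x
    rw [hT.mem_toIdeal, h]
    simp
  rw [h]
  exact ⟨Module.Projective.of_equiv Submodule.topEquiv.symm,
    Module.Finite.equiv Submodule.topEquiv.symm⟩

end Corner

namespace PPData

variable {K : Type} [Field K] {ι : Type} [Fintype ι] [LinearOrder ι] {m : ι → ι → ℕ}
  {A : Type} [Ring A] [Algebra K A] (D : PPData K m A)
  {M : CoxeterMatrix ι} {W : Type} [Group W] (cs : CoxeterSystem M W)
  {T T' : Submodule K A}

lemma one_sub_e_mul_self (i : ι) : (1 - D.e i) * (1 - D.e i) = 1 - D.e i := by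
  rw [mul_sub, mul_one, sub_mul, one_mul, D.e_mul_self, sub_self, sub_zero]

/-- The monomorphism `Te_i → ∏ Te_j × T(1 - e_i)` of the exchange sequence. -/
def exchangeMono (hT : BiStable T) (i : ι) : hT.corner (D.e i) →ₗ[A]
    (∀ a : Arr m i, hT.corner (D.e a.1)) × hT.corner (1 - D.e i) :=
  (LinearMap.pi fun a => mulRightMap (hT.corner (D.e i)) (hT.corner (D.e a.1)) (D.out i a)
    fun _ hx => ⟨hT.right _ hx.1, by rw [mul_assoc, D.out_e]⟩).prod 0

/-- The epimorphism `∏ Te_j × T(1 - e_i) → T I_i` of the exchange sequence. -/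
def exchangeEpi (hloop : ∀ i, m i i = 0) (hT : BiStable T) (hT' : BiStable T') {i : ι}
    (h : T' = T * D.I i) :
    (∀ a : Arr m i, hT.corner (D.e a.1)) × hT.corner (1 - D.e i) →ₗ[A] hT'.toIdeal :=
  (∑ a, mulRightMap (hT.corner (D.e a.1)) hT'.toIdeal (ppSign K i a.1 • D.inn i a) (fun x hx => by
      rw [hT'.mem_toIdeal, h]
      exact Submodule.mul_mem_mul hx.1 (Submodule.smul_mem _ _ (D.inn_mem_I hloop i a))) ∘ₗ
    LinearMap.proj a).coprod (mulRightMap _ _ (1 - D.e i) fun x hx => by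
      rw [hT'.mem_toIdeal, h]
      exact D.mul_one_sub_e_mem hx.1)

lemma coe_exchangeEpi (hloop : ∀ i, m i i = 0) (hT : BiStable T) (hT' : BiStable T') {i : ι}
    (h : T' = T * D.I i) (x : (∀ a : Arr m i, hT.corner (D.e a.1)) × hT.corner (1 - D.e i)) :
    (D.exchangeEpi hloop hT hT' h x : A) =
      ∑ a, ppSign K i a.1 • ((x.1 a : A) * D.inn i a) + x.2 := by
  rw [exchangeEpi, LinearMap.coprod_apply, Submodule.coe_add, coe_mulRightMap, x.2.2.2,
    LinearMap.sum_apply, AddSubmonoidClass.coe_finsetSum]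
  congr 1
  refine Finset.sum_congr rfl fun a _ => ?_
  rw [LinearMap.comp_apply, coe_mulRightMap, mul_smul_comm]
  rfl

lemma exchangeMono_injective (hT : BiStable T) {i : ι} (hR : D.NoSocle ⊥ i) :
    Function.Injective (D.exchangeMono hT i) := by
  rw [← LinearMap.ker_eq_bot, LinearMap.ker_eq_bot']
  intro x hx
  refine Subtype.ext ?_
  rw [← x.2.2]
  refine (Submodule.mem_bot K).1 (hR _ fun a => (Submodule.mem_bot K).2 ?_)
  exact congrArg Subtype.val (congrFun (congrArg Prod.fst hx) a)

lemma exchangeEpi_surjective (hloop : ∀ i, m i i = 0) (hT : BiStable T) (hT' : BiStable T')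
    {i : ι} (h : T' = T * D.I i) : Function.Surjective (D.exchangeEpi hloop hT hT' h) := by
  rintro ⟨x, hx⟩
  have hx' := hx
  rw [hT'.mem_toIdeal, h, D.mem_mul_I_iff hloop hT.right] at hx'
  obtain ⟨hxT, t, ht, hxt⟩ := hx'
  refine ⟨(fun a => ⟨ppSign K i a.1 • (t a * D.e a.1), Submodule.smul_mem _ _ (hT.right _ (ht a)),
    by rw [smul_mul_assoc, mul_assoc, D.e_mul_self]⟩, ⟨x * (1 - D.e i), hT.right _ hxT, by
      rw [mul_assoc, D.one_sub_e_mul_self]⟩), Subtype.ext ?_⟩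
  rw [coe_exchangeEpi]
  simp only [smul_mul_assoc, smul_smul, ppSign_mul_self, one_smul, mul_assoc, D.e_inn]
  rw [← hxt, mul_sub, mul_one, add_sub_cancel]

lemma exchange_exact (hloop : ∀ i, m i i = 0) (hT : BiStable T) (hT' : BiStable T') {i : ι}
    (h : T' = T * D.I i) (hS : D.NoSocle T i) :
    Function.Exact (D.exchangeMono hT i) (D.exchangeEpi hloop hT hT' h) := by
  intro x
  constructor
  · intro hx
    have hx := congrArg Subtype.val hx
    rw [coe_exchangeEpi] at hx
    have hx2 : (x.2 : A) * D.e i = 0 := by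
      rw [← x.2.2.2, mul_assoc, sub_mul, one_mul, D.e_mul_self, sub_self, mul_zero]
    have hsum : ∑ a, ppSign K i a.1 • ((x.1 a : A) * D.inn i a) = 0 := by
      have := congrArg (· * D.e i) hx
      simpa [add_mul, Finset.sum_mul, hx2, mul_assoc, D.inn_e] using this
    rw [hsum, zero_add] at hx
    obtain ⟨z, hz⟩ := D.exact_right i (fun a => (x.1 a : A)) hsum
    have hz' (a : Arr m i) : z * D.out i a = x.1 a := by
      rw [← (x.1 a).2.2]
      exact (hz a).symm
    refine ⟨⟨z * D.e i, hS z fun a => by rw [hz']; exact (x.1 a).2.1, by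
      rw [mul_assoc, D.e_mul_self]⟩, Prod.ext (funext fun a => Subtype.ext ?_)
      (Subtype.ext hx.symm)⟩
    change z * D.e i * D.out i a = _
    rw [mul_assoc, D.e_out, hz']
  · rintro ⟨y, rfl⟩
    refine Subtype.ext ?_
    rw [coe_exchangeEpi]
    have : ∀ a : Arr m i, ((D.exchangeMono hT i y).1 a : A) * D.inn i a =
        y.1 * (D.out i a * D.inn i a) := fun a => mul_assoc _ _ _
    have hsum : ∑ a, ppSign K i a.1 • (((D.exchangeMono hT i y).1 a : A) * D.inn i a) =
        y.1 * ∑ a, ppSign K i a.1 • (D.out i a * D.inn i a) := by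
      rw [Finset.mul_sum]
      exact Finset.sum_congr rfl fun a _ => by rw [this, mul_smul_comm]
    rw [hsum, D.rel', mul_zero, zero_add]
    rfl

lemma hasShortResolution_I (hloop : ∀ i, m i i = 0) {i : ι} (hR : D.NoSocle ⊥ i) :
    HasShortResolution A (D.I_biStable i).toIdeal := by
  have hT := BiStable.top (K := K) (A := A)
  have h : D.I i = ⊤ * D.I i := (D.I_biStable i).top_mul.symm
  have h1 := fun a : Arr m i => projective_corner_top (K := K) (D.e_mul_self a.1)
  have h2 := projective_corner_top (K := K) (D.one_sub_e_mul_self i)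
  have h3 := projective_corner_top (K := K) (D.e_mul_self i)
  have := fun a => (h1 a).1
  have := fun a => (h1 a).2
  have := h2.1
  have := h2.2
  have := h3.1
  have := h3.2
  classical
  have : Module.Projective A (∀ a : Arr m i, hT.corner (D.e a.1)) :=
    Module.Projective.of_equiv
      (DFinsupp.linearEquivFunOnFintype (R := A) (M := fun a : Arr m i => hT.corner (D.e a.1)))
  exact HasShortResolution.of_projective.of_projective_kernel (D.exchangeMono_injective hT hR)
    (D.exchangeEpi_surjective hloop hT (D.I_biStable i) h)
    (D.exchange_exact hloop hT (D.I_biStable i) h fun _ _ => trivial)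

lemma exists_sub_algebraMap_mem_I (hloop : ∀ i, m i i = 0) (i : ι) (x : A) :
    ∃ c : K, x - algebraMap K A c ∈ D.I i := by
  obtain ⟨c, hc⟩ := D.exists_scalar x
  refine ⟨c i, ?_⟩
  have h : x - algebraMap K A (c i) =
      (x - ∑ j, c j • D.e j) + ∑ j, (c j - c i) • D.e j := by
    simp only [sub_smul, Finset.sum_sub_distrib, ← Finset.smul_sum, D.sum_e,
      Algebra.algebraMap_eq_smul_one]
    abel
  rw [h]
  refine add_mem (D.L_one_le_I hloop i hc) (sum_mem fun j _ => ?_)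
  by_cases hj : j = i
  · rw [hj, sub_self, zero_smul]
    exact zero_mem _
  · exact Submodule.smul_mem _ _ (D.e_mem_I hj)

end PPData

/-- A basis of `T` modulo a subspace of finite codimension. -/
lemma exists_basis_modulo {K A : Type} [Field K] [AddCommGroup A] [Module K A]
    {T T' : Submodule K A} (hfin : FiniteDimensional K (A ⧸ T')) :
    ∃ (d : ℕ) (t : Fin d → A), (∀ k, t k ∈ T) ∧
      (∀ x ∈ T, ∃ c : Fin d → K, x - ∑ k, c k • t k ∈ T') ∧
      ∀ c : Fin d → K, ∑ k, c k • t k ∈ T' → c = 0 := by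
  let N : Submodule K (A ⧸ T') := T.map T'.mkQ
  let b := Module.finBasis K N
  choose t ht htb using fun k => (b k).2
  have hsum (c : Fin (Module.finrank K N) → K) :
      T'.mkQ (∑ k, c k • t k) = (∑ k, c k • b k : N) := by
    rw [map_sum, AddSubmonoidClass.coe_finsetSum]
    simp only [map_smul, htb, Submodule.coe_smul]
  refine ⟨_, t, ht, fun x hx => ?_, fun c hc => ?_⟩
  · let y : N := ⟨T'.mkQ x, x, hx, rfl⟩
    refine ⟨b.repr y, ?_⟩
    rw [← Submodule.Quotient.mk_eq_zero, ← Submodule.mkQ_apply, map_sub, hsum, b.sum_repr,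
      sub_self]
  · rw [← Submodule.Quotient.mk_eq_zero, ← Submodule.mkQ_apply, hsum] at hc
    exact funext (Fintype.linearIndependent_iff.1 b.linearIndependent c (Subtype.ext hc))

namespace PPData

variable {K : Type} [Field K] {ι : Type} [Fintype ι] [LinearOrder ι] {m : ι → ι → ℕ}
  {A : Type} [Ring A] [Algebra K A] (D : PPData K m A)
  {M : CoxeterMatrix ι} {W : Type} [Group W] (cs : CoxeterSystem M W)
  {T T' : Submodule K A}

lemma hasShortResolution_I_mul (hloop : ∀ i, m i i = 0) {i : ι} (hR : D.NoSocle ⊥ i)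
    (hT : BiStable T) (hT' : BiStable T') (h : T' = D.I i * T)
    (hfin : FiniteDimensional K (A ⧸ T')) (hres : HasShortResolution A hT.toIdeal) :
    HasShortResolution A hT'.toIdeal := by
  obtain ⟨d, t, ht, hspan, hind⟩ := exists_basis_modulo (T := T) hfin
  have hmul {y u : A} (hy : y ∈ D.I i) (hu : u ∈ T) : y * u ∈ T' :=
    h ▸ Submodule.mul_mem_mul hy hu
  have hle : T' ≤ T := h ▸ hT.mul_le_right
  let q : (Fin d → (D.I_biStable i).toIdeal) →ₗ[A] hT'.toIdeal :=
    ∑ k, mulRightMap (D.I_biStable i).toIdeal hT'.toIdeal (t k) (fun x hx => hmul hx (ht k)) ∘ₗ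
      LinearMap.proj k
  have hq (y) : (q y : A) = ∑ k, (y k : A) * t k := by
    simp only [q, LinearMap.sum_apply, AddSubmonoidClass.coe_finsetSum]
    rfl
  let f : (Fin d → (D.I_biStable i).toIdeal) →ₗ[A] hT'.toIdeal × (Fin d → A) :=
    (-q).prod ((Submodule.subtype _).compLeft (Fin d))
  let g : hT'.toIdeal × (Fin d → A) →ₗ[A] hT.toIdeal :=
    (mulRightMap hT'.toIdeal hT.toIdeal 1 fun x hx => by rw [mul_one]; exact hle hx).coprod
      (∑ k, (LinearMap.toSpanSingleton A hT.toIdeal ⟨t k, ht k⟩) ∘ₗ LinearMap.proj k)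
  have hg (x) : (g x : A) = x.1 + ∑ k, x.2 k * t k := by
    simp only [g, LinearMap.coprod_apply, Submodule.coe_add, coe_mulRightMap, mul_one,
      LinearMap.sum_apply, AddSubmonoidClass.coe_finsetSum]
    rfl
  have hmid : HasShortResolution A (hT'.toIdeal × (Fin d → A)) := by
    refine (D.hasShortResolution_I hloop hR).pi (κ := Fin d) |>.of_exact hres (f := f) (g := g)
      (fun y y' hy => funext fun k => Subtype.ext (congrFun (congrArg Prod.snd hy) k)) ?_ ?_
    · rintro ⟨x, hx⟩
      obtain ⟨c, hc⟩ := hspan x hx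
      refine ⟨(⟨_, hc⟩, fun k => algebraMap K A (c k)), Subtype.ext ?_⟩
      rw [hg]
      simp [Algebra.smul_def]
    · intro x
      constructor
      · intro hx
        have hx := congrArg Subtype.val hx
        rw [hg] at hx
        choose c hc using fun k => D.exists_sub_algebraMap_mem_I hloop i (x.2 k)
        have hc0 : c = 0 := hind c (by
          have : ∑ k, c k • t k =
              -(∑ k, (x.2 k - algebraMap K A (c k)) * t k) - x.1.1 := by
            simp only [sub_mul, Finset.sum_sub_distrib, Algebra.smul_def]
            rw [eq_neg_of_add_eq_zero_right hx]
            abel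
          rw [this]
          exact sub_mem (neg_mem (sum_mem fun k _ => hmul (hc k) (ht k))) x.1.2)
        have hxI (k) : x.2 k ∈ D.I i := by simpa [hc0] using hc k
        refine ⟨fun k => ⟨x.2 k, hxI k⟩, Prod.ext (Subtype.ext ?_) rfl⟩
        change -(q _ : A) = _
        rw [hq, eq_neg_of_add_eq_zero_left hx]
      · rintro ⟨y, rfl⟩
        refine Subtype.ext ?_
        rw [hg]
        change -(q y : A) + _ = 0
        rw [hq]
        exact neg_add_cancel _
  exact hmid.of_projective_kernel (f := LinearMap.inr A _ _) (g := LinearMap.fst A _ _)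
    LinearMap.inr_injective LinearMap.fst_surjective Function.Exact.inr_fst

lemma finiteDimensional_quotient_Iw (hsymm : ∀ i j, m i j = m j i) (hloop : ∀ i, m i i = 0)
    (hM : IsCoxeterOf m M) (w : W) : FiniteDimensional K (A ⧸ D.Iw cs w) := by
  have := D.finiteDimensional_slice_Iw cs hsymm hloop hM w
  let f : (A ⧸ D.Iw cs w) →ₗ[K] (∀ j, A ⧸ D.slice (D.Iw cs w) j) :=
    LinearMap.pi fun j => Submodule.mapQ _ _ LinearMap.id fun x hx =>
      (D.Iw_biStable cs w).right _ hx
  refine FiniteDimensional.of_injective f ?_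
  rw [← LinearMap.ker_eq_bot, LinearMap.ker_eq_bot']
  intro x hx
  obtain ⟨x, rfl⟩ := Submodule.mkQ_surjective _ x
  refine (Submodule.Quotient.mk_eq_zero _).2 ?_
  rw [← mul_one x, ← D.sum_e, Finset.mul_sum]
  exact sum_mem fun j _ => (D.mk_slice_eq_zero).1 (congrFun hx j)

/-- Each ideal `I_w` has projective dimension at most one. -/
lemma hasShortResolution_Iw (hsymm : ∀ i j, m i j = m j i) (hloop : ∀ i, m i i = 0)
    (hM : IsCoxeterOf m M) (hR : ∀ i, D.NoSocle ⊥ i) (w : W) :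
    HasShortResolution A (D.Iw_biStable cs w).toIdeal := by
  obtain ⟨n, hn⟩ : ∃ n, cs.length w = n := ⟨_, rfl⟩
  induction n generalizing w with
  | zero =>
    obtain rfl := cs.length_eq_zero_iff.1 hn
    have h := projective_toIdeal (D.Iw_biStable cs 1) (D.Iw_one cs hsymm hloop hM)
    have := h.1
    have := h.2
    exact .of_projective
  | succ n ih =>
    obtain ⟨i, hi⟩ := cs.exists_leftDescent_of_ne_one (w := w) (by rintro rfl; simp at hn)
    rw [cs.isLeftDescent_iff_not_isLeftDescent_mul] at hi
    obtain ⟨w, rfl⟩ : ∃ w', w = cs.simple i * w' :=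
      ⟨cs.simple i * w, (cs.simple_mul_simple_cancel_left i).symm⟩
    rw [cs.simple_mul_simple_cancel_left] at hi
    have hl := cs.not_isLeftDescent_iff.1 hi
    exact D.hasShortResolution_I_mul hloop (hR i) (D.Iw_biStable cs w) _
      (D.Iw_simple_mul cs hsymm hloop hM hi) (D.finiteDimensional_quotient_Iw cs hsymm hloop hM _)
      (ih w (by omega))

lemma ext1Vanishes_exchange {hT : BiStable T} {i : ι} {Y : Type} [AddCommGroup Y] [Module A Y]
    (h1 : ∀ j ≠ i, Ext1Vanishes A (hT.corner (D.e j)) Y)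
    (h2 : Ext1Vanishes A (hT.corner (1 - D.e i)) Y) (hloop : ∀ i, m i i = 0) :
    Ext1Vanishes A ((∀ a : Arr m i, hT.corner (D.e a.1)) × hT.corner (1 - D.e i)) Y :=
  (Ext1Vanishes.pi fun a => h1 a.1 (fst_ne hloop a)).prod h2

lemma exists_eq_mul_of_corner (hloop : ∀ i, m i i = 0) (hD : D.LeftFree) {v : W} {c : A}
    (hc : c * c = c) {Q : Submodule A A} (φ : (D.Iw_biStable cs v).corner c →ₗ[A] Q) :
    ∃ z, ∀ x, (φ x : A) = x.1 * z := by
  obtain ⟨z, hz⟩ := D.exists_eq_mul_of_J hloop hD _ (Q.subtype ∘ₗ φ ∘ₗ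
    mulRightMap (D.Iw_biStable cs v).toIdeal _ c fun x hx =>
      ⟨(D.Iw_biStable cs v).right _ hx, by rw [mul_assoc, hc]⟩)
  refine ⟨z, fun x => ?_⟩
  rw [← hz ⟨x.1, x.2.1⟩]
  exact congrArg (fun y => (φ y : A)) (Subtype.ext x.2.2.symm)

/-- `Ext¹(I_v, I_w) = 0` if `v ≤ w` in the right weak order. -/
lemma ext1Vanishes_Iw (hsymm : ∀ i j, m i j = m j i) (hloop : ∀ i, m i i = 0)
    (hM : IsCoxeterOf m M) (hD : D.LeftFree) (n : ℕ) : ∀ v u : W, cs.length v = n →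
      cs.length (v * u) = cs.length v + cs.length u →
      Ext1Vanishes A (D.Iw_biStable cs v).toIdeal (D.Iw_biStable cs (v * u)).toIdeal := by
  induction n with
  | zero =>
    intro v u hv _
    obtain rfl := cs.length_eq_zero_iff.1 hv
    have := (projective_toIdeal (D.Iw_biStable cs 1) (D.Iw_one cs hsymm hloop hM)).1
    exact ext1Vanishes_of_projective
  | succ n ih =>
    intro v u hv hvu
    obtain ⟨i, hi⟩ := cs.exists_rightDescent_of_ne_one (w := v) (by rintro rfl; simp at hv)
    rw [cs.isRightDescent_iff_not_isRightDescent_mul] at hi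
    obtain ⟨v, rfl⟩ : ∃ v', v = v' * cs.simple i :=
      ⟨v * cs.simple i, (cs.simple_mul_simple_cancel_right i).symm⟩
    rw [cs.simple_mul_simple_cancel_right] at hi
    have hl := cs.not_isRightDescent_iff.1 hi
    have hle := cs.length_mul_le v (cs.simple i * u)
    have hle' := cs.length_mul_le (cs.simple i) u
    rw [cs.length_simple] at hle'
    rw [← mul_assoc] at hle
    have hu : ¬cs.IsLeftDescent u i := by
      rw [cs.not_isLeftDescent_iff]
      omega
    have hl' := cs.not_isLeftDescent_iff.1 hu
    have hadd : cs.length (v * (cs.simple i * u)) =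
        cs.length v + cs.length (cs.simple i * u) := by
      rw [← mul_assoc]
      omega
    have hT := D.Iw_biStable cs v
    have h := D.Iw_mul_simple cs hsymm hloop hM hi
    have hY := D.Iw_mul cs hsymm hloop hM hvu
    have ih := ih v (cs.simple i * u) (by omega) hadd
    rw [← mul_assoc] at ih hadd
    refine Ext1Vanishes.of_exact (D.ext1Vanishes_exchange (hT := hT) (i := i)
      (fun j _ => ih.corner hT hT (D.e_mul_self j) le_rfl fun x hx => hT.right _ hx)
      (ih.corner hT hT (D.one_sub_e_mul_self i) le_rfl fun x hx => hT.right _ hx) hloop)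
      (D.exchangeEpi_surjective hloop hT _ h)
      (D.exchange_exact hloop hT _ h (D.noSocle_Iw cs hsymm hloop hM hi)) fun φ => ?_
    obtain ⟨z, hz⟩ := D.exists_eq_mul_of_corner cs hloop hD (D.e_mul_self i) φ
    have hmem : D.e i * z ∈ D.Iw cs (cs.simple i * u) := by
      refine D.mem_Iw_of_Iw_mul cs hsymm hloop hM _ v _ rfl (by rwa [← mul_assoc]) _ fun y hy => ?_
      rw [← mul_assoc, ← mul_assoc]
      have := (φ ⟨y * D.e i, hT.right _ hy, by rw [mul_assoc, D.e_mul_self]⟩).2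
      rwa [hz] at this
    rw [D.Iw_simple_mul cs hsymm hloop hM hu, D.mem_I_mul_iff hloop (D.Iw_biStable cs u)] at hmem
    obtain ⟨-, r, hr, hzr⟩ := hmem
    rw [← mul_assoc, D.e_mul_self] at hzr
    have hmap (a : Arr m i) (x : A) (hx : x ∈ hT.corner (D.e a.1)) :
        x * r a ∈ (D.Iw_biStable cs (v * cs.simple i * u)).toIdeal := by
      rw [BiStable.mem_toIdeal, hY, h]
      refine Submodule.mul_mem_mul ?_ (hr a)
      rw [← hx.2]
      exact D.mem_mul_I_of_e_ne (fst_ne hloop a) (hT.right _ hx.1)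
    refine ⟨(∑ a, mulRightMap _ _ (r a) (hmap a) ∘ₗ LinearMap.proj a) ∘ₗ LinearMap.fst A _ _,
      LinearMap.ext fun x => Subtype.ext ?_⟩
    have hxz : (x : A) * z = ∑ a, x.1 * D.out i a * r a := by
      conv_lhs => rw [← x.2.2, mul_assoc, hzr, Finset.mul_sum]
      simp only [mul_assoc]
    rw [hz, hxz]
    simp only [LinearMap.comp_apply, LinearMap.sum_apply, AddSubmonoidClass.coe_finsetSum,
      coe_mulRightMap]
    rfl

/-- If `Ext¹(I_v, I_w) = 0`, then `v ≤ w` in the right weak order. -/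
lemma length_add_eq_of_ext1Vanishes (hsymm : ∀ i j, m i j = m j i) (hloop : ∀ i, m i i = 0)
    (hM : IsCoxeterOf m M) (hR : ∀ i, D.NoSocle ⊥ i) (hD : D.LeftFree) (n : ℕ) :
    ∀ v w : W, cs.length v = n →
      Ext1Vanishes A (D.Iw_biStable cs v).toIdeal (D.Iw_biStable cs w).toIdeal →
      cs.length v + cs.length (v⁻¹ * w) = cs.length w := by
  induction n with
  | zero =>
    intro v w hv _
    obtain rfl := cs.length_eq_zero_iff.1 hv
    simp
  | succ n ih =>
    intro v w hv hext
    obtain ⟨i, hi⟩ := cs.exists_rightDescent_of_ne_one (w := v) (by rintro rfl; simp at hv)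
    rw [cs.isRightDescent_iff_not_isRightDescent_mul] at hi
    obtain ⟨v, rfl⟩ : ∃ v', v = v' * cs.simple i :=
      ⟨v * cs.simple i, (cs.simple_mul_simple_cancel_right i).symm⟩
    rw [cs.simple_mul_simple_cancel_right] at hi
    have hl := cs.not_isRightDescent_iff.1 hi
    have hT := D.Iw_biStable cs v
    have hT' := D.Iw_biStable cs (v * cs.simple i)
    have h := D.Iw_mul_simple cs hsymm hloop hM hi
    have hle : D.Iw cs (v * cs.simple i) ≤ D.Iw cs v := h ▸ hT.mul_le_left
    have hc : Ext1Vanishes A (hT.corner (1 - D.e i)) (D.Iw_biStable cs w).toIdeal :=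
      hext.corner hT hT' (D.one_sub_e_mul_self i) hle fun x hx => h ▸ D.mul_one_sub_e_mem hx
    have hci : Ext1Vanishes A (hT.corner (D.e i)) (D.Iw_biStable cs w).toIdeal :=
      Ext1Vanishes.of_exact_of_hasShortResolution (D.ext1Vanishes_exchange (hT := hT) (i := i)
        (fun j hj => hext.corner hT hT' (D.e_mul_self j) hle fun x hx =>
          h ▸ D.mem_mul_I_of_e_ne hj (hT.right _ hx)) hc hloop)
        (D.hasShortResolution_Iw cs hsymm hloop hM hR (v * cs.simple i))
        (D.exchangeMono_injective hT (hR i)) (D.exchangeEpi_surjective hloop hT hT' h)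
        (D.exchange_exact hloop hT hT' h (D.noSocle_Iw cs hsymm hloop hM hi))
    have hTY : Ext1Vanishes A hT.toIdeal (D.Iw_biStable cs w).toIdeal :=
      (hci.prod hc).of_retract
        ((mulRightMap hT.toIdeal (hT.corner (D.e i)) (D.e i) fun x hx => ⟨hT.right _ hx, by
            rw [mul_assoc, D.e_mul_self]⟩).prod
          (mulRightMap hT.toIdeal (hT.corner (1 - D.e i)) (1 - D.e i) fun x hx => ⟨hT.right _ hx, by
            rw [mul_assoc, D.one_sub_e_mul_self]⟩))
        ((mulRightMap (hT.corner (D.e i)) hT.toIdeal 1 fun x hx => by rw [mul_one]; exact hx.1).coprod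
          (mulRightMap (hT.corner (1 - D.e i)) hT.toIdeal 1 fun x hx => by rw [mul_one]; exact hx.1))
        (LinearMap.ext fun x => Subtype.ext (by
          change x.1 * D.e i * 1 + x.1 * (1 - D.e i) * 1 = x.1
          rw [mul_one, mul_one, mul_sub, mul_one, add_sub_cancel]))
    have ih := ih v w (by omega) hTY
    obtain ⟨u, rfl⟩ : ∃ u, w = v * u := ⟨v⁻¹ * w, (mul_inv_cancel_left v w).symm⟩
    rw [inv_mul_cancel_left] at ih
    have hU := D.Iw_biStable cs u
    have hY := D.Iw_mul cs hsymm hloop hM ih.symm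
    have hdesc : cs.IsLeftDescent u i := by
      by_contra hu
      refine D.I_mul_Iw_ne cs hsymm hloop hM hu (le_antisymm hU.mul_le_right fun x hx => ?_)
      rw [D.mem_I_mul_iff hloop hU]
      refine ⟨hx, ?_⟩
      obtain ⟨ψ, hψ⟩ := hext.exists_extend (D.exchangeMono_injective hT (hR i))
        (D.exchangeEpi_surjective hloop hT hT' h)
        (D.exchange_exact hloop hT hT' h (D.noSocle_Iw cs hsymm hloop hM hi))
        (mulRightMap (hT.corner (D.e i)) (D.Iw_biStable cs (v * u)).toIdeal x fun y hy => by
          rw [BiStable.mem_toIdeal, hY]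
          exact Submodule.mul_mem_mul hy.1 hx)
      choose z hz using fun a : Arr m i => D.exists_eq_mul_of_corner cs hloop hD
        (D.e_mul_self a.1) (ψ ∘ₗ LinearMap.inl A _ _ ∘ₗ
          LinearMap.single A (fun a : Arr m i => hT.corner (D.e a.1)) a)
      have hψx (t) : (ψ (t, 0) : A) = ∑ a, (t a : A) * z a := by
        have ht : (t, 0) = ∑ a, LinearMap.inl A _ (hT.corner (1 - D.e i))
            (LinearMap.single A (fun a : Arr m i => hT.corner (D.e a.1)) a (t a)) := by
          rw [← map_sum]
          simp [Finset.univ_sum_single]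
        rw [ht, map_sum, AddSubmonoidClass.coe_finsetSum]
        exact Finset.sum_congr rfl fun a _ => hz a (t a)
      refine ⟨fun a => D.e a.1 * z a, fun a => ?_, ?_⟩
      · refine D.mem_Iw_of_Iw_mul cs hsymm hloop hM _ v u rfl ih.symm _ fun y hy => ?_
        rw [← mul_assoc]
        have := hz a ⟨y * D.e a.1, hT.right _ hy, by rw [mul_assoc, D.e_mul_self]⟩
        rw [← this]
        exact Subtype.property _
      · refine sub_eq_zero.1 (D.eq_zero_of_J_mul hloop hD _ fun y (hy : y ∈ D.Iw cs v) => ?_)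
        have h1 := congrArg Subtype.val (LinearMap.congr_fun hψ
          ⟨y * D.e i, hT.right _ hy, by rw [mul_assoc, D.e_mul_self]⟩)
        have h2 : (ψ (D.exchangeMono hT i ⟨y * D.e i, hT.right _ hy, by
            rw [mul_assoc, D.e_mul_self]⟩) : A) = _ := hψx _
        rw [LinearMap.comp_apply, h2, coe_mulRightMap] at h1
        rw [mul_sub, ← mul_assoc, ← h1, Finset.mul_sum, sub_eq_zero]
        refine Finset.sum_congr rfl fun a _ => ?_
        change y * D.e i * D.out i a * z a = _
        rw [mul_assoc y, D.e_out, ← mul_assoc (D.out i a), D.out_e, mul_assoc]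
    have h3 := cs.isLeftDescent_iff.1 hdesc
    rw [mul_inv_rev, cs.inv_simple, mul_assoc, inv_mul_cancel_left]
    omega

end PPData

end Exchange

section Coresolution

open MulOpposite

variable {A : Type} [Ring A] {T : Ideal A} {To : Ideal Aᵐᵒᵖ} {n n' n'' : ℕ}

/-- The map from a free right module to a two-sided ideal (viewed as a right ideal) that has
prescribed values on the standard basis. -/
def fromBasis (hT : ∀ x, op x ∈ To ↔ x ∈ T) (x : Fin n → T) : (Fin n → Aᵐᵒᵖ) →ₗ[Aᵐᵒᵖ] To :=
  ∑ k, LinearMap.toSpanSingleton Aᵐᵒᵖ To ⟨op (x k : A), (hT _).2 (x k).2⟩ ∘ₗ LinearMap.proj k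

lemma coe_fromBasis (hT : ∀ x, op x ∈ To ↔ x ∈ T) (x : Fin n → T) (y : Fin n → Aᵐᵒᵖ) :
    (fromBasis hT x y : Aᵐᵒᵖ) = op (∑ k, x k * unop (y k)) := by
  simp [fromBasis, LinearMap.sum_apply, AddSubmonoidClass.coe_finsetSum, Finset.op_sum]

lemma fromBasis_single (hT : ∀ x, op x ∈ To ↔ x ∈ T) (x : Fin n → T) (k : Fin n) :
    unop (fromBasis hT x (Pi.single k 1) : Aᵐᵒᵖ) = x k := by
  rw [coe_fromBasis, unop_op, Finset.sum_eq_single k] <;> simp +contextual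

lemma fromBasis_injective (hT : ∀ x, op x ∈ To ↔ x ∈ T) :
    Function.Injective (fromBasis hT (n := n)) := fun x y h => funext fun k => Subtype.ext (by
  rw [← fromBasis_single hT, h, fromBasis_single])

lemma fromBasis_surjective (hT : ∀ x, op x ∈ To ↔ x ∈ T) :
    Function.Surjective (fromBasis hT (n := n)) := by
  intro f
  refine ⟨fun k => ⟨unop (f (Pi.single k 1) : Aᵐᵒᵖ), (hT _).1 (f (Pi.single k 1)).2⟩, ?_⟩
  refine (Pi.basisFun Aᵐᵒᵖ (Fin n)).ext fun k => Subtype.ext (unop_injective ?_)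
  rw [Pi.basisFun_apply, fromBasis_single]

/-- The map induced on tuples by precomposition with a map of free modules. -/
def precompTuple (hT : ∀ x, op x ∈ To ↔ x ∈ T) (h : (Fin n' → Aᵐᵒᵖ) →ₗ[Aᵐᵒᵖ] (Fin n → Aᵐᵒᵖ)) :
    (Fin n → T) →ₗ[A] (Fin n' → T) where
  toFun x l := ⟨unop (fromBasis hT x (h (Pi.single l 1)) : Aᵐᵒᵖ), (hT _).1 (Subtype.property _)⟩
  map_add' x y := funext fun l => Subtype.ext (by
    simp [coe_fromBasis, add_mul, Finset.sum_add_distrib])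
  map_smul' a x := funext fun l => Subtype.ext (by
    simp [coe_fromBasis, mul_assoc, Finset.mul_sum])

lemma fromBasis_precompTuple (hT : ∀ x, op x ∈ To ↔ x ∈ T)
    (h : (Fin n' → Aᵐᵒᵖ) →ₗ[Aᵐᵒᵖ] (Fin n → Aᵐᵒᵖ)) (x : Fin n → T) :
    fromBasis hT (precompTuple hT h x) = fromBasis hT x ∘ₗ h := by
  refine (Pi.basisFun Aᵐᵒᵖ (Fin n')).ext fun k => Subtype.ext (unop_injective ?_)
  rw [Pi.basisFun_apply, fromBasis_single]
  rfl

/-- A coresolution of the ring by summands of copies of a two-sided ideal, obtained from a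
resolution of the ideal as a right module. -/
lemma exists_coresolution (hT : ∀ x, op x ∈ To ↔ x ∈ T) (hres : HasShortResolution Aᵐᵒᵖ To)
    (hext : Ext1Vanishes Aᵐᵒᵖ To To) (hfree : ∀ z : Aᵐᵒᵖ, (∀ t ∈ To, t * z = 0) → z = 0)
    (hhom : ∀ g : To →ₗ[Aᵐᵒᵖ] To, ∃ z, ∀ t, (g t : Aᵐᵒᵖ) = t * z) :
    ∃ (n n' : ℕ) (V : Submodule A (Fin n → T)) (V' : Submodule A (Fin n' → T))
      (_ : ∃ W, IsCompl V W) (_ : ∃ W', IsCompl V' W')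
      (u : A →ₗ[A] V) (v : V →ₗ[A] V'),
      Function.Injective u ∧ Function.Surjective v ∧ Function.Exact u v := by
  obtain ⟨n, p, hp, _, _⟩ := hres.exists_fin
  obtain ⟨n', q, hq⟩ := Module.Finite.exists_fin' Aᵐᵒᵖ (LinearMap.ker p)
  obtain ⟨σ, hσ⟩ := Module.projective_lifting_property q LinearMap.id hq
  have hσ' (x) : q (σ x) = x := LinearMap.congr_fun hσ x
  let N := LinearMap.ker p
  obtain ⟨t, ht⟩ := fromBasis_surjective hT p
  let E := precompTuple hT (σ ∘ₗ q)
  have hE : IsIdempotentElem E := LinearMap.ext fun x => fromBasis_injective hT (by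
    change fromBasis hT (E (E x)) = _
    rw [fromBasis_precompTuple, fromBasis_precompTuple]
    exact LinearMap.ext fun y => by simp [hσ'])
  let v := precompTuple hT (N.subtype ∘ₗ q)
  have hv (x) : E (v x) = v x := fromBasis_injective hT (by
    rw [fromBasis_precompTuple, fromBasis_precompTuple]
    exact LinearMap.ext fun y => by simp [hσ'])
  let u : A →ₗ[A] (Fin n → T) := LinearMap.pi fun k => LinearMap.toSpanSingleton A T (t k)
  have hu (a : A) (y) : (fromBasis hT (u a) y : Aᵐᵒᵖ) = p y * op a := by
    rw [← ht, coe_fromBasis, coe_fromBasis, ← op_mul, Finset.mul_sum]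
    simp [u, mul_assoc]
  refine ⟨n, n', ⊤, LinearMap.range E, ⟨⊥, isCompl_top_bot⟩, ⟨_, LinearMap.IsIdempotentElem.isCompl hE⟩,
    Submodule.topEquiv.symm.toLinearMap ∘ₗ u,
    (v.codRestrict _ fun x => ⟨v x, hv x⟩) ∘ₗ Submodule.subtype _, ?_, ?_, ?_⟩
  · refine Submodule.topEquiv.symm.injective.comp ?_
    rw [← LinearMap.ker_eq_bot, LinearMap.ker_eq_bot']
    intro a ha
    refine op_injective (hfree _ fun s hs => ?_)
    obtain ⟨y, hy⟩ := hp ⟨s, hs⟩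
    have := hu a y
    rw [hy, ha, coe_fromBasis] at this
    simpa using this.symm
  · rintro ⟨_, x, rfl⟩
    obtain ⟨ψ, hψ⟩ := hext.exists_extend N.injective_subtype hp
      (LinearMap.exact_subtype_ker_map p) (fromBasis hT x ∘ₗ σ)
    obtain ⟨y, rfl⟩ := fromBasis_surjective hT ψ
    refine ⟨⟨y, trivial⟩, Subtype.ext (fromBasis_injective hT ?_)⟩
    change fromBasis hT (v y) = fromBasis hT (E x)
    rw [fromBasis_precompTuple, fromBasis_precompTuple, ← LinearMap.comp_assoc, hψ]
    rfl
  · rintro ⟨y, -⟩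
    have hzero : v y = 0 ↔ ∀ x, p x = 0 → fromBasis hT y x = 0 := by
      constructor
      · intro h x hx
        have h1 := fromBasis_precompTuple hT (N.subtype ∘ₗ q) y
        obtain ⟨x', hx'⟩ := hq ⟨x, hx⟩
        have h2 := LinearMap.congr_fun h1 x'
        change fromBasis hT (v y) x' = fromBasis hT y (q x') at h2
        rw [h, hx'] at h2
        rw [← h2]
        exact Subtype.ext (by rw [coe_fromBasis]; simp)
      · intro h
        refine fromBasis_injective hT ?_
        rw [fromBasis_precompTuple]
        refine LinearMap.ext fun x => ?_
        rw [LinearMap.comp_apply, LinearMap.comp_apply,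
          h (N.subtype (q x)) (q x).2]
        exact Subtype.ext (by rw [coe_fromBasis]; simp)
    have hzero' : ((v.codRestrict (LinearMap.range E) fun x => ⟨v x, hv x⟩) ∘ₗ
        Submodule.subtype _) (⟨y, trivial⟩ : (⊤ : Submodule A (Fin n → T))) = 0 ↔ v y = 0 :=
      Subtype.ext_iff
    rw [hzero', hzero]
    constructor
    · intro h
      obtain ⟨g, hg⟩ : ∃ g : To →ₗ[Aᵐᵒᵖ] To, g ∘ₗ p = fromBasis hT y := by
        refine ⟨(N.liftQ (fromBasis hT y) fun x hx => h x hx) ∘ₗ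
          (p.quotKerEquivOfSurjective hp).symm.toLinearMap, LinearMap.ext fun x => ?_⟩
        have : (p.quotKerEquivOfSurjective hp).symm (p x) = N.mkQ x := by
          rw [LinearEquiv.symm_apply_eq]
          rfl
        simp only [LinearMap.comp_apply, LinearEquiv.coe_coe, this]
        rfl
      obtain ⟨z, hz⟩ := hhom g
      refine ⟨unop z, Subtype.ext (fromBasis_injective hT (LinearMap.ext fun x =>
        Subtype.ext ?_))⟩
      change (fromBasis hT (u (unop z)) x : Aᵐᵒᵖ) = fromBasis hT y x
      rw [hu, ← hg, op_unop]
      exact (hz _).symm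
    · rintro ⟨a, ha⟩ x hx
      have ha : u a = y := congrArg Subtype.val ha
      refine Subtype.ext ?_
      rw [← ha, hu, hx]
      simp

end Coresolution

namespace PPData

variable {K : Type} [Field K] {ι : Type} [Fintype ι] [LinearOrder ι] {m : ι → ι → ℕ}
  {A : Type} [Ring A] [Algebra K A] (D : PPData K m A)
  {M : CoxeterMatrix ι} {W : Type} [Group W] (cs : CoxeterSystem M W)

/-- The ideals `I_w` are tilting modules. -/
lemma isTiltingModule_Iw [Infinite W] (hsymm : ∀ i j, m i j = m j i) (hloop : ∀ i, m i i = 0)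
    (hM : IsCoxeterOf m M) (hconn : (SimpleGraph.fromRel (fun i j => m i j ≠ 0)).Connected)
    (w : W) : IsTiltingModule A (D.Iw_biStable cs w).toIdeal := by
  have hext {B : Type} [Ring B] [Algebra K B] (D : PPData K m B) (w : W) :
      Ext1Vanishes B (D.Iw_biStable cs w).toIdeal (D.Iw_biStable cs w).toIdeal := by
    have := D.ext1Vanishes_Iw cs hsymm hloop hM (D.leftFree cs hsymm hloop hM hconn) _ w 1 rfl
      (by simp)
    rwa [mul_one] at this
  have hD := D.op.leftFree cs hsymm hloop hM hconn
  refine ⟨(D.hasShortResolution_Iw cs hsymm hloop hM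
    (D.noSocle_bot cs hsymm hloop hM hconn) w).exists_fin, hext D w, ?_⟩
  refine exists_coresolution (To := (D.op.Iw_biStable cs w⁻¹).toIdeal)
    (fun x => ?_) (D.op.hasShortResolution_Iw cs hsymm hloop hM
    (D.op.noSocle_bot cs hsymm hloop hM hconn) w⁻¹) (hext D.op w⁻¹)
    (fun z hz => D.op.eq_zero_of_J_mul hloop hD _ hz)
    (fun g => D.op.exists_eq_mul_of_J hloop hD _ (Submodule.subtype _ ∘ₗ g))
  rw [BiStable.mem_toIdeal, BiStable.mem_toIdeal]
  exact D.op_mem_Iw cs hsymm hloop hM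

end PPData

section PathAlgebraLemmas

variable {K : Type} [Field K] {ι : Type} [Fintype ι] [LinearOrder ι] {m : ι → ι → ℕ}

namespace Pth

/-- The sum of `H q r` over all decompositions of a path as a concatenation of `q` and `r`. -/
def conv : ∀ {i k : ι} (_ : Pth m i k) (_ : ∀ j, Pth m i j → Pth m j k → K), K
  | _, _, .nil i, H => H i (.nil i) (.nil i)
  | _, _, .cons a p, H => H _ (.nil _) (.cons a p) + p.conv fun j q r => H j (.cons a q) r

lemma conv_congr {i k : ι} (p : Pth m i k) {H H' : ∀ j, Pth m i j → Pth m j k → K}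
    (h : ∀ j q r, q.len + r.len = p.len → H j q r = H' j q r) : p.conv H = p.conv H' := by
  induction p with
  | nil i => exact h _ _ _ rfl
  | cons a p ih =>
    simp only [conv]
    rw [h _ _ _ (by simp [len]), ih fun j q r hqr => h _ _ _ (by simp only [len]; omega)]

lemma conv_sum {κ : Type} (s : Finset κ) {i k : ι} (p : Pth m i k)
    (H : κ → ∀ j, Pth m i j → Pth m j k → K) :
    p.conv (fun j q r => ∑ x ∈ s, H x j q r) = ∑ x ∈ s, p.conv (H x) := by
  induction p with
  | nil i => rfl
  | cons a p ih => simp only [conv, Finset.sum_add_distrib, ih]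

lemma go_eq_conv (g : ∀ i j : ι, Pth m i j → K) {i k : ι} (F : ∀ j, Pth m i j → K)
    (p : Pth m i k) : go g i F k p = p.conv fun j q r => F j q * g j k r := by
  induction p with
  | nil i => rfl
  | cons a p ih => simp only [go, conv, ih]

/-- Appending an arrow at the end of a path. -/
def snoc : ∀ {i j k : ι} (_ : Pth m i j) (_ : Fin (m j k)), Pth m i k
  | _, _, _, .nil _, b => .cons b (.nil _)
  | _, _, _, .cons a p, b => .cons a (p.snoc b)

lemma len_snoc {i j k : ι} (p : Pth m i j) (b : Fin (m j k)) : (p.snoc b).len = p.len + 1 := by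
  induction p with
  | nil i => rfl
  | cons a p ih => simp only [snoc, len, ih]

lemma conv_snoc {i j k : ι} (p : Pth m i j) (b : Fin (m j k))
    (H : ∀ l, Pth m i l → Pth m l k → K) :
    (p.snoc b).conv H =
      H k (p.snoc b) (.nil k) + p.conv fun l q r => H l q (r.snoc b) := by
  induction p with
  | nil i => simp only [snoc, conv, add_comm]
  | cons a p ih => simp only [snoc, conv, ih, add_left_comm]

/-- The reverse of a path in the double quiver. -/
def rev (hsymm : ∀ i j, m i j = m j i) : ∀ {i j : ι} (_ : Pth m i j), Pth m j i
  | _, _, .nil i => .nil i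
  | _, _, .cons a p => (p.rev hsymm).snoc (a.cast (hsymm _ _))

variable (hsymm : ∀ i j, m i j = m j i)

lemma len_rev {i j : ι} (p : Pth m i j) : (p.rev hsymm).len = p.len := by
  induction p with
  | nil i => rfl
  | cons a p ih => rw [rev, len_snoc, ih, len]

lemma rev_snoc {i j k : ι} (p : Pth m i j) (b : Fin (m j k)) :
    (p.snoc b).rev hsymm = .cons (b.cast (hsymm _ _)) (p.rev hsymm) := by
  induction p with
  | nil i => rfl
  | cons a p ih => rw [snoc, rev, ih, rev, snoc]

lemma rev_rev {i j : ι} (p : Pth m i j) : (p.rev hsymm).rev hsymm = p := by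
  induction p with
  | nil i => rfl
  | cons a p ih =>
    rw [rev, rev_snoc, ih]
    rfl

lemma conv_rev {i k : ι} (p : Pth m i k) (H : ∀ l, Pth m k l → Pth m l i → K) :
    (p.rev hsymm).conv H = p.conv fun l q r => H l (r.rev hsymm) (q.rev hsymm) := by
  induction p with
  | nil i => rfl
  | cons a p ih =>
    rw [rev, conv_snoc, ih, conv]
    rfl

end Pth

namespace PreE

instance : SMul K (PreE K m) := ⟨fun c f => ⟨fun i j p => c * f.coeff i j p⟩⟩

instance : Module K (PreE K m) where
  one_smul f := by ext i j p; exact one_mul _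
  mul_smul c d f := by ext i j p; exact mul_assoc _ _ _
  smul_zero c := by ext i j p; exact mul_zero _
  smul_add c f g := by ext i j p; exact mul_add _ _ _
  add_smul c d f := by ext i j p; exact add_mul _ _ _
  zero_smul f := by ext i j p; exact zero_mul _

/-- The coefficient at a path, as a linear map. -/
def coeffHom {i j : ι} (p : Pth m i j) : PreE K m →ₗ[K] K where
  toFun f := f.coeff i j p
  map_add' _ _ := rfl
  map_smul' _ _ := rfl

lemma coeff_add (f g : PreE K m) {i j : ι} (p : Pth m i j) :
    (f + g).coeff i j p = f.coeff i j p + g.coeff i j p := rfl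

lemma coeff_zero {i j : ι} (p : Pth m i j) : (0 : PreE K m).coeff i j p = 0 := rfl

lemma coeff_sub (f g : PreE K m) {i j : ι} (p : Pth m i j) :
    (f - g).coeff i j p = f.coeff i j p - g.coeff i j p := map_sub (coeffHom p) f g

lemma coeff_smul (c : K) (f : PreE K m) {i j : ι} (p : Pth m i j) :
    (c • f).coeff i j p = c * f.coeff i j p := rfl

lemma coeff_sum {κ : Type} (s : Finset κ) (f : κ → PreE K m) {i j : ι} (p : Pth m i j) :
    (∑ x ∈ s, f x).coeff i j p = ∑ x ∈ s, (f x).coeff i j p := map_sum (coeffHom p) f s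

lemma coeff_mul (f g : PreE K m) {i k : ι} (p : Pth m i k) :
    (f * g).coeff i k p = go g.coeff i (f.coeff i) k p := rfl

lemma coeff_mul_eq_conv (f g : PreE K m) {i k : ι} (p : Pth m i k) :
    (f * g).coeff i k p = p.conv fun j q r => f.coeff i j q * g.coeff j k r :=
  Pth.go_eq_conv _ _ _

lemma coeff_mul_nil (f g : PreE K m) (i : ι) :
    (f * g).coeff i i (.nil i) = f.coeff i i (.nil i) * g.coeff i i (.nil i) := rfl

instance : Algebra K (PreE K m) := Algebra.ofModule
  (fun c f g => by ext i j p; exact go_mulF _ _ _ p)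
  (fun c f g => by
    ext i j p
    rw [coeff_smul, coeff_mul_eq_conv, coeff_mul_eq_conv]
    have hc : ∀ {i k : ι} (p : Pth m i k) (H : ∀ l, Pth m i l → Pth m l k → K),
        (p.conv fun l q r => c * H l q r) = c * p.conv H := by
      intro i k p H
      induction p with
      | nil i => rfl
      | cons a p ih => simp only [Pth.conv, ih, mul_add]
    rw [← hc]
    exact p.conv_congr fun l q r _ => mul_left_comm _ _ _)

/-- The trivial path at a vertex. -/
def vtx (K : Type) [Field K] (m : ι → ι → ℕ) (i : ι) : PreE K m :=
  ⟨fun _ _ p => match p with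
    | .nil v => if v = i then (1 : K) else 0
    | .cons _ _ => 0⟩

/-- The `k`-th arrow from `i` to `j`, interpreted as zero if there is no such arrow. -/
def arrow (K : Type) [Field K] (m : ι → ι → ℕ) (i j : ι) (k : ℕ) : PreE K m :=
  ⟨fun s _ p => match p with
    | .nil _ => 0
    | .cons (j := l) a q => if s = i ∧ l = j ∧ (a : ℕ) = k then
        (match q with | .nil _ => (1 : K) | .cons _ _ => 0) else 0⟩

/-- The left derivative with respect to an arrow. -/
def lderiv {i j : ι} (a : Fin (m i j)) (f : PreE K m) : PreE K m :=
  ⟨fun s t q => if h : s = j then f.coeff i t (.cons a (h ▸ q)) else 0⟩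

lemma coeff_lderiv {i j k : ι} (a : Fin (m i j)) (f : PreE K m) (q : Pth m j k) :
    (lderiv a f).coeff j k q = f.coeff i k (.cons a q) := by
  simp [lderiv]

lemma coeff_vtx_mul (i : ι) (f : PreE K m) {s t : ι} (p : Pth m s t) :
    (vtx K m i * f).coeff s t p = if s = i then f.coeff s t p else 0 := by
  cases p with
  | nil s => simp [coeff_mul, go, vtx]
  | cons a p =>
    simp only [coeff_mul, go, vtx, go_zeroF]
    simp

lemma coeff_mul_vtx (i : ι) (f : PreE K m) {s t : ι} (p : Pth m s t) :
    (f * vtx K m i).coeff s t p = if t = i then f.coeff s t p else 0 := by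
  rw [coeff_mul]
  generalize f.coeff s = F
  induction p with
  | nil s => simp [go, vtx]
  | cons a p ih =>
    rw [go, ih]
    simp [vtx]

lemma coeff_arrow_mul_nil (i j : ι) (k : ℕ) (f : PreE K m) (s : ι) :
    (arrow K m i j k * f).coeff s s (.nil s) = 0 := by
  rw [coeff_mul_nil]
  exact zero_mul _

lemma coeff_arrow_mul_cons (i j : ι) (k : ℕ) (f : PreE K m) {s l t : ι} (a : Fin (m s l))
    (q : Pth m l t) : (arrow K m i j k * f).coeff s t (.cons a q) =
      if s = i ∧ l = j ∧ (a : ℕ) = k then f.coeff l t q else 0 := by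
  simp only [coeff_mul, go, arrow, zero_mul, zero_add]
  split_ifs with h
  · exact go_oneF _ q
  · exact go_zeroF _ q

lemma coeff_sum_arrow_mul_nil (g : ∀ i, Arr m i → PreE K m) (s : ι) :
    (∑ i, ∑ b, arrow K m i b.1 b.2 * g i b).coeff s s (.nil s) = 0 := by
  simp only [coeff_sum, coeff_arrow_mul_nil, Finset.sum_const_zero]

lemma coeff_sum_arrow_mul_cons (g : ∀ i, Arr m i → PreE K m) {s l t : ι} (a : Fin (m s l))
    (q : Pth m l t) : (∑ i, ∑ b, arrow K m i b.1 b.2 * g i b).coeff s t (.cons a q) =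
      (g s ⟨l, a⟩).coeff l t q := by
  simp only [coeff_sum, coeff_arrow_mul_cons]
  rw [Finset.sum_eq_single s, Finset.sum_eq_single ⟨l, a⟩]
  · simp
  · rintro ⟨j, b⟩ - hb
    refine if_neg ?_
    rintro ⟨-, rfl, h⟩
    exact hb (by rw [Fin.ext h])
  · simp
  · intro i _ hi
    exact Finset.sum_eq_zero fun b _ => if_neg fun h => hi h.1.symm
  · simp

/-- The degree zero part. -/
def const (f : PreE K m) : PreE K m := ∑ i, f.coeff i i (.nil i) • vtx K m i

lemma coeff_sum_vtx_nil (c : ι → K) (s : ι) :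
    (∑ i, c i • vtx K m i).coeff s s (.nil s) = c s := by
  simp [coeff_sum, coeff_smul, vtx]

lemma coeff_sum_vtx_cons (c : ι → K) {s l t : ι} (a : Fin (m s l)) (q : Pth m l t) :
    (∑ i, c i • vtx K m i).coeff s t (.cons a q) = 0 := by
  simp [coeff_sum, coeff_smul, vtx]

lemma eq_const_add (f : PreE K m) :
    f = const f + ∑ i, ∑ b : Arr m i, arrow K m i b.1 b.2 * lderiv b.2 f := by
  ext s t p
  cases p with
  | nil s => rw [coeff_add, const, coeff_sum_vtx_nil, coeff_sum_arrow_mul_nil, add_zero]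
  | cons a q =>
    rw [coeff_add, const, coeff_sum_vtx_cons, coeff_sum_arrow_mul_cons, coeff_lderiv, zero_add]

lemma vtx_mul_vtx (i j : ι) : vtx K m i * vtx K m j = if i = j then vtx K m i else 0 := by
  ext s t p
  rw [coeff_vtx_mul]
  cases p with
  | nil s =>
    simp only [vtx]
    split_ifs <;> simp_all [coeff_zero]
  | cons a q => split_ifs <;> simp [vtx, coeff_zero]

lemma sum_vtx : ∑ i, vtx K m i = 1 := by
  ext s t p
  cases p with
  | nil s => simp [coeff_sum, vtx]; rfl
  | cons a q => simp [coeff_sum, vtx]; rfl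

lemma vtx_mul_arrow (l i j : ι) (k : ℕ) :
    vtx K m l * arrow K m i j k = if l = i then arrow K m i j k else 0 := by
  ext s t p
  rw [coeff_vtx_mul]
  cases p with
  | nil s => split_ifs <;> simp [arrow, coeff_zero]
  | cons a q => split_ifs <;> simp_all [arrow, coeff_zero]

lemma arrow_mul_vtx (i j : ι) (k : ℕ) : arrow K m i j k * vtx K m j = arrow K m i j k := by
  ext s t p
  rw [coeff_mul_vtx]
  cases p with
  | nil s => split_ifs <;> simp [arrow]
  | cons a q => cases q <;> split_ifs <;> simp_all [arrow]

lemma rho_eq : rho K m = ∑ i, ∑ a : Arr m i,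
    arrow K m i a.1 a.2 * (ppSign K i a.1 • arrow K m a.1 i a.2) := by
  ext s t p
  cases p with
  | nil s =>
    rw [coeff_sum_arrow_mul_nil fun i a => ppSign K i a.1 • arrow K m a.1 i a.2]
    rfl
  | @cons _ l _ a q =>
    rw [coeff_sum_arrow_mul_cons fun i a => ppSign K i a.1 • arrow K m a.1 i a.2, coeff_smul]
    cases q with
    | nil l => simp [arrow, rho]
    | cons b q =>
      cases q with
      | nil r =>
        simp only [rho, arrow, ppSign, true_and]
        by_cases h : t = s <;> by_cases h' : (a : ℕ) = b <;> simp [h, h', eq_comm]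
      | cons c q => simp [rho, arrow]

lemma rho_mul (z : PreE K m) : rho K m * z = ∑ i, ∑ a : Arr m i,
    arrow K m i a.1 a.2 * (ppSign K i a.1 • (arrow K m a.1 i a.2 * z)) := by
  rw [rho_eq]
  simp only [Finset.sum_mul, mul_assoc, smul_mul_assoc]

lemma const_mul_arrow (f : PreE K m) (i j : ι) (k : ℕ) :
    const f * arrow K m i j k = f.coeff i i (.nil i) • arrow K m i j k := by
  simp [const, Finset.sum_mul, vtx_mul_arrow]

lemma vtx_mul_rho (i : ι) : vtx K m i * rho K m = rho K m * vtx K m i := by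
  ext s t p
  rw [coeff_vtx_mul, coeff_mul_vtx]
  rcases p with _ | ⟨a, _ | ⟨b, _ | ⟨c, q⟩⟩⟩
  · rfl
  · simp [rho]
  · by_cases h : t = s
    · subst h
      rfl
    · simp [rho, h]
  · simp [rho]

lemma const_mul_rho (f : PreE K m) : const f * rho K m = rho K m * const f := by
  simp only [const, Finset.sum_mul, Finset.mul_sum, smul_mul_assoc, mul_smul_comm, vtx_mul_rho]

/-- The homogeneous component of a given degree. -/
def comp (d : ℕ) : PreE K m →ₗ[K] PreE K m where
  toFun f := ⟨fun i j p => if p.len = d then f.coeff i j p else 0⟩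
  map_add' f g := by ext i j p; simp only [coeff_add]; split_ifs <;> simp
  map_smul' c f := by ext i j p; simp only [coeff_smul, RingHom.id_apply]; split_ifs <;> simp

lemma coeff_comp (d : ℕ) (f : PreE K m) {i j : ι} (p : Pth m i j) :
    (comp d f).coeff i j p = if p.len = d then f.coeff i j p else 0 := rfl

lemma comp_mul (d : ℕ) (f g : PreE K m) :
    comp d (f * g) = ∑ x ∈ Finset.HasAntidiagonal.antidiagonal d, comp x.1 f * comp x.2 g := by
  ext i k p
  simp only [coeff_sum, coeff_comp, coeff_mul_eq_conv]
  rw [← Pth.conv_sum]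
  split_ifs with h
  · refine p.conv_congr fun j q r hqr => ?_
    rw [Finset.sum_eq_single (q.len, r.len)]
    · simp
    · rintro ⟨a, b⟩ - hab
      split_ifs with h1 h2 <;> simp_all
    · intro hx
      exact absurd (Finset.HasAntidiagonal.mem_antidiagonal.2 (hqr.trans h)) hx
  · have h0 : p.conv (fun j _ _ => (0 : K)) = 0 := by
      simpa using Pth.conv_sum (∅ : Finset Unit) p fun _ _ _ _ => (0 : K)
    refine ((p.conv_congr fun j q r hqr => ?_).trans h0).symm
    refine Finset.sum_eq_zero fun x hx => ?_
    rw [Finset.HasAntidiagonal.mem_antidiagonal] at hx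
    split_ifs with h1 h2
    · omega
    all_goals simp

lemma comp_rho (d : ℕ) : comp d (rho K m) = if d = 2 then rho K m else 0 := by
  ext s t p
  rw [coeff_comp]
  rcases p with _ | ⟨a, _ | ⟨b, _ | ⟨c, q⟩⟩⟩ <;> split_ifs <;>
    simp_all [rho, Pth.len, coeff_zero]

end PreE

end PathAlgebraLemmas

section RelationClosure

variable {K : Type} [Field K] {ι : Type} [Fintype ι] [LinearOrder ι] {m : ι → ι → ℕ}

lemma TwoSidedIdeal.algebra_smul_mem {A : Type} [Ring A] [Algebra K A] (I : TwoSidedIdeal A) (c : K)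
    {x : A} (hx : x ∈ I) : c • x ∈ I := by
  rw [Algebra.smul_def]
  exact I.mul_mem_left _ _ hx

namespace PreE

lemma rho_mem : rho K m ∈ relIdeal K m := TwoSidedIdeal.subset_span rfl

variable (K m) in
/-- The elements all of whose homogeneous components lie in the preprojective ideal. -/
def gradedClosure : TwoSidedIdeal (PreE K m) :=
  .mk' {f | ∀ d, comp d f ∈ relIdeal K m}
    (fun d => by rw [map_zero]; exact zero_mem _)
    (fun hx hy d => by rw [map_add]; exact add_mem (hx d) (hy d))
    (fun hx d => by rw [map_neg]; exact neg_mem (hx d))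
    (fun hy d => by
      rw [comp_mul]
      exact sum_mem fun _ _ => TwoSidedIdeal.mul_mem_left _ _ _ (hy _))
    (fun hx d => by
      rw [comp_mul]
      exact sum_mem fun _ _ => TwoSidedIdeal.mul_mem_right _ _ _ (hx _))

lemma mem_gradedClosure {f : PreE K m} :
    f ∈ gradedClosure K m ↔ ∀ d, comp d f ∈ relIdeal K m :=
  TwoSidedIdeal.mem_mk' ..

lemma relIdeal_le : relIdeal K m ≤ gradedClosure K m := by
  refine TwoSidedIdeal.span_le.2 (Set.singleton_subset_iff.2 (mem_gradedClosure.2 fun d => ?_))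
  rw [comp_rho]
  split_ifs
  exacts [rho_mem, zero_mem _]

lemma mem_relClosure {f : PreE K m} : f ∈ relClosure K m ↔ f ∈ gradedClosure K m := by
  rw [mem_gradedClosure]
  constructor
  · intro h d
    obtain ⟨g, hg, hfg⟩ := h (d + 1)
    have : comp d f = comp d g := by
      ext i j p
      rw [coeff_comp, coeff_comp]
      split_ifs with hp
      · exact hfg i j p (by omega)
      · rfl
    rw [this]
    exact mem_gradedClosure.1 (relIdeal_le hg) d
  · intro h n
    refine ⟨∑ d ∈ Finset.range n, comp d f, sum_mem fun d _ => h d, fun i j p hp => ?_⟩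
    simp [coeff_sum, coeff_comp, hp]

lemma ppCon_eq : ppCon K m = (gradedClosure K m).ringCon := by
  refine le_antisymm (RingCon.ringConGen_le.2 fun x y h => ?_) fun x y h => ?_
  · exact ((gradedClosure K m).rel_iff x y).2 (mem_relClosure.1 h)
  · exact RingConGen.Rel.of _ _ (mem_relClosure.2 (((gradedClosure K m).rel_iff x y).1 h))

lemma exists_decomp_of_mem_relIdeal {f : PreE K m} (hf : f ∈ relIdeal K m) :
    ∃ (z : PreE K m) (r : ∀ i, Arr m i → PreE K m), (∀ i b, r i b ∈ relIdeal K m) ∧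
      f = rho K m * z + ∑ i, ∑ b, arrow K m i b.1 b.2 * r i b := by
  let I : TwoSidedIdeal (PreE K m) := .mk'
    {f | ∃ (z : PreE K m) (r : ∀ i, Arr m i → PreE K m), (∀ i b, r i b ∈ relIdeal K m) ∧
      f = rho K m * z + ∑ i, ∑ b, arrow K m i b.1 b.2 * r i b}
    ⟨0, 0, fun _ _ => zero_mem _, by simp⟩
    (by
      rintro _ _ ⟨z, r, hr, rfl⟩ ⟨z', r', hr', rfl⟩
      refine ⟨z + z', r + r', fun i b => add_mem (hr i b) (hr' i b), ?_⟩
      simp only [Pi.add_apply, mul_add, Finset.sum_add_distrib]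
      abel)
    (by
      rintro _ ⟨z, r, hr, rfl⟩
      refine ⟨-z, -r, fun i b => neg_mem (hr i b), ?_⟩
      simp only [Pi.neg_apply, mul_neg, Finset.sum_neg_distrib, neg_add])
    (by
      rintro x _ ⟨z, r, hr, rfl⟩
      have hmem : rho K m * z + ∑ i, ∑ b, arrow K m i b.1 b.2 * r i b ∈ relIdeal K m :=
        add_mem (TwoSidedIdeal.mul_mem_right _ _ _ rho_mem)
          (sum_mem fun i _ => sum_mem fun b _ => TwoSidedIdeal.mul_mem_left _ _ _ (hr i b))
      refine ⟨const x * z, fun i b => x.coeff i i (.nil i) • r i b +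
        lderiv b.2 x * (rho K m * z + ∑ i, ∑ b, arrow K m i b.1 b.2 * r i b),
        fun i b => add_mem (TwoSidedIdeal.algebra_smul_mem _ _ (hr i b))
          (TwoSidedIdeal.mul_mem_left _ _ _ hmem), ?_⟩
      conv_lhs => rw [eq_const_add x, add_mul, mul_add, ← mul_assoc (const x), const_mul_rho,
        mul_assoc, Finset.mul_sum, Finset.sum_mul]
      simp only [mul_add (arrow K m _ _ _), Finset.sum_add_distrib, Finset.mul_sum, Finset.sum_mul,
        mul_assoc, ← mul_assoc (const x), const_mul_arrow, smul_mul_assoc, mul_smul_comm,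
        add_assoc])
    (by
      rintro _ y ⟨z, r, hr, rfl⟩
      refine ⟨z * y, fun i b => r i b * y, fun i b => TwoSidedIdeal.mul_mem_right _ _ _ (hr i b), ?_⟩
      simp only [add_mul, Finset.sum_mul, mul_assoc])
  have hmem (g : PreE K m) : g ∈ I ↔ _ := TwoSidedIdeal.mem_mk' ..
  have hI : relIdeal K m ≤ I := TwoSidedIdeal.span_le.2 (Set.singleton_subset_iff.2
    ((hmem _).2 ⟨1, 0, fun _ _ => zero_mem _, by simp⟩))
  exact (hmem f).1 (hI hf)

/-- Every element of the closed preprojective ideal is congruent to a right multiple of the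
relation modulo arrows times the closed ideal. -/
lemma exists_decomp {f : PreE K m} (hf : f ∈ gradedClosure K m) :
    ∃ (z : PreE K m) (r : ∀ i, Arr m i → PreE K m), (∀ i b, r i b ∈ gradedClosure K m) ∧
      f = rho K m * z + ∑ i, ∑ b, arrow K m i b.1 b.2 * r i b := by
  choose z r hr h using fun d => exists_decomp_of_mem_relIdeal (mem_gradedClosure.1 hf d)
  refine ⟨⟨fun s t p => (z (p.len + 2)).coeff s t p⟩,
    fun i b => ⟨fun s t p => (r (p.len + 1) i b).coeff s t p⟩, fun i b => ?_, ?_⟩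
  · refine mem_gradedClosure.2 fun d => ?_
    have : comp d ⟨fun s t p => (r (p.len + 1) i b).coeff s t p⟩ = comp d (r (d + 1) i b) := by
      ext s t p
      rw [coeff_comp, coeff_comp]
      split_ifs with hp
      · rw [← hp]
      · rfl
    rw [this]
    exact mem_gradedClosure.1 (relIdeal_le (hr _ i b)) d
  · ext s t p
    have hp : f.coeff s t p = (comp p.len f).coeff s t p := by rw [coeff_comp, if_pos rfl]
    rw [hp, h, coeff_add, coeff_add, rho_mul, rho_mul]
    cases p with
    | nil s => simp only [coeff_sum_arrow_mul_nil]
    | cons a q =>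
      rw [coeff_sum_arrow_mul_cons, coeff_sum_arrow_mul_cons, coeff_sum_arrow_mul_cons,
        coeff_sum_arrow_mul_cons, coeff_smul, coeff_smul]
      refine congrArg₂ (· + ·) (congrArg _ ?_) rfl
      cases q with
      | nil l => simp only [coeff_arrow_mul_nil]
      | cons b q => simp only [coeff_arrow_mul_cons, Pth.len]

lemma exists_of_sum_mem (i : ι) (f : Arr m i → PreE K m)
    (h : ∑ a, ppSign K i a.1 • (arrow K m i a.1 a.2 * f a) ∈ gradedClosure K m) :
    ∃ z, ∀ a, vtx K m a.1 * f a - arrow K m a.1 i a.2 * z ∈ gradedClosure K m := by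
  obtain ⟨z, r, hr, hz⟩ := exists_decomp h
  refine ⟨z, fun a => ?_⟩
  have key : vtx K m a.1 * f a - arrow K m a.1 i a.2 * z =
      ppSign K i a.1 • (vtx K m a.1 * r i a) := by
    ext s t q
    rw [coeff_sub, coeff_smul, coeff_vtx_mul, coeff_vtx_mul]
    split_ifs with hs
    · subst hs
      have h1 := congrArg (fun g => g.coeff i t (.cons a.2 q)) hz
      have h2 : ∑ a, ppSign K i a.1 • (arrow K m i a.1 a.2 * f a) = ∑ j, ∑ b : Arr m j,
          arrow K m j b.1 b.2 * (if h : j = i then ppSign K i b.1 • f (h ▸ b) else 0) := by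
        rw [Finset.sum_eq_single i]
        · simp
        · intro j _ hj
          simp [hj]
        · simp
      rw [h2, rho_mul] at h1
      simp only [coeff_add] at h1
      rw [coeff_sum_arrow_mul_cons fun j b => if h : j = i then ppSign K i b.1 • f (h ▸ b) else 0,
        coeff_sum_arrow_mul_cons, coeff_sum_arrow_mul_cons] at h1
      simp only [dite_true, coeff_smul] at h1
      have h3 := ppSign_mul_self (K := K) i a.1
      linear_combination (ppSign K i a.1) * h1 +
        ((arrow K m a.1 i a.2 * z).coeff a.1 t q - (f a).coeff a.1 t q) * h3
    · rw [mul_zero, zero_sub, neg_eq_zero]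
      cases q with
      | nil s => exact coeff_arrow_mul_nil ..
      | cons b q =>
        rw [coeff_arrow_mul_cons, if_neg fun h => hs h.1]
  rw [key]
  exact TwoSidedIdeal.algebra_smul_mem _ _ (TwoSidedIdeal.mul_mem_left _ _ _ (hr i a))

lemma sum_sign_mem (i : ι) : ∑ a : Arr m i,
    ppSign K i a.1 • (arrow K m i a.1 a.2 * arrow K m a.1 i a.2) ∈ gradedClosure K m := by
  have : ∑ a : Arr m i, ppSign K i a.1 • (arrow K m i a.1 a.2 * arrow K m a.1 i a.2) =
      vtx K m i * rho K m := by
    rw [rho_eq, Finset.mul_sum, Finset.sum_eq_single i]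
    · simp only [Finset.mul_sum, ← mul_assoc, vtx_mul_arrow, if_true, mul_smul_comm]
    · intro j _ hj
      simp only [Finset.mul_sum, ← mul_assoc, vtx_mul_arrow, if_neg hj.symm, zero_mul,
        Finset.sum_const_zero]
    · simp
  rw [this]
  exact TwoSidedIdeal.mul_mem_left _ _ _ (relIdeal_le rho_mem)

/-- The elements supported on paths of length at least `n`. -/
def fil (K : Type) [Field K] (m : ι → ι → ℕ) (n : ℕ) : Submodule K (PreE K m) where
  carrier := {f | ∀ i j (p : Pth m i j), p.len < n → f.coeff i j p = 0}
  add_mem' hf hg i j p hp := by rw [coeff_add, hf i j p hp, hg i j p hp, add_zero]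
  zero_mem' _ _ _ _ := rfl
  smul_mem' c f hf i j p hp := by rw [coeff_smul, hf i j p hp, mul_zero]

lemma mem_fil_succ {n : ℕ} {f : PreE K m} : f ∈ fil K m (n + 1) ↔
    ∃ y : ∀ i, Arr m i → PreE K m, (∀ i a, y i a ∈ fil K m n) ∧
      f = ∑ i, ∑ a, arrow K m i a.1 a.2 * y i a := by
  constructor
  · intro h
    refine ⟨fun i a => lderiv a.2 f, fun i a s t p hp => ?_, ?_⟩
    · simp only [lderiv]
      split_ifs with hs
      · subst hs
        exact h _ _ _ (by simpa [Pth.len] using hp)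
      · rfl
    · have hc : const f = 0 := Finset.sum_eq_zero fun i _ => by
        rw [h i i (.nil i) (by simp [Pth.len]), zero_smul]
      conv_lhs => rw [eq_const_add f, hc, zero_add]
  · rintro ⟨y, hy, rfl⟩ i j p hp
    cases p with
    | nil i => exact coeff_sum_arrow_mul_nil _ _
    | cons a q =>
      rw [coeff_sum_arrow_mul_cons]
      exact hy _ _ _ _ _ (by simpa [Pth.len] using hp)

lemma exists_sub_mem_fil_one (f : PreE K m) : f - const f ∈ fil K m 1 := by
  intro i j p hp
  cases p with
  | nil i => rw [coeff_sub, const, coeff_sum_vtx_nil, sub_self]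
  | cons a q => simp [Pth.len] at hp

lemma mem_gradedClosure_of_approx {f : PreE K m}
    (h : ∀ n, ∃ g ∈ gradedClosure K m, f - g ∈ fil K m n) : f ∈ gradedClosure K m := by
  refine mem_gradedClosure.2 fun d => ?_
  obtain ⟨g, hg, hfg⟩ := h (d + 1)
  have : comp d f = comp d g := by
    ext i j p
    rw [coeff_comp, coeff_comp]
    split_ifs with hp
    · exact sub_eq_zero.1 ((coeff_sub f g p).symm.trans (hfg i j p (by omega)))
    · rfl
  rw [this]
  exact mem_gradedClosure.1 hg d

lemma coeff_nil_of_mem {f : PreE K m} (hf : f ∈ gradedClosure K m) (i : ι) :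
    f.coeff i i (.nil i) = 0 := by
  obtain ⟨z, r, -, rfl⟩ := exists_decomp hf
  rw [coeff_add, rho_mul, coeff_sum_arrow_mul_nil, coeff_sum_arrow_mul_nil, add_zero]

section Reversal

variable (hsymm : ∀ i j, m i j = m j i)

/-- The anti-automorphism of the path algebra that reverses paths. -/
def rev : PreE K m →ₗ[K] PreE K m where
  toFun f := ⟨fun i j p => f.coeff j i (p.rev hsymm)⟩
  map_add' _ _ := rfl
  map_smul' _ _ := rfl

lemma coeff_rev (f : PreE K m) {i j : ι} (p : Pth m i j) :
    (rev hsymm f).coeff i j p = f.coeff j i (p.rev hsymm) := rfl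

lemma rev_rev (f : PreE K m) : rev hsymm (rev hsymm f) = f := by
  ext i j p
  rw [coeff_rev, coeff_rev, Pth.rev_rev]

lemma rev_mul (f g : PreE K m) : rev hsymm (f * g) = rev hsymm g * rev hsymm f := by
  ext i j p
  rw [coeff_rev, coeff_mul_eq_conv, coeff_mul_eq_conv, Pth.conv_rev]
  exact p.conv_congr fun l q r _ => mul_comm _ _

lemma rev_vtx (i : ι) : rev hsymm (vtx K m i) = vtx K m i := by
  ext s t p
  rw [coeff_rev]
  cases p with
  | nil s => rfl
  | cons a q =>
    have h : ∀ {s t : ι} (p : Pth m s t), p.len ≠ 0 → (vtx K m i).coeff s t p = 0 := by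
      intro s t p hp
      cases p with
      | nil s => simp [Pth.len] at hp
      | cons a q => rfl
    rw [h _ (by simp [Pth.len_rev, Pth.len]), h _ (by simp [Pth.len])]

lemma rev_arrow (i j : ι) (k : ℕ) : rev hsymm (arrow K m i j k) = arrow K m j i k := by
  have h : ∀ {i j : ι} {s t : ι} (p : Pth m s t), p.len ≠ 1 → (arrow K m i j k).coeff s t p = 0 := by
    intro i j s t p hp
    rcases p with _ | ⟨a, _ | ⟨b, q⟩⟩
    · rfl
    · simp [Pth.len] at hp
    · simp [arrow]
  ext s t p
  rw [coeff_rev]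
  by_cases hp : p.len = 1
  · rcases p with _ | ⟨a, _ | ⟨b, q⟩⟩
    · simp [Pth.len] at hp
    · simp [Pth.rev, Pth.snoc, arrow, and_left_comm]
    · simp [Pth.len] at hp
  · rw [h _ hp, h _ (by rwa [Pth.len_rev])]

lemma rev_rho : rev hsymm (rho K m) = rho K m := by
  have h : ∀ {s t : ι} (p : Pth m s t), p.len ≠ 2 → (rho K m).coeff s t p = 0 := by
    intro s t p hp
    have := congrArg (fun g => g.coeff s t p) (comp_rho (K := K) (m := m) p.len)
    simp only [coeff_comp, if_true, if_neg hp] at this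
    exact this
  ext s t p
  rw [coeff_rev]
  by_cases hp : p.len = 2
  · rcases p with _ | ⟨a, _ | ⟨b, _ | ⟨c, q⟩⟩⟩
    · simp [Pth.len] at hp
    · simp [Pth.len] at hp
    · by_cases hst : t = s
      · subst hst
        simp [Pth.rev, Pth.snoc, rho, eq_comm]
      · simp [Pth.rev, Pth.snoc, rho, hst, Ne.symm hst]
    · simp [Pth.len] at hp
  · rw [h _ hp, h _ (by rwa [Pth.len_rev])]

lemma comp_rev (d : ℕ) (f : PreE K m) : comp d (rev hsymm f) = rev hsymm (comp d f) := by
  ext i j p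
  simp only [coeff_comp, coeff_rev, Pth.len_rev]

lemma rev_mem_relIdeal {f : PreE K m} (hf : f ∈ relIdeal K m) : rev hsymm f ∈ relIdeal K m := by
  let I : TwoSidedIdeal (PreE K m) := .mk' {f | rev hsymm f ∈ relIdeal K m}
    (by rw [Set.mem_ofPred_eq, map_zero]; exact zero_mem _)
    (fun hx hy => by rw [Set.mem_ofPred_eq, map_add]; exact add_mem hx hy)
    (fun hx => by rw [Set.mem_ofPred_eq, map_neg]; exact neg_mem hx)
    (fun hy => by rw [Set.mem_ofPred_eq, rev_mul]; exact TwoSidedIdeal.mul_mem_right _ _ _ hy)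
    (fun hx => by rw [Set.mem_ofPred_eq, rev_mul]; exact TwoSidedIdeal.mul_mem_left _ _ _ hx)
  have hmem (g : PreE K m) : g ∈ I ↔ _ := TwoSidedIdeal.mem_mk' ..
  have hI : relIdeal K m ≤ I := TwoSidedIdeal.span_le.2 (Set.singleton_subset_iff.2
    ((hmem _).2 (by rw [Set.mem_ofPred_eq, rev_rho]; exact rho_mem)))
  exact (hmem f).1 (hI hf)

lemma rev_mem {f : PreE K m} (hf : f ∈ gradedClosure K m) : rev hsymm f ∈ gradedClosure K m :=
  mem_gradedClosure.2 fun d => by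
    rw [comp_rev]
    exact rev_mem_relIdeal hsymm (mem_gradedClosure.1 hf d)

lemma rev_mem_fil {n : ℕ} {f : PreE K m} (hf : f ∈ fil K m n) : rev hsymm f ∈ fil K m n :=
  fun i j p hp => hf _ _ _ (by rwa [Pth.len_rev])

lemma mem_fil_succ' (hsymm : ∀ i j, m i j = m j i) {n : ℕ} {f : PreE K m} :
    f ∈ fil K m (n + 1) ↔ ∃ y : ∀ i, Arr m i → PreE K m, (∀ i a, y i a ∈ fil K m n) ∧
      f = ∑ i, ∑ a, y i a * arrow K m a.1 i a.2 := by
  constructor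
  · intro h
    obtain ⟨y, hy, hf⟩ := mem_fil_succ.1 (rev_mem_fil hsymm h)
    refine ⟨fun i a => rev hsymm (y i a), fun i a => rev_mem_fil hsymm (hy i a), ?_⟩
    rw [← rev_rev hsymm f, hf]
    simp only [map_sum, rev_mul, rev_arrow]
  · rintro ⟨y, hy, rfl⟩
    rw [← rev_rev hsymm (∑ i, ∑ a, _)]
    refine rev_mem_fil hsymm (mem_fil_succ.2 ⟨fun i a => rev hsymm (y i a),
      fun i a => rev_mem_fil hsymm (hy i a), ?_⟩)
    simp only [map_sum, rev_mul, rev_arrow]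

lemma exists_of_sum_mem' (hsymm : ∀ i j, m i j = m j i) (i : ι) (f : Arr m i → PreE K m)
    (h : ∑ a, ppSign K i a.1 • (f a * arrow K m a.1 i a.2) ∈ gradedClosure K m) :
    ∃ z, ∀ a, f a * vtx K m a.1 - z * arrow K m i a.1 a.2 ∈ gradedClosure K m := by
  have h' := rev_mem hsymm h
  simp only [map_sum, map_smul, rev_mul, rev_arrow] at h'
  obtain ⟨z, hz⟩ := exists_of_sum_mem i _ h'
  refine ⟨rev hsymm z, fun a => ?_⟩
  have := rev_mem hsymm (hz a)
  rwa [map_sub, rev_mul, rev_mul, rev_rev, rev_vtx, rev_arrow] at this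

end Reversal

end PreE

end RelationClosure

section PreprojectiveAlgebra

variable {K : Type} [Field K] {ι : Type} [Fintype ι] [LinearOrder ι] {m : ι → ι → ℕ}

instance PPA.instAlgebra : Algebra K (PPA K m) :=
  inferInstanceAs (Algebra K (ppCon K m).Quotient)

namespace PPA

open PreE

variable (K m) in
/-- The projection from the complete path algebra. -/
def proj : PreE K m →ₐ[K] PPA K m := (ppCon K m).mkₐ K

lemma proj_surjective : Function.Surjective (proj K m) := Quotient.mk_surjective

lemma proj_eq_zero {f : PreE K m} : proj K m f = 0 ↔ f ∈ gradedClosure K m := by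
  have h : proj K m f = 0 ↔ ppCon K m f 0 := (ppCon K m).eq
  rw [h, ppCon_eq, (gradedClosure K m).rel_iff, sub_zero]

lemma proj_eq_iff {f g : PreE K m} : proj K m f = proj K m g ↔ f - g ∈ gradedClosure K m := by
  rw [← proj_eq_zero, map_sub, sub_eq_zero]

variable (K m) in
/-- The arrow filtration. -/
def fil (n : ℕ) : Submodule K (PPA K m) := (PreE.fil K m n).map (proj K m).toLinearMap

lemma mem_fil {n : ℕ} {x : PPA K m} : x ∈ fil K m n ↔ ∃ f ∈ PreE.fil K m n, proj K m f = x :=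
  Iff.rfl

/-- The complete preprojective algebra satisfies the conditions of `PPData`. -/
def ppData (hsymm : ∀ i j, m i j = m j i) : PPData K m (PPA K m) where
  e := eIdem K m
  ar i j k := proj K m (arrow K m i j k)
  L := fil K m
  e_mul_self i := by
    change proj K m (vtx K m i) * proj K m (vtx K m i) = proj K m (vtx K m i)
    rw [← map_mul, vtx_mul_vtx, if_pos rfl]
  e_mul_of_ne i j hij := by
    change proj K m (vtx K m i) * proj K m (vtx K m j) = 0
    rw [← map_mul, vtx_mul_vtx, if_neg hij, map_zero]
  sum_e := by
    change ∑ i, proj K m (vtx K m i) = 1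
    rw [← map_sum, sum_vtx, map_one]
  e_ar i j k := by
    change proj K m (vtx K m i) * _ = _
    rw [← map_mul, vtx_mul_arrow, if_pos rfl]
  ar_e i j k := by
    change _ * proj K m (vtx K m j) = _
    rw [← map_mul, arrow_mul_vtx]
  rel i := by
    simp only [← map_mul, ← map_smul, ← map_sum]
    exact proj_eq_zero.2 (sum_sign_mem i)
  L_zero := by
    refine eq_top_iff.2 fun x _ => ?_
    obtain ⟨f, rfl⟩ := proj_surjective x
    exact ⟨f, fun i j p hp => absurd hp (by omega), rfl⟩
  L_succ_right n x := by
    constructor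
    · rintro ⟨f, hf, rfl⟩
      obtain ⟨y, hy, rfl⟩ := (mem_fil_succ' hsymm).1 hf
      exact ⟨fun i a => proj K m (y i a), fun i a => ⟨_, hy i a, rfl⟩, by simp⟩
    · rintro ⟨y, hy, rfl⟩
      choose f hf hfy using hy
      exact ⟨_, (mem_fil_succ' hsymm).2 ⟨f, hf, rfl⟩, by simp [← hfy]⟩
  L_succ_left n x := by
    constructor
    · rintro ⟨f, hf, rfl⟩
      obtain ⟨y, hy, rfl⟩ := mem_fil_succ.1 hf
      exact ⟨fun i a => proj K m (y i a), fun i a => ⟨_, hy i a, rfl⟩, by simp⟩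
    · rintro ⟨y, hy, rfl⟩
      choose f hf hfy using hy
      exact ⟨_, mem_fil_succ.2 ⟨f, hf, rfl⟩, by simp [← hfy]⟩
  L_inf x hx := by
    obtain ⟨f, rfl⟩ := proj_surjective x
    refine proj_eq_zero.2 (mem_gradedClosure_of_approx fun n => ?_)
    obtain ⟨g, hg, hgf⟩ := mem_fil.1 (hx n)
    exact ⟨f - g, proj_eq_iff.1 hgf.symm, by rwa [sub_sub_cancel]⟩
  exists_scalar x := by
    obtain ⟨f, rfl⟩ := proj_surjective x
    refine ⟨fun i => f.coeff i i (.nil i), f - const f, exists_sub_mem_fil_one f, ?_⟩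
    change proj K m _ = proj K m f - ∑ i, _ • proj K m (vtx K m i)
    simp only [const, map_sub, map_sum, map_smul]
  e_not_mem c hc := by
    obtain ⟨f, hf, hfc⟩ := mem_fil.1 hc
    have h : f - ∑ i, c i • vtx K m i ∈ gradedClosure K m := by
      refine proj_eq_iff.1 (hfc.trans ?_)
      simp only [map_sum, map_smul]
      rfl
    funext i
    have := coeff_nil_of_mem h i
    rw [coeff_sub, hf i i (.nil i) Nat.one_pos, coeff_sum_vtx_nil, zero_sub, neg_eq_zero] at this
    exact this
  exact_right i t ht := by
    choose f hf using fun a => proj_surjective (t a)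
    obtain rfl : (fun a => proj K m (f a)) = t := funext hf
    simp only [← map_mul, ← map_smul, ← map_sum] at ht
    obtain ⟨z, hz⟩ := exists_of_sum_mem' hsymm i f (proj_eq_zero.1 ht)
    refine ⟨proj K m z, fun a => ?_⟩
    change _ * proj K m (vtx K m a.1) = _
    rw [← map_mul, ← map_mul]
    exact proj_eq_iff.2 (hz a)
  exact_left i t ht := by
    choose f hf using fun a => proj_surjective (t a)
    obtain rfl : (fun a => proj K m (f a)) = t := funext hf
    simp only [← map_mul, ← map_smul, ← map_sum] at ht
    obtain ⟨z, hz⟩ := exists_of_sum_mem i f (proj_eq_zero.1 ht)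
    refine ⟨proj K m z, fun a => ?_⟩
    change proj K m (vtx K m a.1) * _ = _
    rw [← map_mul, ← map_mul]
    exact proj_eq_iff.2 (hz a)

end PPA

end PreprojectiveAlgebra

namespace BiStable

variable {K A : Type} [Field K] [Ring A] [Algebra K A] {T T' : Submodule K A}

/-- A two-sided stable subspace as a two-sided ideal. -/
def toTwoSidedIdeal (hT : BiStable T) : TwoSidedIdeal A :=
  .mk' T T.zero_mem T.add_mem T.neg_mem (hT.left _) (hT.right _)

lemma mem_toTwoSidedIdeal (hT : BiStable T) {x : A} : x ∈ hT.toTwoSidedIdeal ↔ x ∈ T :=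
  TwoSidedIdeal.mem_mk' ..

lemma asIdeal_toTwoSidedIdeal (hT : BiStable T) :
    TwoSidedIdeal.asIdeal hT.toTwoSidedIdeal = hT.toIdeal := by
  ext x
  rw [TwoSidedIdeal.mem_asIdeal, mem_toTwoSidedIdeal, mem_toIdeal]

lemma span_eq_toTwoSidedIdeal (hT : BiStable T) {s : Set A} (hs : s ⊆ T)
    (h : ∀ I : TwoSidedIdeal A, s ⊆ I → ∀ x ∈ T, x ∈ I) :
    TwoSidedIdeal.span s = hT.toTwoSidedIdeal :=
  le_antisymm (TwoSidedIdeal.span_le.2 fun _ hx => hT.mem_toTwoSidedIdeal.2 (hs hx))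
    fun _ hx => h _ TwoSidedIdeal.subset_span _ (hT.mem_toTwoSidedIdeal.1 hx)

lemma tmul_toTwoSidedIdeal (hT : BiStable T) (hT' : BiStable T') (hTT' : BiStable (T * T')) :
    tmul hT.toTwoSidedIdeal hT'.toTwoSidedIdeal = hTT'.toTwoSidedIdeal := by
  refine span_eq_toTwoSidedIdeal _ ?_ fun I hI x hx => ?_
  · rintro _ ⟨a, ha, b, hb, rfl⟩
    exact Submodule.mul_mem_mul (hT.mem_toTwoSidedIdeal.1 ha) (hT'.mem_toTwoSidedIdeal.1 hb)
  · induction hx using Submodule.mul_induction_on' with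
    | mem_mul_mem a ha b hb =>
      exact hI ⟨a, hT.mem_toTwoSidedIdeal.2 ha, b, hT'.mem_toTwoSidedIdeal.2 hb, rfl⟩
    | add x _ y _ hx hy => exact add_mem hx hy

end BiStable

section Main

variable {K : Type} [Field K] {ι : Type} [Fintype ι] [LinearOrder ι] {m : ι → ι → ℕ}

lemma Igen_eq (hsymm : ∀ i j, m i j = m j i) (i : ι) :
    Igen K m i = ((PPA.ppData (K := K) hsymm).I_biStable i).toTwoSidedIdeal := by
  refine BiStable.span_eq_toTwoSidedIdeal _ ?_ fun I hI x hx => ?_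
  · rintro _ rfl
    exact Submodule.subset_span ⟨1, 1, by rw [one_mul, mul_one]; rfl⟩
  · induction hx using Submodule.span_induction with
    | mem x hx =>
      obtain ⟨a, b, rfl⟩ := hx
      exact I.mul_mem_right _ _ (I.mul_mem_left _ _ (hI rfl))
    | zero => exact zero_mem _
    | add x y _ _ hx hy => exact add_mem hx hy
    | smul c x _ hx => exact I.algebra_smul_mem c hx

lemma prodI_eq (hsymm : ∀ i j, m i j = m j i) (l : List ι) :
    prodI K m l = ((PPA.ppData (K := K) hsymm).J_biStable l).toTwoSidedIdeal := by
  induction l with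
  | nil =>
    refine (eq_top_iff.2 fun x _ => BiStable.mem_toTwoSidedIdeal _ |>.2 ?_).symm
    rw [PPData.J_nil]
    trivial
  | cons i l ih =>
    change tmul (Igen K m i) (prodI K m l) = _
    rw [ih, Igen_eq hsymm]
    simp only [PPData.J_cons]
    exact BiStable.tmul_toTwoSidedIdeal _ _ _

end Main

/-- **[BIRS, Theorem III.1.9, III.1.13]** Let `Δ` be a (connected) non-Dynkin graph
(equivalently, its Coxeter group `W` is infinite) and `Λ` the complete preprojective algebra of
`Δ` over an algebraically closed field.  Then each ideal `I_w` (`w ∈ W`) is a tilting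
`Λ`-module of projective dimension at most one, and `w ↦ I_w` is an anti-isomorphism of posets
from `W` with the right weak order (`v ≤ w ↔ ℓ(v) + ℓ(v⁻¹w) = ℓ(w)`) onto `⟨I_1, …, I_n⟩`
ordered by `S ≥ T ↔ Ext¹_Λ(S, T) = 0`. -/
theorem Iw_tilting_and_poset_antiIso
    (K : Type) [Field K] [IsAlgClosed K]
    {ι : Type} [Fintype ι] [LinearOrder ι] [Nonempty ι]
    (m : ι → ι → ℕ) (hsymm : ∀ i j, m i j = m j i) (hloop : ∀ i, m i i = 0)
    (hconn : (SimpleGraph.fromRel (fun i j => m i j ≠ 0)).Connected)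
    (Mc : CoxeterMatrix ι)
    (hMc : ∀ i j, i ≠ j → Mc i j = if m i j = 0 then 2 else if m i j = 1 then 3 else 0)
    (hNonDynkin : Infinite Mc.Group) :
    ∃ F : Mc.Group → TwoSidedIdeal (PPA K m),
      (∀ (w : Mc.Group) (l : List ι), Mc.toCoxeterSystem.wordProd l = w →
        l.length = Mc.toCoxeterSystem.length w → F w = prodI K m l) ∧
      Set.BijOn F Set.univ
        {J : TwoSidedIdeal (PPA K m) | ∃ l : List ι, J = prodI K m l} ∧
      (∀ w : Mc.Group,
        IsTiltingModule (PPA K m) (TwoSidedIdeal.asIdeal (F w) : Ideal (PPA K m))) ∧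
      (∀ v w : Mc.Group,
        (Mc.toCoxeterSystem.length v + Mc.toCoxeterSystem.length (v⁻¹ * w) =
            Mc.toCoxeterSystem.length w) ↔
          Ext1Vanishes (PPA K m) (TwoSidedIdeal.asIdeal (F v) : Ideal (PPA K m))
            (TwoSidedIdeal.asIdeal (F w) : Ideal (PPA K m))) := by
  let D := PPA.ppData (K := K) hsymm
  let cs := Mc.toCoxeterSystem
  have hM : IsCoxeterOf m Mc := hMc
  have hfree := D.leftFree cs hsymm hloop hM hconn
  have hF {l : List ι} {w : Mc.Group} (h : D.J l = D.Iw cs w) :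
      (D.Iw_biStable cs w).toTwoSidedIdeal = prodI K m l := by
    rw [prodI_eq hsymm]
    ext x
    rw [BiStable.mem_toTwoSidedIdeal, BiStable.mem_toTwoSidedIdeal, ← h]
  refine ⟨fun w => (D.Iw_biStable cs w).toTwoSidedIdeal, ?_, ⟨?_, ?_, ?_⟩, fun w => ?_,
    fun v w => ?_⟩
  · rintro _ l rfl hl
    exact hF (D.J_eq_Iw cs hsymm hloop hM hl.symm)
  · rintro w -
    exact ⟨_, hF rfl⟩
  · rintro v - w - h
    refine D.Iw_injective cs hsymm hloop hM (Submodule.ext fun x => ?_)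
    rw [← (D.Iw_biStable cs v).mem_toTwoSidedIdeal, ← (D.Iw_biStable cs w).mem_toTwoSidedIdeal]
    exact iff_of_eq (congrArg (x ∈ ·) h)
  · rintro _ ⟨l, rfl⟩
    obtain ⟨w, hw⟩ := D.exists_J_eq_Iw cs hsymm hloop hM l
    exact ⟨w, trivial, hF hw⟩
  · rw [BiStable.asIdeal_toTwoSidedIdeal]
    exact D.isTiltingModule_Iw cs hsymm hloop hM hconn w
  · rw [BiStable.asIdeal_toTwoSidedIdeal, BiStable.asIdeal_toTwoSidedIdeal]
    constructor
    · intro h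
      have := D.ext1Vanishes_Iw cs hsymm hloop hM hfree _ v (v⁻¹ * w) rfl
      rw [mul_inv_cancel_left] at this
      exact this h.symm
    · exact D.length_add_eq_of_ext1Vanishes cs hsymm hloop hM
        (D.noSocle_bot cs hsymm hloop hM hconn) hfree _ v w rfl
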